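/- Let γ ∈ (0,1/48], p > 2, let 0 ≤ m ≤ d−2 be an integer, M > 0, Λ ∈ (0,1]. Assume Ω ⊆ ℝ^d satisfies the γ-Reifenberg-flatness assumption with parameter R1 and Γ is a (γ,m)-flat separation with parameter R1, and let a_{ij} be symmetric uniformly elliptic coefficients with constant Λ. Let λ > 0, f, f_1,…,f_d ∈ L^p(Ω) ∩ L²(Ω), and let u ∈ W^{1,2}_D(Ω), with weak gradient g, be a weak solution of D_i(a_{ij}D_j u) − λu = f + D_i f_i in Ω with conormal condition on N and u = 0 on D. Then there exist constants p0 ∈ (2,p) and C > 0, depending only on d, p, M, Λ, such that for every x0 ∈ ℝ^d and every R ∈ (0,R1], ((Ū^{p0})_{B_{R/2}(x0)})^{1/p0} ≤ C·((Ū²)_{B_R(x0)})^{1/2} + C·((F̄^{p0})_{B_R(x0)})^{1/p0}, where Ū and F̄ are the extensions by zero outside Ω of U = |g| + √λ|u| and F = Σ_i|f_i| + λ^{−1/2}|f|, and (h)_E denotes the average of h over E. If moreover f ≡ 0, the analogous estimate holds with λ = 0: ((|ḡ|^{p0})_{B_{R/2}(x0)})^{1/p0} ≤ C·((|ḡ|²)_{B_R(x0)})^{1/2}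 + C·(((Σ_i|f̄_i|)^{p0})_{B_R(x0)})^{1/p0}, with ḡ, f̄_i the zero extensions of g, f_i. -/

import Mathlib

open Set Filter MeasureTheory Metric Topology

noncomputable section

/-- `ℝ^d` with the Euclidean norm. -/
abbrev Euc (d : ℕ) := EuclideanSpace ℝ (Fin d)

/-- A smooth compactly supported test function. -/
def IsTest {d : ℕ} (ζ : Euc d → ℝ) : Prop := ContDiff ℝ (⊤ : ℕ∞) ζ ∧ HasCompactSupport ζ

/-- The gradient vector of a differentiable function, as an element of `ℝ^d`. -/
def gradVec {d : ℕ} (ζ : Euc d → ℝ) (x : Euc d) : Euc d :=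
  WithLp.toLp 2 (fun i => fderiv ℝ ζ x (EuclideanSpace.single i 1) : Fin d → ℝ)

/-- The `i`-th partial derivative. -/
def pder {d : ℕ} (i : Fin d) (ζ : Euc d → ℝ) (x : Euc d) : ℝ :=
  fderiv ℝ ζ x (EuclideanSpace.single i 1)

/-- `g` is the weak gradient of `u` on the open set `V`. -/
def HasWeakGradOn {d : ℕ} (u : Euc d → ℝ) (g : Euc d → Euc d) (V : Set (Euc d)) : Prop :=
  ∀ i : Fin d, ∀ ζ : Euc d → ℝ, IsTest ζ → tsupport ζ ⊆ V →
    ∫ x in V, u x * pder i ζ x = - ∫ x in V, g x i * ζ x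

/-- `u` (with weak gradient `g`) is approximable in `W^{1,p}(V)` by smooth compactly
supported functions whose support avoids `D`; this encodes membership in `W^{1,p}_D`. -/
def ApproxWD {d : ℕ} (u : Euc d → ℝ) (g : Euc d → Euc d) (D V : Set (Euc d)) (p : ℝ) : Prop :=
  ∃ un : ℕ → Euc d → ℝ,
    (∀ n, IsTest (un n) ∧ Function.support (un n) ∩ D = ∅) ∧
    Tendsto (fun n => ∫ x in V, |un n x - u x| ^ p) atTop (nhds 0) ∧
    Tendsto (fun n => ∫ x in V, ‖gradVec (un n) x - g x‖ ^ p) atTop (nhds 0)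

/-- Membership in `W^{1,p}_D(V)` : `u, g ∈ L^p`, `g` is the weak gradient of `u` on `V`,
and `u` is approximable by smooth functions vanishing near no point of `D`. -/
def MemW1pD {d : ℕ} (u : Euc d → ℝ) (g : Euc d → Euc d) (D V : Set (Euc d)) (p : ℝ) : Prop :=
  MemLp u (ENNReal.ofReal p) (volume.restrict V) ∧
  MemLp g (ENNReal.ofReal p) (volume.restrict V) ∧
  HasWeakGradOn u g V ∧ ApproxWD u g D V p

/-- The `γ`-Reifenberg flatness assumption with parameter `R1`. -/
def ReifenbergFlat {d : ℕ} (Ω : Set (Euc d)) (γ R1 : ℝ) : Prop :=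
  ∀ x0 ∈ frontier Ω, ∀ R ∈ Set.Ioc (0 : ℝ) R1, ∃ ν : Euc d, ‖ν‖ = 1 ∧
    ({x ∈ ball x0 R | γ * R < inner ℝ (x - x0) ν} ⊆ Ω) ∧
    (Ω ∩ ball x0 R ⊆ {x | -(γ * R) < (inner ℝ (x - x0) ν : ℝ)})

/-- `M`-Lipschitz functions `ℝ^m → ℝ`. -/
def LipConst {m : ℕ} (M : ℝ) (φ : Euc m → ℝ) : Prop :=
  ∀ a b : Euc m, |φ a - φ b| ≤ M * ‖a - b‖

/-- The boundary of `Ω` is decomposed into disjoint nonempty pieces `N` (conormal part)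
and `D` (Dirichlet part). -/
def BoundarySplit {d : ℕ} (Ω N D : Set (Euc d)) : Prop :=
  frontier Ω = N ∪ D ∧ N ∩ D = ∅ ∧ N.Nonempty ∧ D.Nonempty

/-- The interface `Γ = cl N ∩ cl D` is a `(γ,m)`-flat separation with parameter `R1`:
at every point of `Γ` and scale `R ≤ R1` there are orthonormal vectors
`ν 0, …, ν (m+1)`, with `ν 0` a Reifenberg flatness direction for `Ω`, and an
`M`-Lipschitz function `φ : ℝ^m → ℝ` such that, in the corresponding coordinates,
the parts of `∂Ω ∩ B_R(x0)` lying above/below the graph of `φ` at height `±γR`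
belong to `D` resp. `N`. -/
def FlatSeparation {d : ℕ} (Ω N D : Set (Euc d)) (m : ℕ) (M γ R1 : ℝ) : Prop :=
  ∀ x0 ∈ closure N ∩ closure D, ∀ R ∈ Set.Ioc (0 : ℝ) R1,
    ∃ ν : Fin (m + 2) → Euc d, Orthonormal ℝ ν ∧
      ({x ∈ ball x0 R | γ * R < inner ℝ (x - x0) (ν 0)} ⊆ Ω) ∧
      (Ω ∩ ball x0 R ⊆ {x | -(γ * R) < (inner ℝ (x - x0) (ν 0) : ℝ)}) ∧
      ∃ φ : Euc m → ℝ, LipConst M φ ∧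
        (frontier Ω ∩ ball x0 R ∩
            {x | φ (WithLp.toLp 2 ((fun i : Fin m => (inner ℝ (x - x0) (ν ⟨i.1 + 2, by omega⟩) : ℝ)) :
                Fin m → ℝ)) + γ * R < (inner ℝ (x - x0) (ν 1) : ℝ)} ⊆ D) ∧
        (frontier Ω ∩ ball x0 R ∩
            {x | (inner ℝ (x - x0) (ν 1) : ℝ) < φ (WithLp.toLp 2 ((fun i : Fin m =>
                (inner ℝ (x - x0) (ν ⟨i.1 + 2, by omega⟩) : ℝ)) : Fin m → ℝ)) - γ * R} ⊆ N)

/-- Average of `h` over `E`. -/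
def avg {d : ℕ} (E : Set (Euc d)) (h : Euc d → ℝ) : ℝ :=
  (volume E).toReal⁻¹ * ∫ x in E, h x

/-- Symmetric, measurable, uniformly `Λ`-elliptic coefficients. -/
def EllipticSym {d : ℕ} (a : Fin d → Fin d → Euc d → ℝ) (Λ : ℝ) : Prop :=
  (∀ i j, Measurable (a i j)) ∧ (∀ i j x, a i j x = a j i x) ∧
  (∀ x : Euc d, ∀ ξ : Fin d → ℝ,
    Λ * (∑ i, ξ i ^ 2) ≤ ∑ i, ∑ j, a i j x * ξ j * ξ i ∧
      ∑ i, ∑ j, a i j x * ξ j * ξ i ≤ Λ⁻¹ * (∑ i, ξ i ^ 2))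

/-- The `(θ, R1)`-small BMO condition on `Ω`. -/
def SmallBMO {d : ℕ} (a : Fin d → Fin d → Euc d → ℝ) (Ω : Set (Euc d)) (θ R1 : ℝ) : Prop :=
  ∀ i j, ∀ x ∈ closure Ω, ∀ r ∈ Set.Ioc (0 : ℝ) R1,
    avg (Ω ∩ ball x r) (fun y => |a i j y - avg (Ω ∩ ball x r) (a i j)|) < θ

/-- `u ∈ W^{1,2}_D(Ω)` with weak gradient `g` is a weak solution of
`D_i(a_{ij} D_j u) − λ u = f + D_i f_i` in `Ω` with conormal condition
`a_{ij} D_j u n_i = f_i n_i` on `N` and `u = 0` on `D`. -/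
def WeakSolMixed {d : ℕ} (a : Fin d → Fin d → Euc d → ℝ) (lam : ℝ)
    (u : Euc d → ℝ) (g : Euc d → Euc d) (f : Euc d → ℝ) (fv : Fin d → Euc d → ℝ)
    (Ω D : Set (Euc d)) : Prop :=
  ∀ ζ : Euc d → ℝ, IsTest ζ → tsupport ζ ∩ closure D = ∅ →
    ∫ x in Ω, (-(∑ i, ∑ j, a i j x * g x j * pder i ζ x) - lam * u x * ζ x)
      = (∫ x in Ω, f x * ζ x) - ∫ x in Ω, ∑ i, fv i x * pder i ζ x

end

open Set Filter MeasureTheory Metric Topology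

/-- Volume of the unit ball. -/
noncomputable def ub (d : ℕ) : ℝ := volume.real (ball (0 : Euc d) 1)

lemma ub_pos (d : ℕ) : 0 < ub d :=
  ENNReal.toReal_pos (measure_ball_pos volume _ one_pos).ne' measure_ball_lt_top.ne

lemma vol_ball {d : ℕ} (x : Euc d) {r : ℝ} (hr : 0 < r) :
    volume.real (ball x r) = r ^ d * ub d := by
  rw [measureReal_def, Measure.addHaar_ball_of_pos volume x hr, ENNReal.toReal_mul,
    ENNReal.toReal_ofReal (by positivity)]
  simp [ub, measureReal_def]

lemma vol_ball_enn {d : ℕ} (x : Euc d) {r : ℝ} (hr : 0 < r) :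
    volume (ball x r) = ENNReal.ofReal (r ^ d * ub d) := by
  rw [← vol_ball x hr, measureReal_def, ENNReal.ofReal_toReal measure_ball_lt_top.ne]

lemma ball_ae_closedBall {d : ℕ} (x : Euc d) {r : ℝ} (hr : 0 < r) :
    (ball x r : Set (Euc d)) =ᵐ[volume] closedBall x r := by
  refine ae_eq_of_subset_of_measure_ge ball_subset_closedBall ?_ measurableSet_ball.nullMeasurableSet
    measure_closedBall_lt_top.ne
  rw [Measure.addHaar_closedBall _ _ hr.le, Measure.addHaar_ball_of_pos _ _ hr]

lemma leb_ball {d : ℕ} {f : Euc d → ℝ} (hf : LocallyIntegrable f) :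
    ∀ᵐ x : Euc d, Tendsto (fun r : ℝ => (r ^ d * ub d)⁻¹ * ∫ y in ball x r, f y) (𝓝[>] 0)
      (𝓝 (f x)) := by
  filter_upwards [(Besicovitch.vitaliFamily (volume : Measure (Euc d))).ae_tendsto_average hf]
    with x hx
  refine (hx.comp (Besicovitch.tendsto_filterAt volume x)).congr' ?_
  filter_upwards [self_mem_nhdsWithin] with r hr
  have hr' : (0 : ℝ) < r := hr
  rw [Function.comp_apply, setAverage_eq, ← setIntegral_congr_set (ball_ae_closedBall x hr'),
    measureReal_congr (ball_ae_closedBall x hr').symm, vol_ball x hr', smul_eq_mul]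

/-- Stopping radius. -/
lemma gehring_selection {d : ℕ} {U : Euc d → ℝ} {x0 : Euc d} {R : ℝ}
    (hI : IntegrableOn (fun x => U x ^ 2) (ball x0 R)) {s t K lam : ℝ} (hK : 1 ≤ K)
    (hst : s < t) (htR : t ≤ R) (hlam : 0 < lam)
    (hl : (∫ x in ball x0 R, U x ^ 2) * (6 * K) ^ d ≤ lam ^ 2 * ub d * (t - s) ^ d) :
    ∀ᵐ x : Euc d, x ∈ ball x0 s → lam < U x → ∃ r > 0, 6 * K * r ≤ t - s ∧
      lam ^ 2 * (r ^ d * ub d) < ∫ y in ball x r, U y ^ 2 ∧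
      ∀ ρ, 2 * r ≤ ρ → ρ ≤ t - s → ∫ y in ball x ρ, U y ^ 2 ≤ lam ^ 2 * (ρ ^ d * ub d) := by
  have hloc : LocallyIntegrable ((ball x0 R).indicator (fun x => U x ^ 2)) :=
    (integrable_indicator_iff measurableSet_ball |>.2 hI).locallyIntegrable
  filter_upwards [leb_ball hloc] with x hx hxs hU
  have hsub : ∀ ρ, ρ ≤ t - s → ball x ρ ⊆ ball x0 R := by
    intro ρ hρ
    apply ball_subset_ball'
    rw [mem_ball] at hxs
    linarith
  have hxR : x ∈ ball x0 R := by rw [mem_ball] at hxs ⊢; linarith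
  have hub := ub_pos d
  set S : Set ℝ := {r | 0 < r ∧ r ≤ t - s ∧ lam ^ 2 * (r ^ d * ub d) < ∫ y in ball x r, U y ^ 2}
    with hS
  have hbig : ∀ r ∈ S, 6 * K * r ≤ t - s := by
    intro r hr
    by_contra hcon
    push Not at hcon
    have h1 : ∫ y in ball x r, U y ^ 2 ≤ ∫ y in ball x0 R, U y ^ 2 :=
      setIntegral_mono_set hI (ae_of_all _ fun y => sq_nonneg _)
        (LE.le.eventuallyLE (hsub r hr.2.1))
    have h2 : (t - s) ^ d ≤ (6 * K * r) ^ d := by gcongr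
    have h3 : lam ^ 2 * ub d * (t - s) ^ d ≤ lam ^ 2 * ub d * (6 * K * r) ^ d := by gcongr
    have h4 := hr.2.2
    have h5 : (0:ℝ) < (6 * K) ^ d := by positivity
    rw [mul_pow] at h3
    have : lam ^ 2 * (r ^ d * ub d) * (6 * K) ^ d < lam ^ 2 * ub d * ((6 * K) ^ d * r ^ d) := by
      calc _ < (∫ y in ball x r, U y ^ 2) * (6 * K) ^ d := by gcongr
        _ ≤ (∫ y in ball x0 R, U y ^ 2) * (6 * K) ^ d := by gcongr
        _ ≤ _ := hl.trans h3
    exact absurd this (not_lt.2 (le_of_eq (by ring)))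
  have hne : S.Nonempty := by
    have h1 : lam ^ 2 < (ball x0 R).indicator (fun x => U x ^ 2) x := by
      rw [indicator_of_mem hxR]
      exact pow_lt_pow_left₀ hU hlam.le two_ne_zero
    have h2 := (hx.eventually (lt_mem_nhds h1)).and
      ((Ioo_mem_nhdsGT (show (0:ℝ) < t - s by linarith)))
    obtain ⟨r, hr, hr2⟩ := h2.exists
    refine ⟨r, hr2.1, hr2.2.le, ?_⟩
    rw [setIntegral_indicator measurableSet_ball,
      inter_eq_self_of_subset_left (hsub r hr2.2.le)] at hr
    have h5 : 0 < r ^ d * ub d := by have := hr2.1; positivity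
    rw [← div_eq_inv_mul, lt_div_iff₀ h5] at hr
    exact hr
  have hbdd : BddAbove S := ⟨t - s, fun r hr => hr.2.1⟩
  obtain ⟨r, hrS, hr⟩ : ∃ r ∈ S, sSup S / 2 < r := by
    apply exists_lt_of_lt_csSup hne
    obtain ⟨r, hr⟩ := hne
    have : 0 < sSup S := hr.1.trans_le (le_csSup hbdd hr)
    linarith
  refine ⟨r, hrS.1, hbig r hrS, hrS.2.2, ?_⟩
  intro ρ h1 h2
  by_contra hcon
  push Not at hcon
  have hρ : ρ ∈ S := ⟨by have := hrS.1; linarith, h2, hcon⟩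
  have := le_csSup hbdd hρ
  linarith

lemma gehring_alg {A b k η lam m X X' Y Y' W : ℝ} (hA : 0 < A) (hb : 0 < b) (hk : 0 < k)
    (h1 : 16 * A * η ^ 2 * b * k ^ 2 ≤ 1) (h2 : 8 * A * η ^ 2 * k ≤ 1)
    (hlam : 0 < lam) (hm : 0 < m) (hX0 : 0 ≤ X) (hX'0 : 0 ≤ X') (hY'0 : 0 ≤ Y')
    (hX : X ≤ η * lam * (k * m * b) + X') (hY : Y ≤ (η * lam) ^ 2 * (k * m * b) + Y')
    (hW : W ≤ lam ^ 2 * (k * m * b))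
    (hRH : lam ^ 2 * (m * b) ≤ 1 / (4 * k) * W + A / m * X ^ 2 + A * Y) :
    lam ^ 2 * m ≤ (4 * A / b + √(8 * A / b)) * (lam * X' + Y') := by
  have e1 : 1 / (4 * k) * W ≤ lam ^ 2 * (m * b) / 4 := by
    calc 1 / (4 * k) * W ≤ 1 / (4 * k) * (lam ^ 2 * (k * m * b)) := by gcongr
      _ = _ := by field_simp
  have e2 : A / m * X ^ 2 ≤ lam ^ 2 * (m * b) / 8 + 2 * A / m * X' ^ 2 := by
    have : X ^ 2 ≤ 2 * (η * lam * (k * m * b)) ^ 2 + 2 * X' ^ 2 := by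
      have : X ^ 2 ≤ (η * lam * (k * m * b) + X') ^ 2 := by gcongr
      nlinarith [sq_nonneg (η * lam * (k * m * b) - X')]
    calc A / m * X ^ 2 ≤ A / m * (2 * (η * lam * (k * m * b)) ^ 2 + 2 * X' ^ 2) := by gcongr
      _ = (16 * A * η ^ 2 * b * k ^ 2) * (lam ^ 2 * (m * b) / 8) + 2 * A / m * X' ^ 2 := by
        field_simp; ring
      _ ≤ 1 * (lam ^ 2 * (m * b) / 8) + 2 * A / m * X' ^ 2 := by gcongr
      _ = _ := by ring
  have e3 : A * Y ≤ lam ^ 2 * (m * b) / 8 + A * Y' := by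
    calc A * Y ≤ A * ((η * lam) ^ 2 * (k * m * b) + Y') := by gcongr
      _ = (8 * A * η ^ 2 * k) * (lam ^ 2 * (m * b) / 8) + A * Y' := by ring
      _ ≤ 1 * (lam ^ 2 * (m * b) / 8) + A * Y' := by gcongr
      _ = _ := by ring
  have e4 : lam ^ 2 * (m * b) / 2 ≤ 2 * A / m * X' ^ 2 + A * Y' := by linarith
  have hs : 0 ≤ √(8 * A / b) := Real.sqrt_nonneg _
  by_cases hc : lam ^ 2 * (m * b) / 4 ≤ A * Y'
  · have : lam ^ 2 * m ≤ 4 * A / b * Y' := by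
      rw [div_mul_eq_mul_div, le_div_iff₀ hb]; linarith
    have h5 : 0 ≤ 4 * A / b * (lam * X') := by positivity
    have h6 : 0 ≤ √(8 * A / b) * (lam * X' + Y') := by positivity
    linarith
  · have h7 : lam ^ 2 * (m * b) / 4 ≤ 2 * A / m * X' ^ 2 := by linarith
    have h8 : (lam * m) ^ 2 ≤ (√(8 * A / b) * X') ^ 2 := by
      rw [mul_pow (√_), Real.sq_sqrt (by positivity), div_mul_eq_mul_div, le_div_iff₀ hb]
      rw [div_mul_eq_mul_div, le_div_iff₀ hm] at h7
      nlinarith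
    have h9 : lam * m ≤ √(8 * A / b) * X' :=
      (sq_le_sq₀ (by positivity) (by positivity)).1 h8
    have h10 : lam ^ 2 * m ≤ √(8 * A / b) * (lam * X') := by nlinarith
    have h5 : 0 ≤ 4 * A / b * (lam * X' + Y') := by positivity
    have h6 : 0 ≤ √(8 * A / b) * Y' := by positivity
    linarith

/-- splitting an integral at a level -/
lemma split_level {d : ℕ} {G : Euc d → ℝ} {E : Set (Euc d)} (hE : MeasurableSet E)
    (hEf : volume E ≠ ⊤) {G0 : Euc d → ℝ} (hG0 : Measurable G0) {l c : ℝ} (hc : 0 ≤ c)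
    (hG : IntegrableOn G E) (hle : ∀ x, G0 x ≤ l → G x ≤ c) :
    ∫ x in E, G x ≤ c * volume.real E + ∫ x in E ∩ {x | l < G0 x}, G x := by
  have hm : MeasurableSet {x | l < G0 x} := measurableSet_lt measurable_const hG0
  rw [← integral_inter_add_sdiff hm hG, add_comm]
  gcongr
  calc ∫ x in E \ {x | l < G0 x}, G x ≤ ∫ x in E \ {x | l < G0 x}, c := by
        apply setIntegral_mono_on (hG.mono_set sdiff_subset)
          (integrableOn_const (measure_ne_top_of_subset sdiff_subset hEf)) (hE.diff hm)
        intro x hx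
        exact hle x (by simpa using hx.2)
    _ = c * volume.real (E \ {x | l < G0 x}) := by simp [mul_comm]
    _ ≤ c * volume.real E := by
        gcongr
        exact sdiff_subset

/-- The reverse Hölder hypothesis of the Gehring lemma. -/
def RevH {d : ℕ} (U F : Euc d → ℝ) (x0 : Euc d) (R K A : ℝ) : Prop :=
  ∀ x r, 0 < r → ball x (K * r) ⊆ ball x0 R →
    ∫ y in ball x r, U y ^ 2 ≤ 1 / (4 * K ^ d) * (∫ y in ball x (K * r), U y ^ 2)
      + A / r ^ d * (∫ y in ball x (K * r), U y) ^ 2 + A * ∫ y in ball x (K * r), F y ^ 2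

lemma integrableOn_of_sq {d : ℕ} {U : Euc d → ℝ} (hU : Measurable U) {E : Set (Euc d)}
    (hE : volume E ≠ ⊤) (hI : IntegrableOn (fun x => U x ^ 2) E) : IntegrableOn U E := by
  have : IntegrableOn (fun x => 1 + U x ^ 2) E := (integrableOn_const hE).add hI
  refine this.mono' hU.aestronglyMeasurable (ae_of_all _ fun x => ?_)
  rw [Real.norm_eq_abs]
  nlinarith [sq_nonneg (|U x| - 1), sq_abs (U x)]

lemma gehring_ball {d : ℕ} {U F : Euc d → ℝ} (hUm : Measurable U) (hFm : Measurable F)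
    (hUn : ∀ x, 0 ≤ U x) (hFn : ∀ x, 0 ≤ F x) {x0 : Euc d} {R K A η : ℝ}
    (hI : IntegrableOn (fun x => U x ^ 2) (ball x0 R))
    (hF : IntegrableOn (fun x => F x ^ 2) (ball x0 R))
    (hK : 2 ≤ K) (hA : 0 < A) (hη : 0 < η)
    (h1 : 16 * A * η ^ 2 * ub d * (K ^ d) ^ 2 ≤ 1) (h2 : 8 * A * η ^ 2 * K ^ d ≤ 1)
    (hRH : RevH U F x0 R K A) {lam : ℝ} (hlam : 0 < lam)
    {x : Euc d} {r T : ℝ} (hr : 0 < r) (hT : 6 * K * r ≤ T) (hTs : ball x T ⊆ ball x0 R)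
    (hs1 : lam ^ 2 * (r ^ d * ub d) < ∫ y in ball x r, U y ^ 2)
    (hs2 : ∀ ρ, 2 * r ≤ ρ → ρ ≤ T → ∫ y in ball x ρ, U y ^ 2 ≤ lam ^ 2 * (ρ ^ d * ub d)) :
    ∫⁻ y in ball x (6 * K * r), ENNReal.ofReal (U y ^ 2) ≤
      ENNReal.ofReal ((6 * K) ^ d * ub d * (4 * A / ub d + √(8 * A / ub d))) *
       (ENNReal.ofReal lam * (∫⁻ y in ball x (K * r) ∩ {y | η * lam < U y}, ENNReal.ofReal (U y))
        + ∫⁻ y in ball x (K * r) ∩ {y | η * lam < F y}, ENNReal.ofReal (F y ^ 2)) := by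
  have hub := ub_pos d
  have hKr : K * r ≤ T := by nlinarith
  have hsub : ball x (K * r) ⊆ ball x0 R := (ball_subset_ball hKr).trans hTs
  have hI1 := hI.mono_set hsub
  have hF1 := hF.mono_set hsub
  have hU1 := integrableOn_of_sq hUm measure_ball_lt_top.ne hI1
  have hi : IntegrableOn (fun x => U x ^ 2) (ball x (6 * K * r)) :=
    hI.mono_set ((ball_subset_ball hT).trans hTs)
  have hKr0 : 0 < K * r := by positivity
  have hX := split_level (G0 := U) (l := η * lam) (c := η * lam) measurableSet_ball
    measure_ball_lt_top.ne hUm (by positivity) hU1 (fun x h => h)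
  have hY := split_level (G0 := F) (l := η * lam) (c := (η * lam) ^ 2) measurableSet_ball
    measure_ball_lt_top.ne hFm (by positivity) hF1 (fun x h => by gcongr; exact hFn x)
  rw [vol_ball x hKr0, mul_pow K] at hX hY
  have hW := hs2 (K * r) (by nlinarith) hKr
  rw [mul_pow] at hW
  have key := gehring_alg (k := K ^ d) (m := r ^ d) hA hub (by positivity) h1 h2 hlam
    (by positivity) (setIntegral_nonneg measurableSet_ball fun x _ => hUn x)
    (setIntegral_nonneg (measurableSet_ball.inter (measurableSet_lt measurable_const hUm))
      fun x _ => hUn x)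
    (setIntegral_nonneg (measurableSet_ball.inter (measurableSet_lt measurable_const hFm))
      fun x _ => sq_nonneg _) hX hY hW (hs1.le.trans (hRH x r hr hsub))
  rw [← ofReal_integral_eq_lintegral_ofReal hi (ae_of_all _ fun x => sq_nonneg _),
    ← ofReal_integral_eq_lintegral_ofReal (hU1.mono_set inter_subset_left)
      (ae_of_all _ fun x => hUn x),
    ← ofReal_integral_eq_lintegral_ofReal (hF1.mono_set inter_subset_left)
      (ae_of_all _ fun x => sq_nonneg _), ← ENNReal.ofReal_mul hlam.le,
    ← ENNReal.ofReal_add (mul_nonneg hlam.le (integral_nonneg fun x => hUn x))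
      (integral_nonneg fun x => sq_nonneg _), ← ENNReal.ofReal_mul (by positivity)]
  apply ENNReal.ofReal_le_ofReal
  calc _ ≤ lam ^ 2 * ((6 * K * r) ^ d * ub d) := hs2 _ (by nlinarith) hT
    _ = (6 * K) ^ d * ub d * (lam ^ 2 * r ^ d) := by rw [mul_pow]; ring
    _ ≤ _ := mul_le_mul_of_nonneg_left key (by positivity)
    _ = _ := (mul_assoc _ _ _).symm

lemma gehring_level {d : ℕ} {U F : Euc d → ℝ} (hUm : Measurable U) (hFm : Measurable F)
    (hUn : ∀ x, 0 ≤ U x) (hFn : ∀ x, 0 ≤ F x) {x0 : Euc d} {R K A η : ℝ}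
    (hI : IntegrableOn (fun x => U x ^ 2) (ball x0 R))
    (hF : IntegrableOn (fun x => F x ^ 2) (ball x0 R))
    (hK : 2 ≤ K) (hA : 0 < A) (hη : 0 < η)
    (h1 : 16 * A * η ^ 2 * ub d * (K ^ d) ^ 2 ≤ 1) (h2 : 8 * A * η ^ 2 * K ^ d ≤ 1)
    (hRH : RevH U F x0 R K A) {lam s t : ℝ} (hlam : 0 < lam) (hst : s < t) (htR : t ≤ R)
    (hl : (∫ x in ball x0 R, U x ^ 2) * (6 * K) ^ d ≤ lam ^ 2 * ub d * (t - s) ^ d) :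
    ∫⁻ y in ball x0 s ∩ {y | lam < U y}, ENNReal.ofReal (U y ^ 2) ≤
      ENNReal.ofReal ((6 * K) ^ d * ub d * (4 * A / ub d + √(8 * A / ub d))) *
       (ENNReal.ofReal lam * (∫⁻ y in ball x0 t ∩ {y | η * lam < U y}, ENNReal.ofReal (U y))
        + ∫⁻ y in ball x0 t ∩ {y | η * lam < F y}, ENNReal.ofReal (F y ^ 2)) := by
  set C := ENNReal.ofReal ((6 * K) ^ d * ub d * (4 * A / ub d + √(8 * A / ub d)))
  have hGoodLam := gehring_selection hI (K := K) (by linarith) hst htR hlam hl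
  set T : Set (Euc d) := {x | x ∈ ball x0 s ∧ ∃ r > 0, 6 * K * r ≤ t - s ∧
      lam ^ 2 * (r ^ d * ub d) < ∫ y in ball x r, U y ^ 2 ∧
      ∀ ρ, 2 * r ≤ ρ → ρ ≤ t - s → ∫ y in ball x ρ, U y ^ 2 ≤ lam ^ 2 * (ρ ^ d * ub d)} with hT
  choose! rr hr0 hr1 hr2 hr3 using fun x (hx : x ∈ T) => hx.2
  obtain ⟨u, huT, hdis, hcov⟩ := Vitali.exists_disjoint_subfamily_covering_enlargement_closedBall
    T (fun x => x) (fun x => K * rr x) (t - s) (fun x hx => by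
      have := hr1 x hx; have := hr0 x hx; show K * rr x ≤ t - s
      nlinarith [mul_pos (show (0:ℝ) < K by linarith) (hr0 x hx)]) 5 (by norm_num)
  have hKr0 : ∀ x ∈ T, 0 < K * rr x := fun x hx =>
    mul_pos (by linarith) (hr0 x hx)
  have hucount : u.Countable := by
    apply hdis.countable_of_nonempty_interior
    intro x hx
    rw [interior_closedBall _ (hKr0 x (huT hx)).ne']
    exact nonempty_ball.2 (hKr0 x (huT hx))
  have hsubt : ∀ x ∈ T, ball x (K * rr x) ⊆ ball x0 t := by
    intro x hx
    apply ball_subset_ball'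
    have := hx.1
    rw [mem_ball] at this
    have := hr1 x hx
    nlinarith [hKr0 x hx]
  have hTs : ∀ x ∈ T, ball x (t - s) ⊆ ball x0 R := by
    intro x hx
    apply ball_subset_ball'
    have := hx.1
    rw [mem_ball] at this
    linarith
  have hcover : ∀ᵐ x : Euc d, x ∈ ball x0 s ∩ {y | lam < U y} →
      x ∈ ⋃ b ∈ u, ball b (6 * K * rr b) := by
    filter_upwards [hGoodLam] with x hx hx2
    have hxT : x ∈ T := ⟨hx2.1, hx hx2.1 hx2.2⟩
    obtain ⟨b, hb, hsub⟩ := hcov x hxT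
    refine mem_biUnion hb ?_
    have := hsub (mem_closedBall_self (hKr0 x hxT).le)
    rw [mem_closedBall] at this
    rw [mem_ball]
    nlinarith [hKr0 b (huT hb)]
  have hdis2 : u.PairwiseDisjoint fun a => ball a (K * rr a) :=
    hdis.mono fun a => ball_subset_closedBall
  have hsum : ∀ (G G0 : Euc d → ℝ), Measurable G0 →
      ∑' b : u, ∫⁻ y in ball b.1 (K * rr b) ∩ {y | η * lam < G0 y}, ENNReal.ofReal (G y) ≤
      ∫⁻ y in ball x0 t ∩ {y | η * lam < G0 y}, ENNReal.ofReal (G y) := by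
    intro G G0 hG0
    rw [← lintegral_biUnion hucount
      (fun b hb => measurableSet_ball.inter (measurableSet_lt measurable_const hG0))
      (hdis2.mono fun a => inter_subset_left)]
    apply lintegral_mono_set
    refine iUnion₂_subset fun b hb => ?_
    exact inter_subset_inter_left _ (hsubt b (huT hb))
  have hcu : Countable u := hucount.to_subtype
  calc ∫⁻ y in ball x0 s ∩ {y | lam < U y}, ENNReal.ofReal (U y ^ 2)
      ≤ ∫⁻ y in ⋃ b ∈ u, ball b (6 * K * rr b), ENNReal.ofReal (U y ^ 2) :=
        lintegral_mono_set' hcover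
    _ ≤ ∑' b : u, ∫⁻ y in ball b.1 (6 * K * rr b), ENNReal.ofReal (U y ^ 2) := by
        rw [biUnion_eq_iUnion]
        exact lintegral_iUnion_le _ _
    _ ≤ ∑' b : u, C * (ENNReal.ofReal lam *
          (∫⁻ y in ball b.1 (K * rr b) ∩ {y | η * lam < U y}, ENNReal.ofReal (U y))
        + ∫⁻ y in ball b.1 (K * rr b) ∩ {y | η * lam < F y}, ENNReal.ofReal (F y ^ 2)) := by
        refine ENNReal.tsum_le_tsum fun b => ?_
        have hb := huT b.2
        exact gehring_ball hUm hFm hUn hFn hI hF hK hA hη h1 h2 hRH hlam (hr0 b hb) (hr1 b hb)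
          (hTs b hb) (hr2 b hb) (hr3 b hb)
    _ ≤ _ := by
        rw [ENNReal.tsum_mul_left, ENNReal.tsum_add, ENNReal.tsum_mul_left]
        gcongr
        · exact hsum _ _ hUm
        · exact hsum (fun y => F y ^ 2) _ hFm

lemma lint_rpow {a b ε : ℝ} (ha : 0 < a) (hab : a ≤ b) (hε : 0 < ε) :
    ENNReal.ofReal ε * ∫⁻ l in Ioo a b, ENNReal.ofReal (l ^ (ε - 1)) =
      ENNReal.ofReal (b ^ ε - a ^ ε) := by
  have h0 : (0:ℝ) ∉ Set.uIcc a b := by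
    rw [uIcc_of_le hab]; intro h; linarith [h.1]
  have hi : IntegrableOn (fun l : ℝ => l ^ (ε - 1)) (Ioc a b) :=
    (intervalIntegral.intervalIntegrable_rpow (Or.inr h0)).1
  rw [setLIntegral_congr Ioo_ae_eq_Ioc, ← ofReal_integral_eq_lintegral_ofReal hi,
    ← intervalIntegral.integral_of_le hab, integral_rpow (Or.inr ⟨by linarith, h0⟩),
    ← ENNReal.ofReal_mul hε.le]
  · congr 1
    simp
    field_simp
  · filter_upwards [ae_restrict_mem measurableSet_Ioc] with l hl
    exact Real.rpow_nonneg (ha.trans hl.1).le _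

lemma lint_ite {a L y : ℝ} (w : ℝ → ENNReal) :
    ∫⁻ l in Ioo a L, (if l < y then w l else 0) = ∫⁻ l in Ioo a (min y L), w l := by
  have : Ioo a (min y L) = {l | l < y} ∩ Ioo a L := by
    ext l; simp only [mem_Ioo, mem_inter_iff, mem_ofPred_eq, lt_min_iff]; tauto
  have hm : MeasurableSet {l : ℝ | l < y} := measurableSet_lt measurable_id measurable_const
  rw [this, ← Measure.restrict_restrict hm, ← lintegral_indicator hm]
  rfl

lemma lam_one {a L y ε : ℝ} (ha : 0 < a) (hL : 0 < L) (hy : 0 ≤ y) (hε : 0 < ε) :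
    ENNReal.ofReal (min y L ^ ε) ≤ ENNReal.ofReal (a ^ ε) + ENNReal.ofReal ε *
      ∫⁻ l in Ioo a L, (if l < y then ENNReal.ofReal (l ^ (ε - 1)) else 0) := by
  rw [lint_ite]
  rcases le_total a (min y L) with h | h
  · rw [lint_rpow ha h hε, ← ENNReal.ofReal_add (by positivity)]
    · simp
    · rw [sub_nonneg]; gcongr
  · refine le_trans (ENNReal.ofReal_le_ofReal ?_) le_self_add
    gcongr

lemma lam_three {a L y ε η : ℝ} (ha : 0 < a) (hy : 0 ≤ y) (hε : 0 < ε) (hε1 : ε ≤ 1)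
    (hη : 0 < η) (hη1 : η ≤ 1) :
    ENNReal.ofReal ε * ∫⁻ l in Ioo a L, (if η * l < y then ENNReal.ofReal (l ^ (ε - 1)) else 0)
      ≤ ENNReal.ofReal (η⁻¹ * y ^ ε) := by
  have : ∀ l, (η * l < y) = (l < y / η) := fun l => by rw [lt_div_iff₀ hη, mul_comm]
  simp_rw [this]
  rw [lint_ite]
  rcases le_total a (min (y / η) L) with h | h
  · rw [lint_rpow ha h hε]
    apply ENNReal.ofReal_le_ofReal
    have h1 : (min (y / η) L) ^ ε ≤ (y / η) ^ ε := by
      gcongr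
      · linarith
      · exact min_le_left _ _
    have h2 : (y / η) ^ ε ≤ η⁻¹ * y ^ ε := by
      rw [Real.div_rpow hy hη.le, div_eq_inv_mul]
      gcongr
      calc η = η ^ (1:ℝ) := (Real.rpow_one η).symm
        _ ≤ η ^ ε := Real.rpow_le_rpow_of_exponent_ge hη hη1 hε1
    have := Real.rpow_nonneg ha.le ε
    linarith
  · rw [Ioo_eq_empty (not_lt.2 h)]; simp

lemma lam_two {a L y ε η : ℝ} (ha : 0 < a) (hy : 0 ≤ y) (hε : 0 < ε) (hε1 : ε ≤ 1)
    (hη : 0 < η) (hη1 : η ≤ 1) (hL : 0 < L) :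
    ∫⁻ l in Ioo a L, (if η * l < y then ENNReal.ofReal (l ^ (ε - 1)) * ENNReal.ofReal l else 0)
      ≤ ENNReal.ofReal ((η ^ 2)⁻¹ * (y * min y L ^ ε)) := by
  have : ∀ l, (η * l < y) = (l < y / η) := fun l => by rw [lt_div_iff₀ hη, mul_comm]
  simp_rw [this]
  rw [lint_ite]
  have h3 : min (y / η) L ≤ η⁻¹ * min y L := by
    rw [mul_min_of_nonneg _ _ (by positivity)]
    refine min_le_min (by rw [div_eq_inv_mul]) ?_
    have : 1 ≤ η⁻¹ := (one_le_inv₀ hη).2 hη1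
    nlinarith
  calc ∫⁻ l in Ioo a (min (y / η) L), ENNReal.ofReal (l ^ (ε - 1)) * ENNReal.ofReal l
      ≤ ∫⁻ l in Ioo a (min (y / η) L), ENNReal.ofReal (η⁻¹ * min y L ^ ε) := by
        apply setLIntegral_mono measurable_const
        intro l hl
        have hl0 : 0 < l := ha.trans hl.1
        rw [← ENNReal.ofReal_mul (by positivity)]
        apply ENNReal.ofReal_le_ofReal
        calc l ^ (ε - 1) * l = l ^ ε := by
              rw [Real.rpow_sub_one hl0.ne']; field_simp
          _ ≤ (η⁻¹ * min y L) ^ ε := by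
              gcongr; exact hl.2.le.trans h3
          _ = (η⁻¹) ^ ε * min y L ^ ε := Real.mul_rpow (by positivity) (le_min hy hL.le)
          _ ≤ η⁻¹ * min y L ^ ε := by
              gcongr
              calc (η⁻¹) ^ ε ≤ (η⁻¹) ^ (1:ℝ) :=
                    Real.rpow_le_rpow_of_exponent_le ((one_le_inv₀ hη).2 hη1) hε1
                _ = _ := Real.rpow_one _
    _ = ENNReal.ofReal (η⁻¹ * min y L ^ ε) * ENNReal.ofReal (min (y / η) L - a) := by
        rw [setLIntegral_const, Real.volume_Ioo]
    _ ≤ ENNReal.ofReal (η⁻¹ * min y L ^ ε) * ENNReal.ofReal (η⁻¹ * y) := by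
        gcongr
        have := min_le_left (y / η) L
        rw [div_eq_inv_mul] at this ⊢
        linarith
    _ = _ := by
        have : 0 ≤ min y L := le_min hy hL.le
        rw [← ENNReal.ofReal_mul (by positivity)]
        congr 1; field_simp

lemma set_ite {d : ℕ} (E : Set (Euc d)) {G0 : Euc d → ℝ} (hG0 : Measurable G0) (l : ℝ)
    (G : Euc d → ENNReal) :
    ∫⁻ x in E ∩ {x | l < G0 x}, G x = ∫⁻ x in E, (if l < G0 x then G x else 0) := by
  rw [inter_comm, ← Measure.restrict_restrict (measurableSet_lt measurable_const hG0),
    ← lintegral_indicator (measurableSet_lt measurable_const hG0)]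
  rfl

lemma swap_ite {d : ℕ} (E : Set (Euc d)) {G0 : Euc d → ℝ} (hG0 : Measurable G0) {η : ℝ}
    {G : Euc d → ENNReal} (hG : Measurable G) {w : ℝ → ENNReal} (hw : Measurable w) (a L : ℝ) :
    ∫⁻ l in Ioo a L, w l * ∫⁻ x in E ∩ {x | η * l < G0 x}, G x =
     ∫⁻ x in E, G x * ∫⁻ l in Ioo a L, (if η * l < G0 x then w l else 0) := by
  have hm : MeasurableSet {q : ℝ × Euc d | η * q.1 < G0 q.2} :=
    measurableSet_lt (measurable_fst.const_mul _) (hG0.comp measurable_snd)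
  have e1 : ∀ l, w l * ∫⁻ x in E ∩ {x | η * l < G0 x}, G x =
      ∫⁻ x in E, (if η * l < G0 x then w l * G x else 0) := by
    intro l
    rw [set_ite E hG0, ← lintegral_const_mul]
    · congr 1; ext x; split_ifs <;> simp
    · exact Measurable.ite (measurableSet_lt measurable_const hG0) hG measurable_const
  have e2 : ∀ x, G x * ∫⁻ l in Ioo a L, (if η * l < G0 x then w l else 0) =
      ∫⁻ l in Ioo a L, (if η * l < G0 x then w l * G x else 0) := by
    intro x
    rw [← lintegral_const_mul]
    · congr 1; ext x; split_ifs <;> simp [mul_comm]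
    · exact Measurable.ite (measurableSet_lt (measurable_id.const_mul _) measurable_const) hw
        measurable_const
  simp_rw [e1, e2]
  apply lintegral_lintegral_swap
  apply Measurable.aemeasurable
  exact Measurable.ite hm ((hw.comp measurable_fst).mul (hG.comp measurable_snd)) measurable_const

/-- One step of the Gehring iteration. -/
lemma gehring_step {d : ℕ} {U F : Euc d → ℝ} (hUm : Measurable U) (hFm : Measurable F)
    (hUn : ∀ x, 0 ≤ U x) (hFn : ∀ x, 0 ≤ F x) {x0 : Euc d} {R K A η : ℝ}
    (hI : IntegrableOn (fun x => U x ^ 2) (ball x0 R))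
    (hF : IntegrableOn (fun x => F x ^ 2) (ball x0 R))
    (hK : 2 ≤ K) (hA : 0 < A) (hη : 0 < η) (hη1 : η ≤ 1)
    (h1 : 16 * A * η ^ 2 * ub d * (K ^ d) ^ 2 ≤ 1) (h2 : 8 * A * η ^ 2 * K ^ d ≤ 1)
    (hRH : RevH U F x0 R K A) {a s t ε L C : ℝ} (ha : 0 < a) (hst : s < t) (htR : t ≤ R)
    (hε : 0 < ε) (hε1 : ε ≤ 1) (hL : 0 < L)
    (hC : C = (6 * K) ^ d * ub d * (4 * A / ub d + √(8 * A / ub d)))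
    (hl : (∫ x in ball x0 R, U x ^ 2) * (6 * K) ^ d ≤ a ^ 2 * ub d * (t - s) ^ d) :
    ∫⁻ x in ball x0 s, ENNReal.ofReal (U x ^ 2 * min (U x) L ^ ε) ≤
      ENNReal.ofReal (a ^ ε) * (∫⁻ x in ball x0 R, ENNReal.ofReal (U x ^ 2)) +
      ENNReal.ofReal (ε * C * (η ^ 2)⁻¹) *
        (∫⁻ x in ball x0 t, ENNReal.ofReal (U x ^ 2 * min (U x) L ^ ε)) +
      ENNReal.ofReal (C * η⁻¹) * ∫⁻ x in ball x0 R, ENNReal.ofReal (F x ^ 2 * F x ^ ε) := by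
  have hub := ub_pos d
  have hC0 : 0 ≤ C := by rw [hC]; positivity
  set w : ℝ → ENNReal := fun l => ENNReal.ofReal (l ^ (ε - 1)) with hwd
  have hw : Measurable w := by fun_prop
  have hU2 : Measurable fun x => ENNReal.ofReal (U x ^ 2) := by fun_prop
  have hU1 : Measurable fun x => ENNReal.ofReal (U x) := by fun_prop
  have hF2 : Measurable fun x => ENNReal.ofReal (F x ^ 2) := by fun_prop
  have hsw := swap_ite (ball x0 s) hUm (η := 1) hU2 hw a L
  simp only [one_mul] at hsw
  have hmin : ∀ x, 0 ≤ min (U x) L := fun x => le_min (hUn x) hL.le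
  calc ∫⁻ x in ball x0 s, ENNReal.ofReal (U x ^ 2 * min (U x) L ^ ε)
      ≤ ∫⁻ x in ball x0 s, (ENNReal.ofReal (a ^ ε) * ENNReal.ofReal (U x ^ 2) +
          ENNReal.ofReal ε * (ENNReal.ofReal (U x ^ 2) *
            ∫⁻ l in Ioo a L, (if l < U x then w l else 0))) := by
        apply lintegral_mono
        intro x
        show ENNReal.ofReal (U x ^ 2 * min (U x) L ^ ε) ≤ _
        rw [ENNReal.ofReal_mul (sq_nonneg _)]
        have := mul_le_mul_right (lam_one ha hL (hUn x) hε) (ENNReal.ofReal (U x ^ 2))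
        refine this.trans (le_of_eq ?_)
        rw [mul_add, mul_comm (ENNReal.ofReal (U x ^ 2)) (ENNReal.ofReal (a ^ ε)), mul_left_comm]
    _ ≤ ENNReal.ofReal (a ^ ε) * (∫⁻ x in ball x0 s, ENNReal.ofReal (U x ^ 2)) +
          ENNReal.ofReal ε * ∫⁻ x in ball x0 s, (ENNReal.ofReal (U x ^ 2) *
            ∫⁻ l in Ioo a L, (if l < U x then w l else 0)) := by
        rw [lintegral_add_left (hU2.const_mul _), lintegral_const_mul _ hU2,
          lintegral_const_mul' _ _ ENNReal.ofReal_ne_top]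
    _ ≤ ENNReal.ofReal (a ^ ε) * (∫⁻ x in ball x0 R, ENNReal.ofReal (U x ^ 2)) +
          ENNReal.ofReal ε * ∫⁻ l in Ioo a L, w l * (ENNReal.ofReal C *
       (ENNReal.ofReal l * (∫⁻ y in ball x0 t ∩ {y | η * l < U y}, ENNReal.ofReal (U y))
        + ∫⁻ y in ball x0 t ∩ {y | η * l < F y}, ENNReal.ofReal (F y ^ 2))) := by
        rw [← hsw]
        gcongr ENNReal.ofReal (a ^ ε) * ?_ + ENNReal.ofReal ε * ?_
        · exact lintegral_mono_set (ball_subset_ball (by linarith))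
        · refine setLIntegral_mono' measurableSet_Ioo fun l hl => ?_
          have hl0 : 0 < l := ha.trans hl.1
          gcongr
          rw [hC]
          refine gehring_level hUm hFm hUn hFn hI hF hK hA hη h1 h2 hRH hl0 hst htR
            (le_trans ‹_› ?_)
          have := hl.1
          have : 0 < (t - s) := by linarith
          gcongr
    _ = ENNReal.ofReal (a ^ ε) * (∫⁻ x in ball x0 R, ENNReal.ofReal (U x ^ 2)) +
          ENNReal.ofReal ε * (ENNReal.ofReal C * (
            (∫⁻ l in Ioo a L, (w l * ENNReal.ofReal l) *
              ∫⁻ y in ball x0 t ∩ {y | η * l < U y}, ENNReal.ofReal (U y)) +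
            ∫⁻ l in Ioo a L, w l *
              ∫⁻ y in ball x0 t ∩ {y | η * l < F y}, ENNReal.ofReal (F y ^ 2))) := by
        congr 2
        rw [← lintegral_add_left', ← lintegral_const_mul' _ _ ENNReal.ofReal_ne_top]
        · congr 1; ext l; ring
        · apply Measurable.aemeasurable
          apply (hw.mul ENNReal.measurable_ofReal).mul
          simp_rw [set_ite (ball x0 t) hUm]
          apply Measurable.lintegral_prod_right'
            (f := fun q : ℝ × Euc d => if η * q.1 < U q.2 then ENNReal.ofReal (U q.2) else 0)
          exact Measurable.ite (measurableSet_lt (measurable_fst.const_mul _)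
            (hUm.comp measurable_snd)) (hU1.comp measurable_snd) measurable_const
    _ = ENNReal.ofReal (a ^ ε) * (∫⁻ x in ball x0 R, ENNReal.ofReal (U x ^ 2)) +
          (ENNReal.ofReal ε * ENNReal.ofReal C *
            (∫⁻ y in ball x0 t, ENNReal.ofReal (U y) *
              ∫⁻ l in Ioo a L, (if η * l < U y then w l * ENNReal.ofReal l else 0)) +
           ENNReal.ofReal C * ∫⁻ y in ball x0 t, ENNReal.ofReal (F y ^ 2) *
              (ENNReal.ofReal ε * ∫⁻ l in Ioo a L, (if η * l < F y then w l else 0))) := by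
        rw [swap_ite (ball x0 t) hUm hU1 (w := fun l => w l * ENNReal.ofReal l)
            (hw.mul ENNReal.measurable_ofReal),
          swap_ite (ball x0 t) hFm hF2 hw]
        congr 1
        rw [mul_add, mul_add, mul_assoc, mul_left_comm (ENNReal.ofReal ε) (ENNReal.ofReal C)
          (∫⁻ y in ball x0 t, ENNReal.ofReal (F y ^ 2) * _)]
        congr 2
        rw [← lintegral_const_mul' _ _ ENNReal.ofReal_ne_top]
        congr 1; ext y; ring
    _ ≤ ENNReal.ofReal (a ^ ε) * (∫⁻ x in ball x0 R, ENNReal.ofReal (U x ^ 2)) +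
          (ENNReal.ofReal ε * ENNReal.ofReal C *
            (∫⁻ y in ball x0 t, ENNReal.ofReal (U y) *
              ENNReal.ofReal ((η ^ 2)⁻¹ * (U y * min (U y) L ^ ε))) +
           ENNReal.ofReal C * ∫⁻ y in ball x0 R, ENNReal.ofReal (F y ^ 2) *
              ENNReal.ofReal (η⁻¹ * F y ^ ε)) := by
        gcongr with y y
        · exact lam_two ha (hUn y) hε hε1 hη hη1 hL
        · exact lam_three ha (hFn y) hε hε1 hη hη1
    _ = _ := by
        have e1 : (∫⁻ y in ball x0 t, ENNReal.ofReal (U y) *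
              ENNReal.ofReal ((η ^ 2)⁻¹ * (U y * min (U y) L ^ ε))) = ENNReal.ofReal ((η ^ 2)⁻¹) *
              ∫⁻ x in ball x0 t, ENNReal.ofReal (U x ^ 2 * min (U x) L ^ ε) := by
          rw [← lintegral_const_mul' _ _ ENNReal.ofReal_ne_top]
          apply lintegral_congr
          intro y
          rw [← ENNReal.ofReal_mul (hUn y), ← ENNReal.ofReal_mul (by positivity)]
          congr 1; ring
        have e2 : (∫⁻ y in ball x0 R, ENNReal.ofReal (F y ^ 2) *
              ENNReal.ofReal (η⁻¹ * F y ^ ε)) = ENNReal.ofReal (η⁻¹) *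
              ∫⁻ x in ball x0 R, ENNReal.ofReal (F x ^ 2 * F x ^ ε) := by
          rw [← lintegral_const_mul' _ _ ENNReal.ofReal_ne_top]
          apply lintegral_congr
          intro y
          rw [← ENNReal.ofReal_mul (sq_nonneg _), ← ENNReal.ofReal_mul (by positivity)]
          congr 1; ring
        rw [e1, e2, ENNReal.ofReal_mul (by positivity), ENNReal.ofReal_mul hε.le,
          ENNReal.ofReal_mul hC0]
        ring

lemma iter_half {ψ : ℕ → ENNReal} {Y B : ENNReal} (hB : B ≠ ⊤) (hψ : ∀ k, ψ k ≤ B)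
    (h : ∀ k, ψ k ≤ ENNReal.ofReal ((3/2)^k) * Y + ENNReal.ofReal (1/2) * ψ (k+1)) :
    ψ 0 ≤ 4 * Y := by
  have key : ∀ n : ℕ, ψ 0 ≤ ENNReal.ofReal (4 - 4 * (3/4)^n) * Y +
      ENNReal.ofReal ((1/2)^n) * ψ n := by
    intro n
    induction n with
    | zero => simp
    | succ n ih =>
      have hp : ((3:ℝ)/4)^n ≤ 1 := pow_le_one₀ (by norm_num) (by norm_num)
      calc ψ 0 ≤ _ := ih
        _ ≤ ENNReal.ofReal (4 - 4 * (3/4)^n) * Y + ENNReal.ofReal ((1/2)^n) *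
            (ENNReal.ofReal ((3/2)^n) * Y + ENNReal.ofReal (1/2) * ψ (n+1)) := by
          gcongr; exact h n
        _ = (ENNReal.ofReal (4 - 4 * (3/4)^n) + ENNReal.ofReal ((1/2)^n) *
            ENNReal.ofReal ((3/2)^n)) * Y + (ENNReal.ofReal ((1/2)^n) * ENNReal.ofReal (1/2)) *
              ψ (n+1) := by ring
        _ = _ := by
          rw [← ENNReal.ofReal_mul (by positivity), ← ENNReal.ofReal_mul (by positivity),
            ← ENNReal.ofReal_add (by linarith) (by positivity), ← pow_succ, ← mul_pow]
          congr 3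
          rw [pow_succ]; norm_num; ring
  have key2 : ∀ n : ℕ, ψ 0 ≤ 4 * Y + ENNReal.ofReal ((1/2)^n) * B := by
    intro n
    refine (key n).trans ?_
    gcongr
    · rw [show (4:ENNReal) = ENNReal.ofReal 4 by simp]
      apply ENNReal.ofReal_le_ofReal
      have : (0:ℝ) ≤ (3/4)^n := by positivity
      linarith
    · exact hψ n
  have lim : Tendsto (fun n : ℕ => 4 * Y + ENNReal.ofReal ((1/2)^n) * B) atTop
      (𝓝 (4 * Y + 0)) := by
    apply Tendsto.const_add
    have : Tendsto (fun n : ℕ => ENNReal.ofReal ((1/2)^n)) atTop (𝓝 0) := by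
      rw [← ENNReal.ofReal_zero]
      exact ENNReal.tendsto_ofReal (tendsto_pow_atTop_nhds_zero_of_lt_one (by norm_num)
        (by norm_num))
    have h2 := ENNReal.Tendsto.mul_const (b := B) this (Or.inr hB)
    simpa using h2
  rw [add_zero] at lim
  exact ge_of_tendsto' lim key2

set_option maxHeartbeats 1600000 in
theorem gehring (d : ℕ) (hd : 1 ≤ d) (K A p : ℝ) (hK : 2 ≤ K) (hA : 0 < A) (hp : 2 < p) :
    ∃ ε : ℝ, 0 < ε ∧ 2 + ε < p ∧ ∃ C > (0:ℝ), ∀ (U F : Euc d → ℝ) (_ : Measurable U)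
      (_ : Measurable F) (_ : ∀ x, 0 ≤ U x) (_ : ∀ x, 0 ≤ F x) (x0 : Euc d) (R : ℝ) (_ : 0 < R)
      (_ : IntegrableOn (fun x => U x ^ 2) (ball x0 R))
      (_ : IntegrableOn (fun x => F x ^ 2) (ball x0 R)) (_ : RevH U F x0 R K A),
      ∫⁻ x in ball x0 (R / 2), ENNReal.ofReal (U x ^ (2 + ε)) ≤
        ENNReal.ofReal (C * (((∫ x in ball x0 R, U x ^ 2) / R ^ d) ^ (ε / 2) *
          ∫ x in ball x0 R, U x ^ 2)) + ENNReal.ofReal C *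
          ∫⁻ x in ball x0 R, ENNReal.ofReal (F x ^ (2 + ε)) := by
  have hub := ub_pos d
  have hK0 : 0 < K := by linarith
  obtain ⟨η, hη, hη1, h1, h2⟩ : ∃ η : ℝ, 0 < η ∧ η ≤ 1 ∧
      16 * A * η ^ 2 * ub d * (K ^ d) ^ 2 ≤ 1 ∧ 8 * A * η ^ 2 * K ^ d ≤ 1 := by
    set X := 16 * A * ub d * (K ^ d) ^ 2 + 8 * A * K ^ d + 1 with hX
    have hX1 : 1 ≤ X := by rw [hX]; have : 0 ≤ 16 * A * ub d * (K ^ d) ^ 2 + 8 * A * K ^ d := by positivity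
                           linarith
    have hXp : 0 < X := by linarith
    have hη2 : (X⁻¹)^2 ≤ X⁻¹ := by
      have : X⁻¹ ≤ 1 := inv_le_one_of_one_le₀ hX1
      have h0 : 0 < X⁻¹ := by positivity
      nlinarith
    refine ⟨X⁻¹, by positivity, inv_le_one_of_one_le₀ hX1, ?_, ?_⟩
    · calc 16 * A * (X⁻¹)^2 * ub d * (K ^ d) ^ 2 = (16 * A * ub d * (K ^ d) ^ 2) * (X⁻¹)^2 := by ring
        _ ≤ X * X⁻¹ := by
          gcongr
          rw [hX]; have : 0 ≤ 8 * A * K ^ d := by positivity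
          linarith
        _ = 1 := mul_inv_cancel₀ hXp.ne'
    · calc 8 * A * (X⁻¹)^2 * (K ^ d) = (8 * A * (K ^ d)) * (X⁻¹)^2 := by ring
        _ ≤ X * X⁻¹ := by
          gcongr
          rw [hX]; have : 0 ≤ 16 * A * ub d * (K ^ d) ^ 2 := by positivity
          linarith
        _ = 1 := mul_inv_cancel₀ hXp.ne'
  set C1 := (6 * K) ^ d * ub d * (4 * A / ub d + √(8 * A / ub d)) with hC1
  have hC1p : 0 < C1 := by rw [hC1]; positivity
  have hd' : (0:ℝ) < d := by exact_mod_cast hd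
  obtain ⟨ε, hε, hε1, hεd, hεC, hεp⟩ : ∃ ε : ℝ, 0 < ε ∧ ε ≤ 1 ∧ d * ε ≤ 1/2 ∧
      ε * C1 * (η ^ 2)⁻¹ ≤ 1/2 ∧ 2 + ε < p := by
    set Z := 2 * (d:ℝ) + 2 * C1 * (η ^ 2)⁻¹ + 1 + 2 / (p - 2) with hZ
    have hp2 : 0 < p - 2 := by linarith
    have t1 : 0 < 2 * C1 * (η ^ 2)⁻¹ := by positivity
    have t2 : 0 < 2 / (p - 2) := by positivity
    have hZp : 0 < Z := by rw [hZ]; linarith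
    refine ⟨Z⁻¹, by positivity, inv_le_one_of_one_le₀ (by rw [hZ]; linarith), ?_, ?_, ?_⟩
    · rw [← div_eq_mul_inv, div_le_iff₀ hZp]; linarith
    · rw [mul_assoc, mul_comm, ← div_eq_mul_inv, div_le_iff₀ hZp]; linarith
    · have : Z⁻¹ < p - 2 := by
        rw [inv_lt_comm₀ hZp hp2]
        have : 2 / (p-2) = 2 * (p-2)⁻¹ := by ring
        have : 0 < (p-2)⁻¹ := by positivity
        linarith
      linarith
  set c2 : ℝ := ((24 * K) ^ d / ub d) ^ (ε / 2) with hc2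
  have hc2p : 0 < c2 := by rw [hc2]; positivity
  refine ⟨ε, hε, hεp, 4 * c2 + 4 * (C1 * η⁻¹), by positivity, ?_⟩
  intro U F hUm hFm hUn hFn x0 R hR hI hF hRH
  set I := ∫ x in ball x0 R, U x ^ 2 with hIdef
  have hI0 : 0 ≤ I := integral_nonneg fun x => sq_nonneg _
  have hUI : ∫⁻ x in ball x0 R, ENNReal.ofReal (U x ^ 2) = ENNReal.ofReal I := by
    rw [hIdef, ofReal_integral_eq_lintegral_ofReal hI (ae_of_all _ fun x => sq_nonneg _)]
  have e2 : ∀ y : ℝ, 0 ≤ y → y ^ 2 * y ^ ε = y ^ (2 + ε) := by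
    intro y hy
    rw [Real.rpow_add_of_nonneg hy (by norm_num) hε.le]; norm_num
  rcases hI0.eq_or_lt with hI00 | hIp
  · have hz : ∫⁻ x in ball x0 R, ENNReal.ofReal (U x ^ 2) = 0 := by rw [hUI, ← hI00]; simp
    rw [lintegral_eq_zero_iff (by fun_prop)] at hz
    have : ∫⁻ x in ball x0 (R / 2), ENNReal.ofReal (U x ^ (2 + ε)) = 0 := by
      rw [lintegral_eq_zero_iff (by fun_prop)]
      filter_upwards [ae_restrict_of_ae_restrict_of_subset
        (ball_subset_ball (by linarith : R/2 ≤ R)) hz] with x hx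
      have hx' : U x ^ 2 ≤ 0 := ENNReal.ofReal_eq_zero.1 hx
      have : U x = 0 := by nlinarith [hUn x]
      rw [this, Real.zero_rpow (by linarith)]; simp
    rw [this]; exact zero_le
  set b := √(I * (24 * K) ^ d / (ub d * R ^ d)) with hb
  have hbp : 0 < b := by rw [hb]; positivity
  have hb2 : b ^ 2 = I * (24 * K) ^ d / (ub d * R ^ d) := Real.sq_sqrt (by positivity)
  have hbε : b ^ ε = c2 * (I / R ^ d) ^ (ε / 2) := by
    rw [hb, Real.sqrt_eq_rpow, ← Real.rpow_mul (by positivity), hc2,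
      ← Real.mul_rpow (by positivity) (by positivity)]
    congr 1
    · field_simp
    · ring
  set J := ∫⁻ x in ball x0 R, ENNReal.ofReal (F x ^ (2 + ε)) with hJ
  have hJ' : ∫⁻ x in ball x0 R, ENNReal.ofReal (F x ^ 2 * F x ^ ε) = J := by
    rw [hJ]; apply lintegral_congr; intro x; rw [e2 _ (hFn x)]
  set Y := ENNReal.ofReal (b ^ ε) * ENNReal.ofReal I + ENNReal.ofReal (C1 * η⁻¹) * J with hY
  have main : ∀ L : ℝ, 0 < L →
      ∫⁻ x in ball x0 (R/2), ENNReal.ofReal (U x ^ 2 * min (U x) L ^ ε) ≤ 4 * Y := by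
    intro L hL
    set ψ : ℕ → ENNReal := fun k => ∫⁻ x in ball x0 (R * (1 - (1/2)^(k+1))),
      ENNReal.ofReal (U x ^ 2 * min (U x) L ^ ε) with hψ
    have hψ0 : ψ 0 = ∫⁻ x in ball x0 (R/2), ENNReal.ofReal (U x ^ 2 * min (U x) L ^ ε) := by
      rw [hψ]; norm_num; rw [show R * (1/2) = R / 2 by ring]
    have ht : ∀ k : ℕ, R * (1 - (1/2)^(k+1)) ≤ R := by
      intro k
      have : (0:ℝ) < (1/2)^(k+1) := by positivity
      nlinarith
    rw [← hψ0]
    apply iter_half (B := ENNReal.ofReal I * ENNReal.ofReal (L ^ ε))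
    · exact ENNReal.mul_ne_top ENNReal.ofReal_ne_top ENNReal.ofReal_ne_top
    · intro k
      rw [← hUI, ← lintegral_mul_const' _ _ ENNReal.ofReal_ne_top]
      refine (lintegral_mono_set (ball_subset_ball (ht k))).trans ?_
      apply lintegral_mono
      intro x
      show _ ≤ ENNReal.ofReal _ * ENNReal.ofReal _
      rw [← ENNReal.ofReal_mul (sq_nonneg _)]
      apply ENNReal.ofReal_le_ofReal
      have := le_min (hUn x) hL.le
      gcongr
      exact min_le_right _ _
    · intro k
      have hstep := gehring_step hUm hFm hUn hFn hI hF hK hA hη hη1 h1 h2 hRH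
        (a := b * 2 ^ (k * d)) (s := R * (1 - (1/2)^(k+1))) (t := R * (1 - (1/2)^(k+1+1)))
        (ε := ε) (L := L) (by positivity) ?_ (ht _) hε hε1 hL hC1 ?_
      · refine hstep.trans ?_
        rw [hUI, hJ', add_right_comm]
        have hpw : ((b * 2 ^ (k * d)) ^ ε) ≤ (3/2)^k * b ^ ε := by
          rw [Real.mul_rpow hbp.le (by positivity), mul_comm]
          gcongr
          rw [← Real.rpow_natCast, ← Real.rpow_mul (by norm_num)]
          calc (2:ℝ) ^ (((k * d : ℕ):ℝ) * ε) ≤ 2 ^ ((1/2:ℝ) * k) := by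
                apply Real.rpow_le_rpow_of_exponent_le (by norm_num)
                push_cast
                have : (0:ℝ) ≤ k := by positivity
                nlinarith
            _ = (√2) ^ k := by
                rw [Real.rpow_mul (by norm_num), Real.rpow_natCast, Real.sqrt_eq_rpow]
            _ ≤ (3/2)^k := by
                gcongr
                rw [Real.sqrt_le_left (by norm_num)]; norm_num
        have h1k : (1:ENNReal) ≤ ENNReal.ofReal ((3/2)^k) := by
          rw [← ENNReal.ofReal_one]
          exact ENNReal.ofReal_le_ofReal (one_le_pow₀ (by norm_num))
        gcongr ?_ + ?_
        · rw [hY, mul_add]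
          refine add_le_add ?_ ?_
          · rw [← mul_assoc, ← ENNReal.ofReal_mul (by positivity : (0:ℝ) ≤ (3/2)^k)]
            gcongr
          · exact le_mul_of_one_le_left zero_le h1k
        · gcongr
      · have : (0:ℝ) < (1/2)^(k+1) := by positivity
        rw [pow_succ _ (k+1)]
        nlinarith
      · rw [← hIdef]
        have e : R * (1 - (1/2)^(k+1+1)) - R * (1 - (1/2)^(k+1)) = R / 4 * (1/2)^k := by
          rw [pow_succ, pow_succ]; ring
        rw [e, mul_pow b, hb2]
        calc I * (6 * K)^d ≤ (2 ^ (k*d)) * (I * (6 * K)^d) :=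
              le_mul_of_one_le_left (by positivity) (one_le_pow₀ (by norm_num))
          _ = _ := by
            have h24 : (24 * K)^d = 4 ^ d * (6 * K)^d := by rw [← mul_pow]; ring
            rw [h24]
            have h2' : ((R / 4) * (1/2)^k)^d = R^d / (4^d * 2^(k*d)) := by
              rw [mul_pow, div_pow, ← pow_mul, one_div, inv_pow]; field_simp
            rw [h2']
            field_simp
  have hlim : ∫⁻ x in ball x0 (R/2), ENNReal.ofReal (U x ^ (2 + ε)) ≤ 4 * Y := by
    have hT : Tendsto (fun n : ℕ => ∫⁻ x in ball x0 (R/2),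
        ENNReal.ofReal (U x ^ 2 * min (U x) ((n:ℝ)+1) ^ ε)) atTop
        (𝓝 (∫⁻ x in ball x0 (R/2), ENNReal.ofReal (U x ^ (2 + ε)))) := by
      apply lintegral_tendsto_of_tendsto_of_monotone
      · intro n; apply Measurable.aemeasurable; fun_prop
      · refine ae_of_all _ fun x n k hnk => ?_
        apply ENNReal.ofReal_le_ofReal
        have hc : (n:ℝ) ≤ k := by exact_mod_cast hnk
        have : 0 ≤ min (U x) ((n:ℝ)+1) := le_min (hUn x) (by positivity)
        gcongr
      · refine ae_of_all _ fun x => ?_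
        apply tendsto_const_nhds.congr'
        filter_upwards [eventually_ge_atTop ⌈U x⌉₊] with n hn
        have : U x ≤ n := Nat.ceil_le.1 hn
        rw [min_eq_left (by linarith), e2 _ (hUn x)]
    exact le_of_tendsto' hT fun n => main _ (by positivity)
  refine hlim.trans ?_
  rw [hY, mul_add, ← ENNReal.ofReal_mul (by positivity), hbε]
  rw [show (4:ENNReal) = ENNReal.ofReal 4 by simp, ← ENNReal.ofReal_mul (by norm_num),
    ← mul_assoc (ENNReal.ofReal 4), ← ENNReal.ofReal_mul (by norm_num : (0:ℝ) ≤ 4)]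
  have h0 : 0 ≤ (I / R ^ d) ^ (ε / 2) := by positivity
  have h4 : 0 < C1 * η⁻¹ := by positivity
  gcongr ENNReal.ofReal ?_ + ENNReal.ofReal ?_ * J
  · have : 0 ≤ (I / R ^ d) ^ (ε / 2) * I := by positivity
    nlinarith
  · linarith

lemma vol_ball_pos {d : ℕ} (x : Euc d) {r : ℝ} (hr : 0 < r) : 0 < (volume (ball x r)).toReal := by
  have := vol_ball x hr
  rw [show (volume (ball x r)).toReal = volume.real (ball x r) from rfl, this]
  have := ub_pos d
  positivity

lemma gehring_avg_meas (d : ℕ) (hd : 1 ≤ d) (K A p : ℝ) (hK : 2 ≤ K) (hA : 0 < A) (hp : 2 < p) :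
    ∃ p0 ∈ Ioo (2:ℝ) p, ∃ C > (0:ℝ), ∀ (U F : Euc d → ℝ) (_ : Measurable U)
      (_ : Measurable F) (_ : ∀ x, 0 ≤ U x) (_ : ∀ x, 0 ≤ F x) (x0 : Euc d) (R : ℝ) (_ : 0 < R)
      (_ : IntegrableOn (fun x => U x ^ 2) (ball x0 R))
      (_ : IntegrableOn (fun x => F x ^ 2) (ball x0 R))
      (_ : IntegrableOn (fun x => F x ^ p0) (ball x0 R)) (_ : RevH U F x0 R K A),
      (avg (ball x0 (R / 2)) (fun x => U x ^ p0)) ^ (1 / p0) ≤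
        C * (avg (ball x0 R) (fun x => U x ^ (2:ℝ))) ^ ((1:ℝ) / 2) +
        C * (avg (ball x0 R) (fun x => F x ^ p0)) ^ (1 / p0) := by
  obtain ⟨ε, hε, hεp, C, hC, H⟩ := gehring d hd K A p hK hA hp
  have hub := ub_pos d
  set C' := 2 ^ d * C * (ub d ^ (ε / 2) + 1) with hC'
  have hC'p : 0 < C' := by positivity
  refine ⟨2 + ε, ⟨by linarith, hεp⟩, C' ^ (1 / (2 + ε)), by positivity, ?_⟩
  intro U F hUm hFm hUn hFn x0 R hR hI hF hFp hRH
  have h := H U F hUm hFm hUn hFn x0 R hR hI hF hRH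
  set I := ∫ x in ball x0 R, U x ^ 2 with hIdef
  set J := ∫ x in ball x0 R, F x ^ (2 + ε) with hJdef
  have hI0 : 0 ≤ I := integral_nonneg fun x => sq_nonneg _
  have hJ0 : 0 ≤ J := integral_nonneg fun x => Real.rpow_nonneg (hFn x) _
  rw [← ofReal_integral_eq_lintegral_ofReal hFp (ae_of_all _ fun x => Real.rpow_nonneg (hFn x) _),
    ← ENNReal.ofReal_mul hC.le, ← ENNReal.ofReal_add (by positivity) (by positivity)] at h
  have h3 : ∫ x in ball x0 (R/2), U x ^ (2 + ε) ≤ C * ((I / R ^ d) ^ (ε / 2) * I) + C * J := by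
    rw [integral_eq_lintegral_of_nonneg_ae (ae_of_all _ fun x => Real.rpow_nonneg (hUn x) _)
      (by apply Measurable.aestronglyMeasurable; fun_prop)]
    exact ENNReal.toReal_le_of_le_ofReal (by positivity) h
  have hv1 : (volume (ball x0 R)).toReal = ub d * R ^ d := by
    rw [show (volume (ball x0 R)).toReal = volume.real (ball x0 R) from rfl, vol_ball x0 hR]; try ring
  have hv2 : (volume (ball x0 (R/2))).toReal = ub d * (R/2) ^ d := by
    rw [show (volume (ball x0 (R/2))).toReal = volume.real (ball x0 (R/2)) from rfl,
      vol_ball x0 (half_pos hR)]; try ring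
  have hU2 : ∀ x, U x ^ (2:ℝ) = U x ^ 2 := fun x => by norm_num
  simp only [avg, hU2, hv1, hv2]
  rw [← hIdef, ← hJdef]
  set α := (ub d * R ^ d)⁻¹ * I with hα
  set β := (ub d * R ^ d)⁻¹ * J with hβ
  have hα0 : 0 ≤ α := by positivity
  have hβ0 : 0 ≤ β := by positivity
  have hIe : I = ub d * R ^ d * α := by rw [hα]; field_simp
  have h4 : (ub d * (R/2)^d)⁻¹ * ∫ x in ball x0 (R/2), U x ^ (2 + ε) ≤
      C' * (α ^ (1 + ε/2) + β) := by
    calc _ ≤ (ub d * (R/2)^d)⁻¹ * (C * ((I / R ^ d) ^ (ε / 2) * I) + C * J) := by gcongr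
      _ = 2 ^ d * C * (ub d ^ (ε/2) * α ^ (1 + ε/2) + β) := by
        have e1 : I / R ^ d = ub d * α := by rw [hIe]; field_simp
        rw [e1, Real.mul_rpow hub.le hα0, Real.rpow_add_of_nonneg hα0 (by norm_num) (by positivity),
          Real.rpow_one, hβ]
        nth_rewrite 1 [hIe]
        rw [div_pow]
        field_simp
      _ ≤ 2 ^ d * C * ((ub d ^ (ε/2) + 1) * α ^ (1 + ε/2) + (ub d ^ (ε/2) + 1) * β) := by
        have : 0 ≤ α ^ (1 + ε/2) := by positivity
        have h5 : 0 ≤ ub d ^ (ε/2) := by positivity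
        have h6 : 0 ≤ ub d ^ (ε/2) * β := by positivity
        gcongr
        · linarith
        · linarith
      _ = _ := by rw [hC']; ring
  have hLn : 0 ≤ ∫ x in ball x0 (R/2), U x ^ (2 + ε) :=
    integral_nonneg fun x => Real.rpow_nonneg (hUn x) _
  calc _ ≤ (C' * (α ^ (1 + ε/2) + β)) ^ (1 / (2 + ε)) := by
        apply Real.rpow_le_rpow (by positivity) h4 (by positivity)
    _ = C' ^ (1 / (2 + ε)) * (α ^ (1 + ε/2) + β) ^ (1 / (2 + ε)) :=
        Real.mul_rpow hC'p.le (by positivity)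
    _ ≤ C' ^ (1 / (2 + ε)) * ((α ^ (1 + ε/2)) ^ (1 / (2 + ε)) + β ^ (1 / (2 + ε))) := by
        gcongr
        apply Real.rpow_add_le_add_rpow (by positivity) hβ0 (by positivity)
        rw [div_le_one (by positivity)]; linarith
    _ = _ := by
        rw [mul_add, ← Real.rpow_mul hα0]
        rw [show (1 + ε/2) * (1 / (2 + ε)) = (1:ℝ) / 2 by field_simp]

theorem gehring_avg (d : ℕ) (hd : 1 ≤ d) (K A p : ℝ) (hK : 2 ≤ K) (hA : 0 < A) (hp : 2 < p) :
    ∃ p0 ∈ Ioo (2:ℝ) p, ∃ C > (0:ℝ), ∀ (U F : Euc d → ℝ) (_ : AEStronglyMeasurable U volume)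
      (_ : AEStronglyMeasurable F volume) (_ : ∀ x, 0 ≤ U x) (_ : ∀ x, 0 ≤ F x) (x0 : Euc d) (R : ℝ) (_ : 0 < R)
      (_ : IntegrableOn (fun x => U x ^ 2) (ball x0 R))
      (_ : IntegrableOn (fun x => F x ^ 2) (ball x0 R))
      (_ : IntegrableOn (fun x => F x ^ p0) (ball x0 R)) (_ : RevH U F x0 R K A),
      (avg (ball x0 (R / 2)) (fun x => U x ^ p0)) ^ (1 / p0) ≤
        C * (avg (ball x0 R) (fun x => U x ^ (2:ℝ))) ^ ((1:ℝ) / 2) +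
        C * (avg (ball x0 R) (fun x => F x ^ p0)) ^ (1 / p0) := by
  obtain ⟨p0, hp0, C, hC, H⟩ := gehring_avg_meas d hd K A p hK hA hp
  refine ⟨p0, hp0, C, hC, ?_⟩
  intro U F hUm hFm hUn hFn x0 R hR hI hF hFp hRH
  have rep : ∀ V : Euc d → ℝ, AEStronglyMeasurable V volume → (∀ x, 0 ≤ V x) →
      ∃ W : Euc d → ℝ, Measurable W ∧ (∀ x, 0 ≤ W x) ∧ V =ᵐ[volume] W := by
    intro V hV hV0
    refine ⟨fun x => max (hV.mk V x) 0, hV.stronglyMeasurable_mk.measurable.max measurable_const,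
      fun x => le_max_right _ _, ?_⟩
    filter_upwards [hV.ae_eq_mk] with x hx
    rw [← hx, max_eq_left (hV0 x)]
  obtain ⟨U', hU'm, hU'n, hU'⟩ := rep U hUm hUn
  obtain ⟨F', hF'm, hF'n, hF'⟩ := rep F hFm hFn
  have tr : ∀ (V W : Euc d → ℝ), V =ᵐ[volume] W → ∀ (φ : ℝ → ℝ) (E : Set (Euc d)),
      (fun x => φ (V x)) =ᵐ[volume.restrict E] (fun x => φ (W x)) := by
    intro V W h φ E
    filter_upwards [ae_restrict_of_ae h] with x hx
    rw [hx]
  have tri : ∀ (V W : Euc d → ℝ), V =ᵐ[volume] W → ∀ (φ : ℝ → ℝ) (E : Set (Euc d)),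
      ∫ x in E, φ (V x) = ∫ x in E, φ (W x) := fun V W h φ E => integral_congr_ae (tr V W h φ E)
  have := H U' F' hU'm hF'm hU'n hF'n x0 R hR (hI.congr (tr U U' hU' (· ^ 2) _))
    (hF.congr (tr F F' hF' (· ^ 2) _)) (hFp.congr (tr F F' hF' (· ^ p0) _)) ?_
  · simp only [avg] at this ⊢
    rw [tri U U' hU' (· ^ p0), tri U U' hU' (· ^ (2:ℝ)), tri F F' hF' (· ^ p0)]
    exact this
  · intro x r hr hx
    have := hRH x r hr hx
    rw [tri U U' hU' (· ^ 2), tri U U' hU' (· ^ 2), tri F F' hF' (· ^ 2), tri U U' hU' (fun x => x)] at this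
    exact this

lemma lint_sq {α : Type*} [MeasurableSpace α] (μ : Measure α) {f : α → ENNReal}
    (hf : AEMeasurable f μ) : (∫⁻ x, f x ∂μ) ^ 2 ≤ μ univ * ∫⁻ x, f x ^ 2 ∂μ := by
  have h := ENNReal.lintegral_mul_le_Lp_mul_Lq μ (p := 2) (q := 2) (by constructor <;> norm_num)
    hf (aemeasurable_const (b := (1:ENNReal)))
  simp only [Pi.mul_apply, mul_one, ENNReal.one_rpow, lintegral_one] at h
  calc (∫⁻ x, f x ∂μ) ^ 2 ≤ ((∫⁻ x, f x ^ (2:ℝ) ∂μ) ^ (1 / (2:ℝ)) * (μ univ) ^ (1 / (2:ℝ))) ^ 2 := by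
        gcongr
    _ = _ := by
        rw [mul_pow, ← ENNReal.rpow_natCast, ← ENNReal.rpow_mul, ← ENNReal.rpow_natCast,
          ← ENNReal.rpow_mul]
        norm_num
        rw [mul_comm]

lemma tsum_sq (a m : ℕ → ENNReal) :
    (∑' k, a k * m k) ^ 2 ≤ (∑' k, a k) * ∑' k, a k * m k ^ 2 := by
  have h := lint_sq (Measure.sum fun k => a k • Measure.dirac k) (f := m)
    (measurable_of_countable m).aemeasurable
  simpa [lintegral_sum_measure, lintegral_smul_measure] using h

lemma ball_swap {d : ℕ} {h : Euc d → ENNReal} (hh : Measurable h) (ρ : ℝ) :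
    ∫⁻ x, ∫⁻ y in ball x ρ, h y = volume (ball (0 : Euc d) ρ) * ∫⁻ y, h y := by
  have e : ∀ x : Euc d, ∫⁻ y in ball x ρ, h y = ∫⁻ y, (if dist y x < ρ then h y else 0) := by
    intro x
    rw [← lintegral_indicator measurableSet_ball]
    rfl
  simp_rw [e]
  rw [lintegral_lintegral_swap]
  · rw [← lintegral_const_mul _ hh]
    apply lintegral_congr
    intro y
    have : (fun x => if dist y x < ρ then h y else 0) = (ball y ρ).indicator (fun _ => h y) := by
      ext x; simp [indicator, mem_ball, dist_comm]
    rw [this, lintegral_indicator measurableSet_ball, setLIntegral_const, mul_comm,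
      Measure.addHaar_ball_center]
  · apply Measurable.aemeasurable
    exact Measurable.ite (measurableSet_lt (by fun_prop) measurable_const)
      (hh.comp measurable_snd) measurable_const

lemma meas_ball_lint {d : ℕ} {h : Euc d → ENNReal} (hh : Measurable h) (ρ : ℝ) :
    Measurable fun x : Euc d => ∫⁻ y in ball x ρ, h y := by
  have e : ∀ x : Euc d, ∫⁻ y in ball x ρ, h y = ∫⁻ y, (if dist y x < ρ then h y else 0) := by
    intro x
    rw [← lintegral_indicator measurableSet_ball]
    rfl
  simp_rw [e]
  apply Measurable.lintegral_prod_right'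
    (f := fun q : Euc d × Euc d => if dist q.2 q.1 < ρ then h q.2 else 0)
  exact Measurable.ite (measurableSet_lt (by fun_prop) measurable_const)
      (hh.comp measurable_snd) measurable_const

/-- The dyadic potential. -/
noncomputable def pot {d : ℕ} (h : Euc d → ENNReal) (r : ℝ) (x : Euc d) : ENNReal :=
  ∑' k : ℕ, ENNReal.ofReal (r * (1/2)^k) *
    (ENNReal.ofReal (((r * (1/2)^k)^d)⁻¹) * ∫⁻ y in ball x (128 * (r * (1/2)^k)), h y)

lemma mean_L2 {d : ℕ} {h : Euc d → ENNReal} (hh : Measurable h) {s : ℝ} (hs : 0 < s) :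
    ∫⁻ x, (ENNReal.ofReal ((s^d)⁻¹) * ∫⁻ y in ball x (128 * s), h y) ^ 2 ≤
      ENNReal.ofReal ((128 ^ d * ub d)^2) * ∫⁻ y, h y ^ 2 := by
  have hub := ub_pos d
  calc ∫⁻ x, (ENNReal.ofReal ((s^d)⁻¹) * ∫⁻ y in ball x (128 * s), h y) ^ 2
      ≤ ∫⁻ x, ENNReal.ofReal ((s^d)⁻¹) ^ 2 * (ENNReal.ofReal ((128 * s)^d * ub d) *
          ∫⁻ y in ball x (128 * s), h y ^ 2) := by
        apply lintegral_mono
        intro x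
        dsimp only
        rw [mul_pow]
        gcongr
        refine (lint_sq _ hh.aemeasurable).trans ?_
        rw [Measure.restrict_apply_univ, vol_ball_enn x (by positivity)]
    _ = ENNReal.ofReal ((s^d)⁻¹) ^ 2 * (ENNReal.ofReal ((128 * s)^d * ub d) *
          (ENNReal.ofReal ((128 * s)^d * ub d) * ∫⁻ y, h y ^ 2)) := by
        rw [lintegral_const_mul' _ _ (by finiteness), lintegral_const_mul' _ _ (by finiteness),
          ball_swap (hh.pow_const 2), vol_ball_enn 0 (by positivity)]
    _ = _ := by
        rw [← ENNReal.ofReal_pow (by positivity), ← mul_assoc, ← mul_assoc,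
          ← ENNReal.ofReal_mul (by positivity), ← ENNReal.ofReal_mul (by positivity)]
        congr 2
        rw [mul_pow 128 s]
        field_simp

lemma tsum_geo {s : ℝ} (hs : 0 < s) : ∑' k : ℕ, ENNReal.ofReal (s * (1/2)^k) = ENNReal.ofReal (2 * s) := by
  rw [← ENNReal.ofReal_tsum_of_nonneg (fun k => by positivity), tsum_mul_left, tsum_geometric_two,
    mul_comm]
  exact (summable_geometric_two).mul_left s

lemma pot_tail {d : ℕ} {h : Euc d → ENNReal} (hh : Measurable h) {s : ℝ} (hs : 0 < s) :
    ∫⁻ x, pot h s x ^ 2 ≤ ENNReal.ofReal ((2 * s)^2 * (128 ^ d * ub d)^2) * ∫⁻ y, h y ^ 2 := by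
  have hub := ub_pos d
  calc ∫⁻ x, pot h s x ^ 2 ≤ ∫⁻ x, ENNReal.ofReal (2 * s) * ∑' k : ℕ, ENNReal.ofReal (s * (1/2)^k) *
    (ENNReal.ofReal (((s * (1/2)^k)^d)⁻¹) * ∫⁻ y in ball x (128 * (s * (1/2)^k)), h y) ^ 2 := by
        apply lintegral_mono
        intro x
        dsimp only
        rw [← tsum_geo hs]
        exact tsum_sq _ _
    _ = ENNReal.ofReal (2 * s) * ∑' k : ℕ, ENNReal.ofReal (s * (1/2)^k) * ∫⁻ x,
    (ENNReal.ofReal (((s * (1/2)^k)^d)⁻¹) * ∫⁻ y in ball x (128 * (s * (1/2)^k)), h y) ^ 2 := by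
        rw [lintegral_const_mul' _ _ (by finiteness), lintegral_tsum]
        · congr 2; ext k
          rw [lintegral_const_mul' _ _ (by finiteness)]
        · intro k
          apply Measurable.aemeasurable
          exact (((meas_ball_lint hh _).const_mul _).pow_const 2).const_mul _
    _ ≤ ENNReal.ofReal (2 * s) * ∑' k : ℕ, ENNReal.ofReal (s * (1/2)^k) *
        (ENNReal.ofReal ((128 ^ d * ub d)^2) * ∫⁻ y, h y ^ 2) := by
        gcongr with k
        exact mean_L2 hh (by positivity)
    _ = _ := by
        rw [ENNReal.tsum_mul_right, tsum_geo hs, ← mul_assoc, ← mul_assoc,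
          ← ENNReal.ofReal_mul (by positivity), ← ENNReal.ofReal_mul (by positivity)]
        congr 2; ring

lemma pot_split {d : ℕ} (h : Euc d → ENNReal) {r : ℝ} (hr : 0 < r) (n : ℕ) (x : Euc d) :
    pot h r x ≤ ENNReal.ofReal (n * r * (2^n)^d / r ^ d) * (∫⁻ y, h y) + pot h (r * (1/2)^n) x := by
  have e : pot h (r * (1/2)^n) x = ∑' k : ℕ, ENNReal.ofReal (r * (1/2)^(k+n)) *
    (ENNReal.ofReal (((r * (1/2)^(k+n))^d)⁻¹) * ∫⁻ y in ball x (128 * (r * (1/2)^(k+n))), h y) := by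
    unfold pot
    congr 1; ext k
    rw [show r * (1/2)^n * (1/2)^k = r * (1/2)^(k+n) by ring]
  rw [e]
  unfold pot
  rw [← Summable.sum_add_tsum_nat_add' (k := n) ENNReal.summable]
  gcongr
  calc _ ≤ ∑ k ∈ Finset.range n, ENNReal.ofReal r * (ENNReal.ofReal ((2^n)^d / r^d) * ∫⁻ y, h y) := by
        apply Finset.sum_le_sum
        intro k hk
        have hk' : k ≤ n := (Finset.mem_range.1 hk).le
        gcongr
        · exact mul_le_of_le_one_right hr.le (pow_le_one₀ (by norm_num) (by norm_num))
        · have e1 : ((r * (1/2)^k)^d)⁻¹ = (2^k)^d / r^d := by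
            rw [mul_pow, mul_inv, one_div, inv_pow, inv_pow, inv_inv]; field_simp
          rw [e1]
          gcongr
          norm_num
        · exact Measure.restrict_le_self
    _ = _ := by
        rw [Finset.sum_const, Finset.card_range, nsmul_eq_mul, ← mul_assoc, ← mul_assoc,
          ← ENNReal.ofReal_natCast, ← ENNReal.ofReal_mul (by positivity),
          ← ENNReal.ofReal_mul (by positivity)]
        congr 2; ring

lemma enn_add_sq (a b : ENNReal) : (a + b) ^ 2 ≤ 2 * a ^ 2 + 2 * b ^ 2 := by
  have := ENNReal.rpow_add_le_mul_rpow_add_rpow a b (p := 2) (by norm_num)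
  norm_num at this
  rw [← mul_add]; exact this

theorem pot_L2 (d : ℕ) (ε : ℝ) (hε : 0 < ε) : ∃ C > (0:ℝ), ∀ (h : Euc d → ENNReal)
    (_ : Measurable h) (r : ℝ) (_ : 0 < r) (z : Euc d),
    ∫⁻ x in ball z (2 * r), pot h r x ^ 2 ≤ ENNReal.ofReal (r ^ 2) *
      (ENNReal.ofReal ε * (∫⁻ y, h y ^ 2) + ENNReal.ofReal (C / r ^ d) * (∫⁻ y, h y) ^ 2) := by
  have hub := ub_pos d
  set X := 8 * (128 ^ d * ub d)^2 with hX
  have hXp : 0 < X := by positivity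
  obtain ⟨n, hn⟩ := exists_pow_lt_of_lt_one (by positivity : 0 < ε / X) (by norm_num : (1:ℝ)/2 < 1)
  set c := (n * (2^n)^d : ℝ) with hc
  refine ⟨2 * c ^ 2 * (2 ^ d * ub d) + 1, by positivity, ?_⟩
  intro h hh r hr z
  have hs : 0 < r * (1/2)^n := by positivity
  have hmp : ∀ s, Measurable (pot h s) := by
    intro s
    unfold pot
    apply Measurable.tsum
    intro k
    exact ((meas_ball_lint hh _).const_mul _).const_mul _
  calc ∫⁻ x in ball z (2 * r), pot h r x ^ 2
      ≤ ∫⁻ x in ball z (2 * r), (2 * (ENNReal.ofReal (n * r * (2^n)^d / r ^ d) * (∫⁻ y, h y)) ^ 2 +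
          2 * pot h (r * (1/2)^n) x ^ 2) := by
        apply lintegral_mono
        intro x
        refine le_trans ?_ (enn_add_sq _ _)
        dsimp only
        gcongr
        exact pot_split h hr n x
    _ = 2 * (ENNReal.ofReal (n * r * (2^n)^d / r ^ d) * (∫⁻ y, h y)) ^ 2 *
          ENNReal.ofReal ((2 * r)^d * ub d) + 2 * ∫⁻ x in ball z (2 * r), pot h (r * (1/2)^n) x ^ 2 := by
        rw [lintegral_add_left measurable_const, setLIntegral_const, vol_ball_enn z (by positivity),
          lintegral_const_mul' _ _ (by finiteness)]
    _ ≤ 2 * (ENNReal.ofReal (n * r * (2^n)^d / r ^ d) * (∫⁻ y, h y)) ^ 2 *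
          ENNReal.ofReal ((2 * r)^d * ub d) + 2 * (ENNReal.ofReal ((2 * (r * (1/2)^n))^2 * (128 ^ d * ub d)^2) * ∫⁻ y, h y ^ 2) := by
        gcongr
        exact (setLIntegral_le_lintegral _ _).trans (pot_tail hh hs)
    _ = ENNReal.ofReal (r ^ 2 * (2 * c ^ 2 * (2 ^ d * ub d) / r ^ d)) * (∫⁻ y, h y) ^ 2 +
        ENNReal.ofReal (r ^ 2 * (X * ((1/2)^n)^2)) * ∫⁻ y, h y ^ 2 := by
        rw [mul_pow, ← ENNReal.ofReal_pow (by positivity)]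
        generalize (∫⁻ y, h y) = H1
        generalize (∫⁻ y, h y ^ 2) = H2
        rw [show (2:ENNReal) = ENNReal.ofReal 2 by simp, ← mul_assoc, ← mul_assoc,
          ← ENNReal.ofReal_mul (by positivity), ← ENNReal.ofReal_mul (by positivity),
          mul_right_comm, ← ENNReal.ofReal_mul (by positivity)]
        congr 3
        · rw [hc, mul_pow 2 r]; field_simp
        · rw [hX]; ring
    _ ≤ _ := by
        rw [mul_add, add_comm, ← mul_assoc (ENNReal.ofReal (r^2)), ← mul_assoc (ENNReal.ofReal (r^2)),
          ← ENNReal.ofReal_mul (by positivity), ← ENNReal.ofReal_mul (by positivity)]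
        gcongr
        · have h1 : ((1:ℝ)/2)^n ≤ 1 := pow_le_one₀ (by norm_num) (by norm_num)
          have h2 : (0:ℝ) ≤ (1/2)^n := by positivity
          rw [lt_div_iff₀ hXp] at hn
          nlinarith
        · linarith

lemma fderiv_le_grad {d : ℕ} (w : Euc d → ℝ) (x v : Euc d) :
    |fderiv ℝ w x v| ≤ ‖gradVec w x‖ * ‖v‖ := by
  have h : fderiv ℝ w x v = inner ℝ (gradVec w x) v := by
    have hv : v = ∑ i, v i • EuclideanSpace.single i (1:ℝ) := by
      ext j
      simp [Finset.sum_apply, Pi.single_apply]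
    conv_lhs => rw [hv]
    rw [map_sum, PiLp.inner_apply]
    apply Finset.sum_congr rfl
    intro i _
    simp [gradVec]
  rw [h]
  exact abs_real_inner_le_norm _ _

lemma continuous_gradVec {d : ℕ} {w : Euc d → ℝ} (hw : ContDiff ℝ (⊤ : ℕ∞) w) :
    Continuous (gradVec w) := by
  unfold gradVec
  have h : Continuous (fderiv ℝ w) := hw.continuous_fderiv (by simp)
  fun_prop

lemma ftc_le {d : ℕ} {w : Euc d → ℝ} (hw : ContDiff ℝ (⊤ : ℕ∞) w) (x v : Euc d) {T : ℝ}
    (hT : 0 ≤ T) : ENNReal.ofReal |w (x + T • v) - w x| ≤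
      ∫⁻ t in Ioc 0 T, ENNReal.ofReal (‖gradVec w (x + t • v)‖ * ‖v‖) := by
  have hder : ∀ t : ℝ, HasDerivAt (fun t : ℝ => w (x + t • v)) (fderiv ℝ w (x + t • v) v) t := by
    intro t
    have h1 : HasDerivAt (fun t : ℝ => x + t • v) v t := by
      simpa using ((hasDerivAt_id t).smul_const v).const_add x
    have h2 : HasFDerivAt w (fderiv ℝ w (x + t • v)) (x + t • v) :=
      ((hw.differentiable (by simp)) _).hasFDerivAt
    exact h2.comp_hasDerivAt t h1
  have hcont : Continuous fun t : ℝ => fderiv ℝ w (x + t • v) v := by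
    have h : Continuous (fderiv ℝ w) := hw.continuous_fderiv (by simp)
    fun_prop
  have h := intervalIntegral.integral_eq_sub_of_hasDerivAt (a := 0) (b := T) (fun t _ => hder t)
    (hcont.intervalIntegrable _ _)
  simp only [zero_smul, add_zero] at h
  rw [← h, intervalIntegral.integral_of_le hT, ← Real.norm_eq_abs]
  refine (ENNReal.ofReal_le_ofReal (norm_integral_le_integral_norm _)).trans ?_
  rw [ofReal_integral_eq_lintegral_ofReal]
  · apply lintegral_mono
    intro t
    apply ENNReal.ofReal_le_ofReal
    exact fderiv_le_grad _ _ _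
  · exact (hcont.norm.integrableOn_Ioc)
  · exact ae_of_all _ fun t => norm_nonneg _

lemma lint_scale {d : ℕ} {G : Euc d → ENNReal} (hG : Measurable G) (a : Euc d) {t : ℝ}
    (ht : 1/2 ≤ t) : ∫⁻ y, G (a + t • y) ≤ ENNReal.ofReal (2 ^ d) * ∫⁻ y, G y := by
  have ht0 : t ≠ 0 := by linarith
  have h1 : ∫⁻ y, G (a + t • y) = ∫⁻ y, G (a + y) ∂(Measure.map (t • ·) volume) := by
    rw [lintegral_map (by fun_prop) (measurable_const_smul t)]
  rw [h1, Measure.map_addHaar_smul _ ht0, lintegral_smul_measure, lintegral_add_left_eq_self G a]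
  rw [smul_eq_mul]
  gcongr
  rw [abs_of_pos (by positivity), finrank_euclideanSpace_fin, ← inv_pow]
  gcongr
  rw [inv_le_comm₀ (by linarith) (by norm_num)]
  linarith

lemma conv_poinc {d : ℕ} {w : Euc d → ℝ} (hw : ContDiff ℝ (⊤ : ℕ∞) w) {A B E : Set (Euc d)}
    (hE : Convex ℝ E) (hEm : MeasurableSet E) (hAm : MeasurableSet A) (hBm : MeasurableSet B)
    (hA : A ⊆ E) (hB : B ⊆ E) {L : ℝ} (hL : ∀ x ∈ A, ∀ y ∈ B, ‖y - x‖ ≤ L) :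
    ∫⁻ x in A, ∫⁻ y in B, ENNReal.ofReal |w y - w x| ≤
      ENNReal.ofReal L * (ENNReal.ofReal (2 ^ d) * (volume A + volume B) *
        ∫⁻ z in E, ENNReal.ofReal ‖gradVec w z‖) := by
  set H : Euc d → ENNReal := E.indicator (fun z => ENNReal.ofReal ‖gradVec w z‖) with hH
  have hHm : Measurable H := by
    apply Measurable.indicator _ hEm
    have := continuous_gradVec hw
    fun_prop
  have hHI : ∫⁻ z in E, ENNReal.ofReal ‖gradVec w z‖ = ∫⁻ z, H z := by
    rw [hH, lintegral_indicator hEm]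
  rw [hHI]
  have hQ : ∀ t ∈ Ioc (0:ℝ) 1, ∫⁻ x in A, ∫⁻ y in B, H (x + t • (y - x)) ≤
      ENNReal.ofReal (2 ^ d) * (volume A + volume B) * ∫⁻ z, H z := by
    intro t ht
    rcases le_total (1/2) t with h | h
    · calc ∫⁻ x in A, ∫⁻ y in B, H (x + t • (y - x))
          ≤ ∫⁻ x in A, (ENNReal.ofReal (2 ^ d) * ∫⁻ z, H z) := by
            apply lintegral_mono
            intro x
            refine (setLIntegral_le_lintegral _ _).trans ?_
            have := lint_scale hHm (x - t • x) h
            refine le_of_eq_of_le (lintegral_congr fun y => ?_) this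
            congr 1
            module
        _ = ENNReal.ofReal (2 ^ d) * volume A * ∫⁻ z, H z := by
            rw [setLIntegral_const]; ring
        _ ≤ _ := by gcongr; exact le_self_add
    · rw [lintegral_lintegral_swap (by apply Measurable.aemeasurable; fun_prop)]
      calc ∫⁻ y in B, ∫⁻ x in A, H (x + t • (y - x))
          ≤ ∫⁻ x in B, (ENNReal.ofReal (2 ^ d) * ∫⁻ z, H z) := by
            apply lintegral_mono
            intro y
            refine (setLIntegral_le_lintegral _ _).trans ?_
            have := lint_scale hHm (t • y) (by linarith : 1/2 ≤ 1 - t)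
            refine le_of_eq_of_le (lintegral_congr fun x => ?_) this
            congr 1
            module
        _ = ENNReal.ofReal (2 ^ d) * volume B * ∫⁻ z, H z := by
            rw [setLIntegral_const]; ring
        _ ≤ _ := by gcongr; exact le_add_self
  calc ∫⁻ x in A, ∫⁻ y in B, ENNReal.ofReal |w y - w x|
      ≤ ∫⁻ x in A, ∫⁻ y in B, ENNReal.ofReal L * ∫⁻ t in Ioc (0:ℝ) 1, H (x + t • (y - x)) := by
        refine setLIntegral_mono' hAm fun x hx => ?_
        refine setLIntegral_mono' hBm fun y hy => ?_
        have h1 := ftc_le hw x (y - x) zero_le_one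
        simp only [one_smul, add_sub_cancel] at h1
        refine h1.trans ?_
        rw [← lintegral_const_mul' _ _ ENNReal.ofReal_ne_top]
        refine setLIntegral_mono' measurableSet_Ioc fun t ht => ?_
        have hmem : x + t • (y - x) ∈ E :=
          hE.add_smul_sub_mem (hA hx) (hB hy) ⟨ht.1.le, ht.2⟩
        rw [hH, indicator_of_mem hmem, mul_comm, ENNReal.ofReal_mul (norm_nonneg _)]
        gcongr
        exact hL x hx y hy
    _ = ENNReal.ofReal L * ∫⁻ x in A, ∫⁻ y in B, ∫⁻ t in Ioc (0:ℝ) 1, H (x + t • (y - x)) := by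
        rw [← lintegral_const_mul' _ _ ENNReal.ofReal_ne_top]
        congr 1; ext x
        rw [← lintegral_const_mul' _ _ ENNReal.ofReal_ne_top]
    _ = ENNReal.ofReal L * ∫⁻ t in Ioc (0:ℝ) 1, ∫⁻ x in A, ∫⁻ y in B, H (x + t • (y - x)) := by
        congr 1
        have h1 : ∀ x, ∫⁻ y in B, ∫⁻ t in Ioc (0:ℝ) 1, H (x + t • (y - x)) =
            ∫⁻ t in Ioc (0:ℝ) 1, ∫⁻ y in B, H (x + t • (y - x)) := by
          intro x
          exact lintegral_lintegral_swap (by apply Measurable.aemeasurable; fun_prop)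
        simp_rw [h1]
        apply lintegral_lintegral_swap
        apply Measurable.aemeasurable
        exact Measurable.lintegral_prod_right'
            (f := fun q : (Euc d × ℝ) × Euc d => H (q.1.1 + q.1.2 • (q.2 - q.1.1)))
            (by fun_prop)
    _ ≤ ENNReal.ofReal L * ∫⁻ t in Ioc (0:ℝ) 1, ENNReal.ofReal (2 ^ d) * (volume A + volume B) *
          ∫⁻ z, H z := by
        refine mul_le_mul_right ?_ _
        exact setLIntegral_mono' measurableSet_Ioc hQ
    _ = _ := by simp

/-- comparison of averages over two balls in a convex set -/
lemma avg_cmp {d : ℕ} {w : Euc d → ℝ} (hw : ContDiff ℝ (⊤ : ℕ∞) w) {A B E : Set (Euc d)}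
    (hE : Convex ℝ E) (hEm : MeasurableSet E) (hAm : MeasurableSet A) (hBm : MeasurableSet B)
    (hA : A ⊆ E) (hB : B ⊆ E) {L : ℝ} (hL : ∀ x ∈ A, ∀ y ∈ B, ‖y - x‖ ≤ L)
    (hA0 : volume A ≠ 0) (hB0 : volume B ≠ 0) (hA1 : volume A ≠ ⊤) (hB1 : volume B ≠ ⊤)
    (hwA : IntegrableOn w A) (hwB : IntegrableOn w B) :
    volume A * volume B * ENNReal.ofReal |avg B w - avg A w| ≤
      ENNReal.ofReal L * (ENNReal.ofReal (2 ^ d) * (volume A + volume B) *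
        ∫⁻ z in E, ENNReal.ofReal ‖gradVec w z‖) := by
  refine le_trans ?_ (conv_poinc hw hE hEm hAm hBm hA hB hL)
  have hAr : 0 < (volume A).toReal := ENNReal.toReal_pos hA0 hA1
  have hBr : 0 < (volume B).toReal := ENNReal.toReal_pos hB0 hB1
  have hkey : ∀ x, volume B * ENNReal.ofReal |avg B w - w x| ≤
      ∫⁻ y in B, ENNReal.ofReal |w y - w x| := by
    intro x
    have h1 : (volume B).toReal * (avg B w - w x) = ∫ y in B, (w y - w x) := by
      rw [integral_sub hwB (integrableOn_const hB1)]
      simp only [setIntegral_const, avg, smul_eq_mul, measureReal_def]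
      field_simp
    have h2 : volume B * ENNReal.ofReal |avg B w - w x| =
        ENNReal.ofReal |∫ y in B, (w y - w x)| := by
      rw [← h1, abs_mul, abs_of_pos hBr, ENNReal.ofReal_mul hBr.le, ENNReal.ofReal_toReal hB1]
    rw [h2, ← Real.norm_eq_abs]
    refine (ENNReal.ofReal_le_ofReal (norm_integral_le_integral_norm _)).trans ?_
    rw [ofReal_integral_eq_lintegral_ofReal]
    · exact le_rfl
    · exact (hwB.sub (integrableOn_const hB1)).norm
    · exact ae_of_all _ fun t => norm_nonneg _
  have hkey2 : volume A * ENNReal.ofReal |avg B w - avg A w| ≤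
      ∫⁻ x in A, ENNReal.ofReal |avg B w - w x| := by
    have h1 : (volume A).toReal * (avg B w - avg A w) = ∫ y in A, (avg B w - w y) := by
      rw [integral_sub (integrable_const_iff.2 (Or.inr (by simpa [isFiniteMeasure_iff] using hA1.lt_top))) hwA]
      simp only [setIntegral_const, avg, smul_eq_mul, measureReal_def]
      field_simp
    have h2 : volume A * ENNReal.ofReal |avg B w - avg A w| =
        ENNReal.ofReal |∫ y in A, (avg B w - w y)| := by
      rw [← h1, abs_mul, abs_of_pos hAr, ENNReal.ofReal_mul hAr.le, ENNReal.ofReal_toReal hA1]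
    rw [h2, ← Real.norm_eq_abs]
    refine (ENNReal.ofReal_le_ofReal (norm_integral_le_integral_norm _)).trans ?_
    rw [ofReal_integral_eq_lintegral_ofReal]
    · exact le_rfl
    · exact ((integrableOn_const hA1).sub hwA).norm
    · exact ae_of_all _ fun t => norm_nonneg _
  calc volume A * volume B * ENNReal.ofReal |avg B w - avg A w|
      = volume B * (volume A * ENNReal.ofReal |avg B w - avg A w|) := by ring
    _ ≤ volume B * ∫⁻ x in A, ENNReal.ofReal |avg B w - w x| := by gcongr
    _ = ∫⁻ x in A, volume B * ENNReal.ofReal |avg B w - w x| := by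
        rw [lintegral_const_mul' _ _ hB1]
    _ ≤ _ := lintegral_mono fun x => hkey x

lemma enn_cancel {a b : ℝ} (ha : 0 < a) (hb : 0 ≤ b) {X I : ENNReal}
    (h : ENNReal.ofReal a * X ≤ ENNReal.ofReal b * I) : X ≤ ENNReal.ofReal (b / a) * I := by
  have h1 : ENNReal.ofReal a⁻¹ * (ENNReal.ofReal a * X) ≤
      ENNReal.ofReal a⁻¹ * (ENNReal.ofReal b * I) := by gcongr
  rw [← mul_assoc, ← mul_assoc, ← ENNReal.ofReal_mul (by positivity),
    ← ENNReal.ofReal_mul (by positivity), inv_mul_cancel₀ ha.ne', ENNReal.ofReal_one, one_mul] at h1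
  rwa [div_eq_inv_mul]

/-- constant of ball comparison -/
noncomputable def Cb (d : ℕ) : ℝ := 512 * 4 ^ d / ub d

lemma Cb_pos (d : ℕ) : 0 < Cb d := by
  have := ub_pos d
  unfold Cb; positivity

lemma intOn_ball {d : ℕ} {w : Euc d → ℝ} (hw : Continuous w) (c : Euc d) (r : ℝ) :
    IntegrableOn w (ball c r) :=
  (hw.locallyIntegrable.integrableOn_isCompact (isCompact_closedBall c r)).mono_set
    ball_subset_closedBall

lemma step_cmp {d : ℕ} {w : Euc d → ℝ} (hw : ContDiff ℝ (⊤ : ℕ∞) w) {E : Set (Euc d)}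
    (hE : Convex ℝ E) (hEo : IsOpen E) {x c c' : Euc d} {r : ℝ} (hr : 0 < r)
    (hA : ball c r ⊆ E) (hB : ball c' (r / 2) ⊆ E) (hEx : E ⊆ ball x (128 * r))
    {h : Euc d → ENNReal} (hh : ∀ y ∈ E, ENNReal.ofReal ‖gradVec w y‖ ≤ h y) :
    ENNReal.ofReal |avg (ball c' (r / 2)) w - avg (ball c r) w| ≤
      ENNReal.ofReal (Cb d) * (ENNReal.ofReal r * (ENNReal.ofReal ((r ^ d)⁻¹) *
        ∫⁻ y in ball x (128 * r), h y)) := by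
  have hub := ub_pos d
  have hL : ∀ y ∈ ball c r, ∀ y' ∈ ball c' (r / 2), ‖y' - y‖ ≤ 256 * r := by
    intro y hy y' hy'
    have h1 := hEx (hA hy)
    have h2 := hEx (hB hy')
    rw [mem_ball] at h1 h2
    rw [← dist_eq_norm]
    linarith [dist_triangle_right y' y x]
  have h0 := avg_cmp hw hE hEo.measurableSet measurableSet_ball measurableSet_ball hA hB hL
    (measure_ball_pos _ _ hr).ne' (measure_ball_pos _ _ (by positivity)).ne'
    measure_ball_lt_top.ne measure_ball_lt_top.ne (intOn_ball hw.continuous _ _)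
    (intOn_ball hw.continuous _ _)
  have hI : ∫⁻ z in E, ENNReal.ofReal ‖gradVec w z‖ ≤ ∫⁻ y in ball x (128 * r), h y :=
    (setLIntegral_mono' hEo.measurableSet hh).trans (lintegral_mono_set hEx)
  set I := ∫⁻ y in ball x (128 * r), h y
  set J := ∫⁻ z in E, ENNReal.ofReal ‖gradVec w z‖
  rw [vol_ball_enn _ hr, vol_ball_enn _ (half_pos hr)] at h0
  set X := ENNReal.ofReal |avg (ball c' (r / 2)) w - avg (ball c r) w|
  have h1 : ENNReal.ofReal (r ^ d * ub d * ((r / 2) ^ d * ub d)) * X ≤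
      ENNReal.ofReal (256 * r * (2 ^ d * (2 * (r ^ d * ub d)))) * I := by
    rw [ENNReal.ofReal_mul (by positivity)]
    refine h0.trans ?_
    rw [ENNReal.ofReal_mul (p := 256 * r) (by positivity),
      ENNReal.ofReal_mul (p := 2 ^ d) (by positivity), mul_assoc (ENNReal.ofReal (256 * r))]
    refine mul_le_mul_right (mul_le_mul' (mul_le_mul_right ?_ _) hI) _
    rw [← ENNReal.ofReal_add (by positivity) (by positivity)]
    apply ENNReal.ofReal_le_ofReal
    have : (r / 2) ^ d ≤ r ^ d := by gcongr; linarith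
    nlinarith
  have h2 := enn_cancel (by positivity) (by positivity) h1
  refine h2.trans (le_of_eq ?_)
  rw [← mul_assoc (ENNReal.ofReal r), ← mul_assoc (ENNReal.ofReal (Cb d)),
    ← ENNReal.ofReal_mul (p := r) (by positivity), ← ENNReal.ofReal_mul (Cb_pos d).le]
  congr 2
  unfold Cb
  have h4 : (4:ℝ) ^ d = 2 ^ d * 2 ^ d := by rw [← mul_pow]; norm_num
  rw [h4, div_pow]
  field_simp
  ring

lemma avg_sub_le {d : ℕ} {w : Euc d → ℝ} (hw : Continuous w) {c : Euc d} {r e a : ℝ} (hr : 0 < r)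
    (h : ∀ y ∈ ball c r, |w y - a| ≤ e) : |avg (ball c r) w - a| ≤ e := by
  have hv : 0 < volume.real (ball c r) := by
    rw [vol_ball _ hr]; have := ub_pos d; positivity
  have h1 : volume.real (ball c r) * (avg (ball c r) w - a) = ∫ y in ball c r, (w y - a) := by
    rw [integral_sub (intOn_ball hw _ _) (integrable_const_iff.2 (Or.inr
      (by simpa [isFiniteMeasure_iff] using measure_ball_lt_top)))]
    simp only [setIntegral_const, avg, smul_eq_mul]
    rw [← measureReal_def]
    field_simp
  have h2 : |∫ y in ball c r, (w y - a)| ≤ e * volume.real (ball c r) := by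
    rw [← Real.norm_eq_abs]
    exact norm_setIntegral_le_of_norm_le_const measure_ball_lt_top h
  rw [← h1, abs_mul, abs_of_pos hv] at h2
  nlinarith

lemma ofReal_tri (a b c : ℝ) :
    ENNReal.ofReal |a - c| ≤ ENNReal.ofReal |b - c| + ENNReal.ofReal |a - b| := by
  rw [← ENNReal.ofReal_add (abs_nonneg _) (abs_nonneg _)]
  apply ENNReal.ofReal_le_ofReal
  linarith [abs_sub_le a b c]

lemma chain_pot {d : ℕ} {w : Euc d → ℝ} (hw : ContDiff ℝ (⊤ : ℕ∞) w) {x : Euc d} {r : ℝ}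
    (hr : 0 < r) {c : ℕ → Euc d} {E : ℕ → Set (Euc d)} {h : Euc d → ENNReal}
    (hE : ∀ k, Convex ℝ (E k)) (hEo : ∀ k, IsOpen (E k))
    (hA : ∀ k, ball (c k) (r * (1/2) ^ k) ⊆ E k)
    (hB : ∀ k, ball (c (k+1)) (r * (1/2) ^ (k+1)) ⊆ E k)
    (hEx : ∀ k, E k ⊆ ball x (128 * (r * (1/2) ^ k)))
    (hh : ∀ k, ∀ y ∈ E k, ENNReal.ofReal ‖gradVec w y‖ ≤ h y) :
    ENNReal.ofReal |w x - avg (ball (c 0) r) w| ≤ ENNReal.ofReal (Cb d) * pot h r x := by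
  have hN : ∀ n, ENNReal.ofReal |avg (ball (c n) (r * (1/2)^n)) w - avg (ball (c 0) r) w| ≤
      ENNReal.ofReal (Cb d) * pot h r x := by
    intro n
    have h1 : ENNReal.ofReal |avg (ball (c n) (r * (1/2)^n)) w - avg (ball (c 0) r) w| ≤
      ∑ k ∈ Finset.range n, ENNReal.ofReal (Cb d) * (ENNReal.ofReal (r*(1/2)^k) *
        (ENNReal.ofReal (((r*(1/2)^k)^d)⁻¹) * ∫⁻ y in ball x (128*(r*(1/2)^k)), h y)) := by
      induction n with
      | zero => simp
      | succ n ih =>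
        rw [Finset.sum_range_succ]
        have h2 := step_cmp hw (hE n) (hEo n) (x := x) (c := c n) (c' := c (n+1))
          (r := r * (1/2)^n) (by positivity) (hA n)
          (by have := hB n; rw [pow_succ] at this
              convert this using 2; ring) (hEx n) (hh n)
        have e : r * (1/2)^n / 2 = r * (1/2:ℝ)^(n+1) := by rw [pow_succ]; ring
        rw [e] at h2
        exact le_trans (ofReal_tri _ _ _) (add_le_add ih h2)
    refine h1.trans ?_
    rw [← Finset.mul_sum]
    gcongr
    exact ENNReal.sum_le_tsum _
  have hlim : Tendsto (fun n => avg (ball (c n) (r * (1/2)^n)) w) atTop (𝓝 (w x)) := by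
    rw [Metric.tendsto_atTop]
    intro e he
    obtain ⟨δ, hδ, hcont⟩ := Metric.continuous_iff.1 hw.continuous x (e/2) (by positivity)
    have ht : Tendsto (fun n : ℕ => 128 * (r * (1/2:ℝ)^n)) atTop (𝓝 0) := by
      have := tendsto_pow_atTop_nhds_zero_of_lt_one (r := (1/2:ℝ)) (by norm_num) (by norm_num)
      simpa using (this.const_mul r).const_mul 128
    obtain ⟨n0, hn0⟩ := eventually_atTop.1 (ht.eventually (gt_mem_nhds hδ))
    refine ⟨n0, fun n hn => ?_⟩
    rw [Real.dist_eq]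
    refine lt_of_le_of_lt (avg_sub_le hw.continuous (e := e/2) (by positivity) ?_) (by linarith)
    intro y hy
    have := hEx n (hA n hy)
    rw [mem_ball] at this
    have := hcont y (this.trans (hn0 n hn))
    rw [Real.dist_eq] at this
    exact this.le
  have hlim2 : Tendsto (fun n => ENNReal.ofReal
      |avg (ball (c n) (r * (1/2)^n)) w - avg (ball (c 0) r) w|) atTop
      (𝓝 (ENNReal.ofReal |w x - avg (ball (c 0) r) w|)) :=
    ENNReal.tendsto_ofReal ((hlim.sub_const _).abs)
  exact le_of_tendsto' hlim2 hN

/-- The flatness half-ball. -/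
def cap {d : ℕ} (γ : ℝ) (y : Euc d) (ρ : ℝ) (ν : Euc d) : Set (Euc d) :=
  {x ∈ ball y ρ | γ * ρ < inner ℝ (x - y) ν}

lemma cap_convex {d : ℕ} (γ : ℝ) (y : Euc d) (ρ : ℝ) (ν : Euc d) : Convex ℝ (cap γ y ρ ν) := by
  have h : cap γ y ρ ν = ball y ρ ∩ {x | γ * ρ + inner ℝ y ν < inner ℝ ν x} := by
    ext x
    simp only [cap, Set.mem_ofPred_eq, mem_inter_iff, inner_sub_left, real_inner_comm x ν]
    constructor
    · rintro ⟨h1, h2⟩; exact ⟨h1, by linarith⟩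
    · rintro ⟨h1, h2⟩; exact ⟨h1, by linarith⟩
  rw [h]
  refine (convex_ball _ _).inter ?_
  exact convex_halfSpace_gt (f := fun x => inner ℝ ν x) ((innerSL ℝ ν).toLinearMap.isLinear) _

lemma cap_open {d : ℕ} (γ : ℝ) (y : Euc d) (ρ : ℝ) (ν : Euc d) : IsOpen (cap γ y ρ ν) := by
  have h : cap γ y ρ ν = ball y ρ ∩ {x | γ * ρ < inner ℝ (x - y) ν} := rfl
  rw [h]
  exact isOpen_ball.inter (isOpen_lt (by fun_prop) (by fun_prop))

lemma preconn_frontier {d : ℕ} {Ω S : Set (Euc d)} (hS : IsPreconnected S)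
    (h1 : (S ∩ Ω).Nonempty) (h2 : (S ∩ Ωᶜ).Nonempty) : (S ∩ frontier Ω).Nonempty := by
  by_contra hcon
  rw [not_nonempty_iff_eq_empty] at hcon
  have hx : ∀ x ∈ S, x ∈ closure Ω → x ∈ interior Ω := by
    intro x hx hc
    by_contra hi
    have : x ∈ S ∩ frontier Ω := ⟨hx, hc, hi⟩
    rw [hcon] at this
    exact this
  obtain ⟨a, ha, ha'⟩ := h1
  obtain ⟨b, hb, hb'⟩ := h2
  obtain ⟨z, hz, hz1, hz2⟩ := hS (interior Ω) (closure Ω)ᶜ isOpen_interior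
    isClosed_closure.isOpen_compl
    (fun x h => by
      by_cases hc : x ∈ closure Ω
      · exact Or.inl (hx x h hc)
      · exact Or.inr hc)
    ⟨a, ha, hx a ha (subset_closure ha')⟩
    ⟨b, hb, fun hc => hb' (interior_subset (hx b hb hc))⟩
  exact hz2 (subset_closure (interior_subset hz1))

lemma seg_frontier {d : ℕ} {Ω : Set (Euc d)} {p v : Euc d} {T : ℝ} (hT : 0 ≤ T)
    (hp : p ∈ Ω) (hq : p + T • v ∉ Ω) : ∃ t ∈ Icc 0 T, p + t • v ∈ frontier Ω := by
  have h1 : IsPreconnected ((fun t : ℝ => p + t • v) '' Icc 0 T) :=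
    isPreconnected_Icc.image _ (by fun_prop)
  obtain ⟨z, ⟨t, ht, rfl⟩, hz⟩ := preconn_frontier (Ω := Ω) h1
    ⟨p, ⟨0, ⟨le_rfl, hT⟩, by simp⟩, hp⟩ ⟨p + T • v, ⟨T, ⟨hT, le_rfl⟩, rfl⟩, hq⟩
  exact ⟨t, ht, hz⟩

lemma cap_of_ball {d : ℕ} {Ω : Set (Euc d)} {γ ρ s s' : ℝ} {y ν c : Euc d} (hγ : 0 < γ)
    (hρ : 0 < ρ) (hν : ‖ν‖ = 1)
    (h2 : Ω ∩ ball y ρ ⊆ {x | -(γ * ρ) < (inner ℝ (x - y) ν : ℝ)})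
    (hc : ball c s ⊆ Ω) (hc2 : ball c s ⊆ ball y ρ) (hs : s' + 2 * (γ * ρ) ≤ s) :
    ball c s' ⊆ cap γ y ρ ν := by
  have hγρ : 0 < γ * ρ := by positivity
  intro z hz
  have hz' : z - (2 * (γ * ρ)) • ν ∈ ball c s := by
    rw [mem_ball, dist_eq_norm] at hz ⊢
    have e : z - (2 * (γ * ρ)) • ν - c = (z - c) - (2 * (γ * ρ)) • ν := by abel
    have h3 : ‖(2 * (γ * ρ)) • ν‖ = 2 * (γ * ρ) := by
      rw [norm_smul, hν, mul_one, Real.norm_eq_abs, abs_of_pos (by positivity)]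
    rw [e]
    refine (norm_sub_le _ _).trans_lt ?_
    linarith
  have h4 := h2 ⟨hc hz', hc2 hz'⟩
  simp only [Set.mem_ofPred_eq] at h4
  refine ⟨hc2 (ball_subset_ball (by linarith) hz), ?_⟩
  have e : z - (2 * (γ * ρ)) • ν - y = (z - y) - (2 * (γ * ρ)) • ν := by abel
  rw [e, inner_sub_left, inner_smul_left, real_inner_self_eq_norm_sq, hν] at h4
  simp at h4
  linarith

lemma ball_sub_cap {d : ℕ} {γ ρ : ℝ} (y : Euc d) {ν : Euc d} {s : ℝ} (hρ : 0 < ρ)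
    (hγ0 : 0 < γ) (hν : ‖ν‖ = 1) (hs : s + γ * ρ ≤ ρ / 2) :
    ball (y + (ρ / 2) • ν) s ⊆ cap γ y ρ ν := by
  have hγρ : 0 < γ * ρ := by positivity
  intro z hz
  rw [mem_ball, dist_eq_norm] at hz
  have e : z - y = (z - (y + (ρ / 2) • ν)) + (ρ / 2) • ν := by abel
  have h3 : ‖(ρ / 2) • ν‖ = ρ / 2 := by
    rw [norm_smul, hν, mul_one, Real.norm_eq_abs, abs_of_pos (by positivity)]
  constructor
  · rw [mem_ball, dist_eq_norm, e]
    refine (norm_add_le _ _).trans_lt ?_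
    linarith
  · rw [e, inner_add_left, inner_smul_left, real_inner_self_eq_norm_sq, hν]
    have h5 := abs_real_inner_le_norm (z - (y + (ρ / 2) • ν)) ν
    rw [hν, mul_one] at h5
    have := (abs_le.1 h5).1
    simp
    linarith

/-- the lower bound extends to the closure -/
lemma frontier_inner {d : ℕ} {Ω : Set (Euc d)} (hΩ : IsOpen Ω) {γ ρ : ℝ} {y ν b : Euc d}
    (h1 : {x ∈ ball y ρ | γ * ρ < inner ℝ (x - y) ν} ⊆ Ω)
    (h2 : Ω ∩ ball y ρ ⊆ {x | -(γ * ρ) < (inner ℝ (x - y) ν : ℝ)})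
    (hb : b ∈ frontier Ω) (hby : b ∈ ball y ρ) : |inner ℝ (b - y) ν| ≤ γ * ρ := by
  rw [hΩ.frontier_eq] at hb
  rw [abs_le]
  constructor
  · have h3 : b ∈ closure (Ω ∩ ball y ρ) := by
      rw [inter_comm]
      exact isOpen_ball.inter_closure ⟨hby, hb.1⟩
    have h4 : IsClosed {x : Euc d | -(γ * ρ) ≤ (inner ℝ (x - y) ν : ℝ)} :=
      isClosed_le (by fun_prop) (by fun_prop)
    have h5 : Ω ∩ ball y ρ ⊆ {x : Euc d | -(γ * ρ) ≤ (inner ℝ (x - y) ν : ℝ)} := by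
      intro x hx
      have := h2 hx
      simp only [Set.mem_ofPred_eq] at this ⊢
      exact this.le
    exact closure_minimal h5 h4 h3
  · by_contra hcon
    push Not at hcon
    exact hb.2 (h1 ⟨hby, hcon⟩)

/-- a boundary point close to any point that is close to the flat plane -/
lemma exists_bdry_near {d : ℕ} {Ω : Set (Euc d)} {γ ρ τ : ℝ} {y ν q : Euc d}
    (hν : ‖ν‖ = 1) (h1 : {x ∈ ball y ρ | γ * ρ < inner ℝ (x - y) ν} ⊆ Ω)
    (h2 : Ω ∩ ball y ρ ⊆ {x | -(γ * ρ) < (inner ℝ (x - y) ν : ℝ)}) (hτ : 0 ≤ τ)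
    (hq : |inner ℝ (q - y) ν| < τ - γ * ρ) (hqd : dist q y + τ < ρ) :
    ∃ t ∈ Icc (-τ) τ, q + t • ν ∈ frontier Ω := by
  have hb := abs_lt.1 hq
  have hball : ∀ t ∈ Icc (-τ) τ, q + t • ν ∈ ball y ρ := by
    intro t ht
    rw [mem_ball, dist_eq_norm]
    have e : q + t • ν - y = (q - y) + t • ν := by abel
    have h3 : ‖t • ν‖ ≤ τ := by
      rw [norm_smul, hν, mul_one, Real.norm_eq_abs]; exact abs_le.2 ht
    rw [e]
    refine (norm_add_le _ _).trans_lt ?_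
    rw [dist_eq_norm] at hqd
    linarith
  have hin : ∀ t : ℝ, inner ℝ (q + t • ν - y) ν = inner ℝ (q - y) ν + t := by
    intro t
    have e : q + t • ν - y = (q - y) + t • ν := by abel
    rw [e, inner_add_left, inner_smul_left, real_inner_self_eq_norm_sq, hν]; simp
  have hp : q + τ • ν ∈ Ω := by
    apply h1
    refine ⟨hball τ ⟨by linarith, le_rfl⟩, ?_⟩
    rw [hin]; linarith
  have hn : q + τ • ν + (2 * τ) • (-ν) ∉ Ω := by
    have e : q + τ • ν + (2 * τ) • (-ν) = q + (-τ) • ν := by module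
    rw [e]
    intro hcon
    have := h2 ⟨hcon, hball (-τ) ⟨le_rfl, by linarith⟩⟩
    simp only [Set.mem_ofPred_eq] at this
    rw [hin] at this; linarith
  obtain ⟨t, ht, hf⟩ := seg_frontier (by linarith) hp hn
  refine ⟨τ - t, ⟨by linarith [ht.2], by linarith [ht.1]⟩, ?_⟩
  convert hf using 1
  module

lemma exists_gamma_near {d : ℕ} {Ω N D : Set (Euc d)} {γ R1 r : ℝ} (hΩ : IsOpen Ω)
    (hγ0 : 0 < γ) (hγ : γ ≤ 1 / 48) (hsplit : BoundarySplit Ω N D) (hRF : ReifenbergFlat Ω γ R1)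
    (hr : 0 < r) (hrR : 2 * r ≤ R1) {y0 n : Euc d} (hy0 : y0 ∈ D) (hn : n ∈ N)
    (hny : dist n y0 < r) : ∃ w ∈ closure N ∩ closure D, dist w y0 ≤ 4 * r := by
  obtain ⟨hf, hdis, -, -⟩ := hsplit
  have hNf : closure N ⊆ frontier Ω := closure_minimal (by rw [hf]; exact subset_union_left)
    isClosed_frontier
  have hDf : closure D ⊆ frontier Ω := closure_minimal (by rw [hf]; exact subset_union_right)
    isClosed_frontier
  set K : Set (Euc d × Euc d) := (closure N ∩ closedBall y0 (10 * r)) ×ˢ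
    (closure D ∩ closedBall y0 (10 * r)) with hK
  have hKc : IsCompact K :=
    ((isCompact_closedBall _ _).inter_left isClosed_closure).prod
      ((isCompact_closedBall _ _).inter_left isClosed_closure)
  have hmem : (n, y0) ∈ K := by
    refine ⟨⟨subset_closure hn, ?_⟩, ⟨subset_closure hy0, ?_⟩⟩
    · rw [mem_closedBall]; linarith
    · rw [mem_closedBall, dist_self]; linarith
  obtain ⟨⟨a, b⟩, hab, hmin⟩ := hKc.exists_isMinOn ⟨_, hmem⟩
    (f := fun q : Euc d × Euc d => 4 * dist q.1 q.2 + dist q.2 y0) (by fun_prop)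
  have hmin' : ∀ a' b', a' ∈ closure N → b' ∈ closure D → dist a' y0 ≤ 10 * r →
      dist b' y0 ≤ 10 * r → 4 * dist a b + dist b y0 ≤ 4 * dist a' b' + dist b' y0 := by
    intro a' b' h1 h2 h3 h4
    exact hmin (a := (a', b')) ⟨⟨h1, mem_closedBall.2 h3⟩, ⟨h2, mem_closedBall.2 h4⟩⟩
  obtain ⟨⟨haN, haB⟩, ⟨hbD, hbB⟩⟩ := hab
  simp only at haN hbD haB hbB
  have h0 := hmin' n y0 (subset_closure hn) (subset_closure hy0) (by linarith)
    (by rw [dist_self]; linarith)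
  rw [dist_self] at h0
  have hbd : dist b y0 ≤ 4 * r := by linarith [dist_nonneg (x := a) (y := b)]
  have hl : dist a b ≤ r := by linarith [dist_nonneg (x := b) (y := y0)]
  rcases eq_or_ne a b with heq | hne
  · subst heq
    exact ⟨a, ⟨haN, hbD⟩, hbd⟩
  exfalso
  have hl0 : 0 < dist a b := dist_pos.2 hne
  set l := dist a b with hldef
  obtain ⟨ν, hν, h1, h2⟩ := hRF a (hNf haN) (2 * l) ⟨by linarith, by linarith⟩
  have hba : b ∈ ball a (2 * l) := by
    rw [mem_ball, dist_comm]; linarith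
  have hin := frontier_inner hΩ h1 h2 (hDf hbD) hba
  set q0 : Euc d := a + (1/2 : ℝ) • (b - a) with hq0
  have e1 : q0 - a = (1/2:ℝ) • (b - a) := by rw [hq0]; abel
  have e2 : q0 - b = -((1/2:ℝ) • (b - a)) := by rw [hq0]; module
  have hn1 : ‖(1/2:ℝ) • (b - a)‖ = l / 2 := by
    rw [norm_smul, ← dist_eq_norm, dist_comm b a, ← hldef]; norm_num; ring
  have hd1 : dist q0 a = l / 2 := by rw [dist_eq_norm, e1, hn1]
  have hd2 : dist q0 b = l / 2 := by rw [dist_eq_norm, e2, norm_neg, hn1]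
  have hgl : γ * l ≤ l / 48 := by nlinarith
  have hgl0 : 0 < γ * l := by positivity
  obtain ⟨t, ht, hq⟩ := exists_bdry_near (q := q0) (τ := 4 * (γ * l)) hν h1 h2 (by linarith)
    (by
      rw [e1, inner_smul_left, abs_mul]
      simp only [conj_trivial]
      rw [abs_of_pos (by norm_num : (0:ℝ) < 1/2)]
      linarith)
    (by rw [hd1]; linarith)
  set q := q0 + t • ν with hqdef
  have hqq : dist q q0 ≤ l / 12 := by
    rw [dist_eq_norm, hqdef, add_sub_cancel_left, norm_smul, hν, mul_one, Real.norm_eq_abs]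
    have := abs_le.2 ht
    linarith
  have hqa : dist q a ≤ 7 / 12 * l := by linarith [dist_triangle q q0 a]
  have hqb : dist q b ≤ 7 / 12 * l := by linarith [dist_triangle q q0 b]
  have hqy : dist q y0 ≤ 10 * r := by linarith [dist_triangle q b y0]
  have hbB' : dist b y0 ≤ 10 * r := by linarith
  rw [hf] at hq
  rcases hq with hqN | hqD
  · have := hmin' q b (subset_closure hqN) hbD hqy hbB'
    linarith
  · have := hmin' a q haN (subset_closure hqD) haB hqy
    rw [dist_comm a q] at this
    linarith [dist_triangle q b y0]

lemma exists_D_ball {d m : ℕ} {Ω N D : Set (Euc d)} {γ R1 r M : ℝ} (hΩ : IsOpen Ω)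
    (hγ0 : 0 < γ) (hγ : γ ≤ 1 / 48) (hM : 0 < M) (hsplit : BoundarySplit Ω N D)
    (hRF : ReifenbergFlat Ω γ R1) (hFS : FlatSeparation Ω N D m M γ R1)
    (hr : 0 < r) (hrR : 2 * r ≤ R1) {y0 : Euc d} (hy0 : y0 ∈ D) :
    ∃ w' ∈ frontier Ω, dist w' y0 ≤ 5 * r ∧
      frontier Ω ∩ ball w' (r / (4 * (1 + M))) ⊆ D := by
  have hf := hsplit.1
  have hs4 : r / (4 * (1 + M)) ≤ r / 4 := by
    apply div_le_div_of_nonneg_left hr.le (by norm_num); linarith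
  by_cases hall : frontier Ω ∩ ball y0 r ⊆ D
  · refine ⟨y0, by rw [hf]; exact Or.inr hy0, by rw [dist_self]; linarith, ?_⟩
    refine Subset.trans (inter_subset_inter_right _ (ball_subset_ball ?_)) hall
    linarith
  rw [not_subset] at hall
  obtain ⟨n, ⟨hnf, hnb⟩, hnD⟩ := hall
  have hnN : n ∈ N := by
    rw [hf] at hnf
    exact hnf.resolve_right hnD
  obtain ⟨w, hw, hwy⟩ := exists_gamma_near hΩ hγ0 hγ hsplit hRF hr hrR hy0 hnN hnb
  obtain ⟨ν, hν, h1, h2, φ, hφ, hφD, hφN⟩ := hFS w hw r ⟨hr, by linarith⟩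
  have hνn : ∀ i, ‖ν i‖ = 1 := hν.1
  have hγr : γ * r ≤ r / 48 := by nlinarith
  have hγr0 : 0 < γ * r := by positivity
  have hν01 : (inner ℝ (ν 1) (ν 0) : ℝ) = 0 := hν.2 (by simp)
  -- upper bound for φ at 0
  have hφcont : Continuous φ := by
    have : LipschitzWith (Real.toNNReal M) φ := by
      apply LipschitzWith.of_dist_le_mul
      intro a b
      rw [Real.dist_eq, dist_eq_norm, Real.coe_toNNReal _ hM.le]
      exact hφ a b
    exact this.continuous
  set P : Euc d → Euc m := fun x => WithLp.toLp 2 ((fun i : Fin m =>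
    (inner ℝ (x - w) (ν ⟨i.1 + 2, by omega⟩) : ℝ)) : Fin m → ℝ) with hP
  have hPc : Continuous P := by
    rw [hP]; fun_prop
  have hPw : P w = 0 := by
    ext i; simp [hP]
  have hφ0 : φ 0 ≤ γ * r := by
    by_contra hcon
    push Not at hcon
    have hop : IsOpen {x : Euc d | (inner ℝ (x - w) (ν 1) : ℝ) < φ (P x) - γ * r} :=
      isOpen_lt (by fun_prop) (by fun_prop)
    have hwm : w ∈ ball w r ∩ {x : Euc d | (inner ℝ (x - w) (ν 1) : ℝ) < φ (P x) - γ * r} := by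
      refine ⟨mem_ball_self hr, ?_⟩
      simp only [Set.mem_ofPred_eq, sub_self, inner_zero_left, hPw]
      linarith
    obtain ⟨z, ⟨hz1, hz2⟩, hzD⟩ := mem_closure_iff.1 hw.2 _ (isOpen_ball.inter hop) hwm
    have hzN : z ∈ N := hφN ⟨⟨by rw [hf]; exact Or.inr hzD, hz1⟩, hz2⟩
    have : z ∈ N ∩ D := ⟨hzN, hzD⟩
    rw [hsplit.2.1] at this
    exact this
  have hn1 : ‖(r / 2) • ν 1‖ = r / 2 := by
    rw [norm_smul, hνn, mul_one, Real.norm_eq_abs, abs_of_pos (by positivity)]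
  obtain ⟨t, ht, hwf⟩ := exists_bdry_near (q := w + (r / 2) • ν 1) (τ := 2 * (γ * r)) (hνn 0)
    h1 h2 (by linarith)
    (by rw [add_sub_cancel_left, inner_smul_left, hν01]; simp; linarith)
    (by rw [dist_eq_norm, add_sub_cancel_left, hn1]; linarith)
  set w' := w + (r / 2) • ν 1 + t • ν 0 with hw'
  have hd1 : dist w' w ≤ r / 2 + r / 24 := by
    rw [dist_eq_norm]
    have e : w' - w = (r / 2) • ν 1 + t • ν 0 := by rw [hw']; abel
    rw [e]
    refine (norm_add_le _ _).trans ?_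
    rw [hn1, norm_smul, hνn, mul_one, Real.norm_eq_abs]
    have := abs_le.2 ht
    linarith
  refine ⟨w', hwf, by linarith [dist_triangle w' w y0], ?_⟩
  rintro q ⟨hqf, hqb⟩
  rw [mem_ball] at hqb
  apply hφD
  refine ⟨⟨hqf, ?_⟩, ?_⟩
  · rw [mem_ball]; linarith [dist_triangle q w' w]
  · simp only [Set.mem_ofPred_eq]
    change φ (P q) + γ * r < _
    have e : q - w = (q - w') + ((r / 2) • ν 1 + t • ν 0) := by rw [hw']; abel
    have hν00 : (inner ℝ (ν 0) (ν 1) : ℝ) = 0 := hν.2 (by simp)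
    have hx1 : (inner ℝ (q - w) (ν 1) : ℝ) = inner ℝ (q - w') (ν 1) + r / 2 := by
      rw [e, inner_add_left, inner_add_left, inner_smul_left, inner_smul_left, hν00,
        real_inner_self_eq_norm_sq, hνn]
      simp
    have hx2 : ‖P q‖ ≤ ‖q - w'‖ := by
      have hPq : ∀ i : Fin m, P q i = inner ℝ (ν ⟨i.1 + 2, by omega⟩) (q - w') := by
        intro i
        have hi0 : (inner ℝ (ν 0) (ν ⟨i.1 + 2, by omega⟩) : ℝ) = 0 :=
          hν.2 (by simp [Fin.ext_iff])
        have hi1 : (inner ℝ (ν 1) (ν ⟨i.1 + 2, by omega⟩) : ℝ) = 0 :=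
          hν.2 (by simp [Fin.ext_iff])
        change (inner ℝ (q - w) (ν ⟨i.1 + 2, by omega⟩) : ℝ) = _
        rw [e, inner_add_left, inner_add_left, inner_smul_left, inner_smul_left, hi0, hi1,
          real_inner_comm]
        simp
      have hort : Orthonormal ℝ (fun i : Fin m => ν ⟨i.1 + 2, by omega⟩) := by
        apply hν.comp (fun i : Fin m => (⟨i.1 + 2, by omega⟩ : Fin (m + 2)))
        intro i j hij
        simp only [Fin.mk.injEq] at hij
        ext; omega
      have hbes := hort.sum_inner_products_le (q - w') (s := Finset.univ)
      rw [← abs_of_nonneg (norm_nonneg (P q)), ← abs_of_nonneg (norm_nonneg (q - w')),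
        ← sq_le_sq, EuclideanSpace.norm_sq_eq]
      refine le_trans (le_of_eq ?_) hbes
      apply Finset.sum_congr rfl
      intro i _
      rw [hPq]
    have hx3 : -‖q - w'‖ ≤ inner ℝ (q - w') (ν 1) := by
      have h5 := abs_real_inner_le_norm (q - w') (ν 1)
      rw [hνn, mul_one] at h5
      exact (abs_le.1 h5).1
    have hx4 := (abs_le.1 (hφ (P q) 0)).2
    rw [sub_zero] at hx4
    rw [dist_eq_norm] at hqb
    have hx5 : (1 + M) * (r / (4 * (1 + M))) = r / 4 := by field_simp
    have hx6 : (1 + M) * ‖q - w'‖ ≤ r / 4 := by rw [← hx5]; gcongr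
    have hx7 : M * ‖P q‖ ≤ M * ‖q - w'‖ := by gcongr
    rw [hx1]
    nlinarith

/-- a choice of flatness directions -/
def IsDir {d : ℕ} (Ω : Set (Euc d)) (γ R1 : ℝ) (ν : Euc d → ℝ → Euc d) : Prop :=
  ∀ x0 ∈ frontier Ω, ∀ R ∈ Set.Ioc (0 : ℝ) R1, ‖ν x0 R‖ = 1 ∧
    (cap γ x0 R (ν x0 R) ⊆ Ω) ∧
    (Ω ∩ ball x0 R ⊆ {x | -(γ * R) < (inner ℝ (x - x0) (ν x0 R) : ℝ)})

lemma exists_dir {d : ℕ} {Ω : Set (Euc d)} {γ R1 : ℝ} (h : ReifenbergFlat Ω γ R1) :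
    ∃ ν, IsDir Ω γ R1 ν := by
  choose! ν hν using h
  exact ⟨ν, hν⟩

lemma cap_sub_ball {d : ℕ} (γ : ℝ) (y : Euc d) (ρ : ℝ) (ν : Euc d) : cap γ y ρ ν ⊆ ball y ρ :=
  fun _ h => h.1

lemma cap_trans {d : ℕ} {Ω : Set (Euc d)} {γ R1 ρ : ℝ} {ν : Euc d → ℝ → Euc d}
    (hγ0 : 0 < γ) (hγ : γ ≤ 1 / 48) (hν : IsDir Ω γ R1 ν) (hρ : 0 < ρ) (hρR : ρ ≤ R1)
    {y0 y1 : Euc d} (hy0 : y0 ∈ frontier Ω) (hy1 : y1 ∈ frontier Ω) (hd : dist y1 y0 ≤ ρ / 2) :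
    ball (y1 + (ρ / 2 / 2) • ν y1 (ρ / 2)) (ρ / 128) ⊆ cap γ y0 ρ (ν y0 ρ) := by
  obtain ⟨a1, a2, a3⟩ := hν y0 hy0 ρ ⟨hρ, hρR⟩
  obtain ⟨b1, b2, b3⟩ := hν y1 hy1 (ρ/2) ⟨by linarith, by linarith⟩
  have hgr : γ * ρ ≤ ρ / 48 := by nlinarith
  have hb : ball (y1 + (ρ / 2 / 2) • ν y1 (ρ / 2)) (ρ / 4 - γ * ρ / 2) ⊆
      cap γ y1 (ρ / 2) (ν y1 (ρ / 2)) :=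
    ball_sub_cap y1 (by linarith) hγ0 b1 (by linarith)
  refine cap_of_ball hγ0 hρ a1 a3 (hb.trans b2) ?_ (s := ρ / 4 - γ * ρ / 2) (by linarith)
  refine (hb.trans (cap_sub_ball _ _ _ _)).trans (ball_subset_ball' (by linarith))

lemma ball_sub_of_frontier {d : ℕ} {Ω : Set (Euc d)} {x : Euc d} {δ : ℝ} (hx : x ∈ Ω)
    (h : ∀ z ∈ frontier Ω, δ ≤ dist x z) : ball x δ ⊆ Ω := by
  intro z hz
  by_contra hcon
  have hδ : 0 < δ := (dist_nonneg).trans_lt (mem_ball.1 hz)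
  obtain ⟨q, hq1, hq2⟩ := preconn_frontier (Ω := Ω) (convex_ball x δ).isPreconnected
    ⟨x, mem_ball_self hδ, hx⟩ ⟨z, hz, hcon⟩
  have := h q hq2
  rw [mem_ball, dist_comm] at hq1
  linarith

lemma chain_bdry {d : ℕ} {Ω : Set (Euc d)} {γ R1 r : ℝ} {ν : Euc d → ℝ → Euc d}
    (hΩ : IsOpen Ω) (hγ0 : 0 < γ) (hγ : γ ≤ 1 / 48) (hν : IsDir Ω γ R1 ν) (hr : 0 < r)
    (hrR : 64 * r ≤ R1) {x y0 : Euc d} (hy0 : y0 ∈ frontier Ω) (hx : x ∈ Ω)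
    (hxy : dist x y0 < 8 * r) :
    ∃ (c : ℕ → Euc d) (E : ℕ → Set (Euc d)), c 0 = y0 + (32 * r) • ν y0 (64 * r) ∧
      (∀ k, Convex ℝ (E k)) ∧ (∀ k, IsOpen (E k)) ∧
      (∀ k, ball (c k) (r * (1/2) ^ k) ⊆ E k) ∧
      (∀ k, ball (c (k+1)) (r * (1/2) ^ (k+1)) ⊆ E k) ∧
      (∀ k, E k ⊆ ball x (80 * (r * (1/2) ^ k))) ∧ (∀ k, E k ⊆ Ω) := by
  classical
  obtain ⟨xs, hxs, hxsd⟩ := isClosed_frontier.exists_infDist_eq_dist ⟨y0, hy0⟩ x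
  set δ := dist x xs with hδ
  have hmin : ∀ z ∈ frontier Ω, δ ≤ dist x z := by
    intro z hz; rw [← hxsd]; exact infDist_le_dist_of_mem hz
  have hbx : ball x δ ⊆ Ω := ball_sub_of_frontier hx hmin
  have hδ8 : δ < 8 * r := (hmin y0 hy0).trans_lt hxy
  set ρ : ℕ → ℝ := fun k => 64 * (r * (1/2:ℝ)^k) with hρ
  have hρp : ∀ k, 0 < ρ k := fun k => by rw [hρ]; positivity
  have hρs : ∀ k, ρ (k+1) = ρ k / 2 := fun k => by simp only [hρ, pow_succ]; ring
  have hρr : ∀ k, r * (1/2:ℝ)^k = ρ k / 64 := fun k => by simp only [hρ]; ring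
  have hρ0 : ρ 0 = 64 * r := by simp [hρ]
  have hρle : ∀ k, ρ k ≤ 64 * r := by
    intro k
    induction k with
    | zero => rw [hρ0]
    | succ k ih => rw [hρs]; linarith [hρp k]
  have hρR : ∀ k, ρ k ≤ R1 := fun k => (hρle k).trans hrR
  set Y : ℕ → Euc d := fun k => if k = 0 then y0 else xs with hY
  have hYf : ∀ k, Y k ∈ frontier Ω := by
    intro k; simp only [hY]; split_ifs <;> assumption
  have hYx : ∀ k, dist x (Y k) ≤ if k = 0 then 8 * r else δ := by
    intro k; simp only [hY]; split_ifs
    · exact hxy.le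
    · exact le_rfl
  set c : ℕ → Euc d := fun k => if 4 * δ ≤ ρ k then Y k + (ρ k / 2) • ν (Y k) (ρ k) else x with hc
  set E : ℕ → Set (Euc d) := fun k => if 4 * δ ≤ ρ k then cap γ (Y k) (ρ k) (ν (Y k) (ρ k))
    else ball x (ρ k / 64) with hE
  have hgr : ∀ k, γ * ρ k ≤ ρ k / 48 := fun k => by nlinarith [hρp k]
  refine ⟨c, E, ?_, ?_, ?_, ?_, ?_, ?_, ?_⟩
  · simp only [hc, hρ0, hY]
    rw [if_pos (by linarith)]
    simp only [if_true]
    congr 2; ring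
  · intro k; simp only [hE]; split_ifs
    · exact cap_convex _ _ _ _
    · exact convex_ball _ _
  · intro k; simp only [hE]; split_ifs
    · exact cap_open _ _ _ _
    · exact isOpen_ball
  · intro k
    rw [hρr]
    simp only [hE, hc]; split_ifs
    · exact ball_sub_cap _ (hρp k) hγ0 (hν _ (hYf k) _ ⟨hρp k, hρR k⟩).1
        (by linarith [hgr k, hρp k])
    · exact Subset.rfl
  · intro k
    rw [hρr, hρs]
    have hp := hρp k
    by_cases h1 : 4 * δ ≤ ρ (k+1)
    · have h2 : 4 * δ ≤ ρ k := by rw [hρs] at h1; linarith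
      simp only [hE, hc]
      rw [if_pos h1, if_pos h2, hρs]
      have hd : dist (Y (k+1)) (Y k) ≤ ρ k / 2 := by
        rcases Nat.eq_zero_or_pos k with h0 | h0
        · subst h0
          simp only [hY, hρ0]
          simp only [zero_add, one_ne_zero, if_false, if_true]
          have := dist_triangle_left xs y0 x
          linarith
        · simp only [hY]
          rw [if_neg (by omega), if_neg (by omega), dist_self]; linarith
      have := cap_trans hγ0 hγ hν (hρp k) (hρR k) (hYf k) (hYf (k+1)) hd
      convert this using 2
      ring
    · by_cases h2 : 4 * δ ≤ ρ k
      · have hk : k ≠ 0 := by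
          rintro rfl
          rw [hρs, hρ0] at h1
          linarith
        simp only [hE, hc]
        rw [if_neg h1, if_pos h2]
        rw [hρs] at h1
        have hYk : Y k = xs := by simp only [hY]; rw [if_neg hk]
        rw [hYk]
        obtain ⟨a1, a2, a3⟩ := hν xs hxs (ρ k) ⟨hρp k, hρR k⟩
        refine cap_of_ball hγ0 (hρp k) a1 a3 (s := ρ k / 8)
          ((ball_subset_ball (by linarith)).trans hbx) (ball_subset_ball' (by linarith)) ?_
        linarith [hgr k]
      · simp only [hE, hc]
        rw [if_neg h1, if_neg h2]
        exact ball_subset_ball (by linarith)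
  · intro k
    rw [hρr]
    have hp := hρp k
    simp only [hE]; split_ifs with h1
    · refine (cap_sub_ball _ _ _ _).trans (ball_subset_ball' ?_)
      have := hYx k
      rw [dist_comm]
      split_ifs at this with h0
      · subst h0
        rw [hρ0]; linarith
      · linarith
    · exact ball_subset_ball (by linarith)
  · intro k
    simp only [hE]; split_ifs with h1
    · exact (hν _ (hYf k) _ ⟨hρp k, hρR k⟩).2.1
    · exact (ball_subset_ball (by linarith [hρp k])).trans hbx

lemma ray_bound {d : ℕ} {Ω D : Set (Euc d)} {γ ρ : ℝ} {y ν z : Euc d} (hΩ : IsOpen Ω)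
    (hγ0 : 0 < γ) (hγ : γ ≤ 1 / 48) (hρ : 0 < ρ) (hν : ‖ν‖ = 1) (h1 : cap γ y ρ ν ⊆ Ω)
    (h2 : Ω ∩ ball y ρ ⊆ {x | -(γ * ρ) < (inner ℝ (x - y) ν : ℝ)})
    (hD : frontier Ω ∩ ball y ρ ⊆ D) (hz : z ∈ ball (y + (ρ / 2) • ν) (ρ / 64))
    {w : Euc d → ℝ} (hw : ContDiff ℝ (⊤ : ℕ∞) w) (hwD : ∀ q ∈ D, w q = 0) {h : Euc d → ENNReal}
    (hh : ∀ q ∈ Ω ∩ ball y ρ, ENNReal.ofReal ‖gradVec w q‖ ≤ h q) :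
    ENNReal.ofReal |w z| ≤ ∫⁻ t in Ioc 0 (3 * ρ / 4), h (z + t • (-ν)) := by
  have hgr : γ * ρ ≤ ρ / 48 := by nlinarith
  have hzΩ : z ∈ Ω := h1 (ball_sub_cap y hρ hγ0 hν (by linarith) hz)
  rw [mem_ball, dist_eq_norm] at hz
  have hball : ∀ t ∈ Icc 0 (3 * ρ / 4), z + t • (-ν) ∈ ball y ρ := by
    intro t ht
    rw [mem_ball, dist_eq_norm]
    have e : z + t • (-ν) - y = (z - (y + (ρ / 2) • ν)) + (ρ / 2 - t) • ν := by module
    rw [e]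
    refine (norm_add_le _ _).trans_lt ?_
    rw [norm_smul, hν, mul_one, Real.norm_eq_abs]
    have : |ρ / 2 - t| ≤ ρ / 2 := abs_le.2 ⟨by linarith [ht.2], by linarith [ht.1]⟩
    linarith
  have hT : z + (3 * ρ / 4) • (-ν) ∉ Ω := by
    intro hcon
    have := h2 ⟨hcon, hball _ ⟨by linarith, le_rfl⟩⟩
    simp only [Set.mem_ofPred_eq] at this
    have e : z + (3 * ρ / 4) • (-ν) - y = (z - (y + (ρ / 2) • ν)) + (-(ρ / 4)) • ν := by module
    rw [e, inner_add_left, inner_smul_left, real_inner_self_eq_norm_sq, hν] at this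
    have h5 := abs_real_inner_le_norm (z - (y + (ρ / 2) • ν)) ν
    rw [hν, mul_one] at h5
    have := (abs_le.1 h5).2
    simp at *
    linarith
  have hcont : Continuous fun t : ℝ => z + t • (-ν) := by fun_prop
  have hcomp : IsCompact (Icc 0 (3 * ρ / 4) ∩ (fun t : ℝ => z + t • (-ν)) ⁻¹' Ωᶜ) :=
    isCompact_Icc.inter_right (hΩ.isClosed_compl.preimage hcont)
  obtain ⟨τ, ⟨hτ1, hτ2⟩, hτ3⟩ := hcomp.exists_isLeast ⟨_, ⟨by linarith, le_rfl⟩, hT⟩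
  have hτΩ : z + τ • (-ν) ∉ Ω := hτ2
  have hlt : ∀ t, 0 ≤ t → t < τ → z + t • (-ν) ∈ Ω := by
    intro t h0 ht
    by_contra hcon
    have := hτ3 ⟨⟨h0, ht.le.trans hτ1.2⟩, hcon⟩
    linarith
  obtain ⟨t, ht, htf⟩ := seg_frontier hτ1.1 hzΩ hτΩ
  have htτ : t = τ := by
    by_contra hne
    have := hlt t ht.1 (lt_of_le_of_ne ht.2 hne)
    rw [hΩ.frontier_eq] at htf
    exact htf.2 this
  subst htτ
  have hq0 : w (z + t • (-ν)) = 0 := hwD _ (hD ⟨htf, hball _ hτ1⟩)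
  have h3 := ftc_le hw z (-ν) hτ1.1
  rw [hq0, zero_sub, abs_neg] at h3
  refine h3.trans ?_
  rw [← setLIntegral_congr Ioo_ae_eq_Ioc]
  refine le_trans (setLIntegral_mono' measurableSet_Ioo (g := fun t => h (z + t • (-ν))) ?_) ?_
  · intro s hs
    rw [norm_neg, hν, mul_one]
    exact hh _ ⟨hlt s hs.1.le hs.2, hball _ ⟨hs.1.le, hs.2.le.trans hτ1.2⟩⟩
  · apply lintegral_mono_set
    intro s hs
    exact ⟨hs.1, hs.2.le.trans hτ1.2⟩

lemma ray_avg {d : ℕ} {b : Set (Euc d)} {w : Euc d → ℝ} {h : Euc d → ENNReal} (hb : MeasurableSet b)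
    (hm : Measurable h) {T : ℝ} {v : Euc d}
    (hr : ∀ z ∈ b, ENNReal.ofReal |w z| ≤ ∫⁻ t in Ioc 0 T, h (z + t • v)) :
    ∫⁻ z in b, ENNReal.ofReal |w z| ≤ ENNReal.ofReal T * ∫⁻ z, h z := by
  calc ∫⁻ z in b, ENNReal.ofReal |w z| ≤ ∫⁻ z in b, ∫⁻ t in Ioc 0 T, h (z + t • v) :=
        setLIntegral_mono' hb hr
    _ ≤ ∫⁻ z, ∫⁻ t in Ioc 0 T, h (z + t • v) := setLIntegral_le_lintegral _ _
    _ = ∫⁻ t in Ioc 0 T, ∫⁻ z, h (z + t • v) :=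
        lintegral_lintegral_swap (by apply Measurable.aemeasurable; fun_prop)
    _ = ∫⁻ t in Ioc 0 T, ∫⁻ z, h z := by
        congr 1; ext t
        exact lintegral_add_right_eq_self h _
    _ = _ := by rw [setLIntegral_const, Real.volume_Ioc, sub_zero, mul_comm]

lemma avg_abs_le {d : ℕ} {w : Euc d → ℝ} (hw : Continuous w) (c : Euc d) {r : ℝ} (hr : 0 < r) :
    ENNReal.ofReal (r ^ d * ub d) * ENNReal.ofReal |avg (ball c r) w| ≤
      ∫⁻ z in ball c r, ENNReal.ofReal |w z| := by
  have hv : 0 < volume.real (ball c r) := by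
    rw [vol_ball _ hr]; have := ub_pos d; positivity
  have h1 : volume.real (ball c r) * (avg (ball c r) w) = ∫ y in ball c r, w y := by
    simp only [avg]
    rw [← measureReal_def]
    field_simp
  rw [← vol_ball c hr, ← ENNReal.ofReal_mul hv.le]
  rw [← abs_of_pos hv, ← abs_mul, h1, ← Real.norm_eq_abs]
  refine (ENNReal.ofReal_le_ofReal (norm_integral_le_integral_norm _)).trans ?_
  rw [ofReal_integral_eq_lintegral_ofReal]
  · exact le_rfl
  · exact (intOn_ball hw _ _).norm
  · exact ae_of_all _ fun t => norm_nonneg _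

lemma enn_le_of {a b : ℝ} (hab : a ≤ b) (I : ENNReal) : ENNReal.ofReal a * I ≤ ENNReal.ofReal b * I := by
  gcongr

lemma avg_D_bound (d : ℕ) {M : ℝ} (hM : 0 < M) : ∃ CD > (0:ℝ), ∀ (m : ℕ) (Ω N D : Set (Euc d))
    (γ R1 r : ℝ) (ν : Euc d → ℝ → Euc d), IsOpen Ω → 0 < γ → γ ≤ 1 / 48 → BoundarySplit Ω N D →
    ReifenbergFlat Ω γ R1 → FlatSeparation Ω N D m M γ R1 → IsDir Ω γ R1 ν → 0 < r → 64 * r ≤ R1 →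
    ∀ y0 ∈ D, ∀ w : Euc d → ℝ, ContDiff ℝ (⊤ : ℕ∞) w → (∀ q ∈ D, w q = 0) →
    ∀ h : Euc d → ENNReal, Measurable h →
    (∀ q ∈ Ω ∩ ball y0 (100 * r), ENNReal.ofReal ‖gradVec w q‖ ≤ h q) →
    ENNReal.ofReal |avg (ball (y0 + (32 * r) • ν y0 (64 * r)) r) w| ≤
      ENNReal.ofReal (CD * (r * (r ^ d)⁻¹)) * ∫⁻ z, h z := by
  have hub := ub_pos d
  have hCb := Cb_pos d
  obtain ⟨J, hJ⟩ : ∃ J : ℕ, (1/2:ℝ)^J < 1 / (256 * (1 + M)) :=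
    exists_pow_lt_of_lt_one (by positivity) (by norm_num)
  have hJ0 : J ≠ 0 := by
    rintro rfl
    rw [pow_zero, lt_div_iff₀ (by positivity)] at hJ
    linarith
  refine ⟨J * (Cb d * (2 ^ J) ^ d) + 48 * (2 ^ J) ^ d / ub d, by positivity, ?_⟩
  intro m Ω N D γ R1 r ν hΩ hγ0 hγ hsplit hRF hFS hν hr hrR y0 hy0 w hw hwD h hhm hh
  have hy0f : y0 ∈ frontier Ω := by rw [hsplit.1]; exact Or.inr hy0
  obtain ⟨w', hw', hwd, hwD'⟩ := exists_D_ball hΩ hγ0 hγ hM hsplit hRF hFS hr (by linarith) hy0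
  set ρ : ℕ → ℝ := fun k => 64 * (r * (1/2:ℝ)^k) with hρ
  have hρp : ∀ k, 0 < ρ k := fun k => by rw [hρ]; positivity
  have hρs : ∀ k, ρ (k+1) = ρ k / 2 := fun k => by simp only [hρ, pow_succ]; ring
  have hρ0 : ρ 0 = 64 * r := by simp [hρ]
  have hρle : ∀ k, ρ k ≤ 64 * r := by
    intro k
    induction k with
    | zero => rw [hρ0]
    | succ k ih => rw [hρs]; linarith [hρp k]
  have hρR : ∀ k, ρ k ≤ R1 := fun k => (hρle k).trans hrR
  have hgr : ∀ k, γ * ρ k ≤ ρ k / 48 := fun k => by nlinarith [hρp k]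
  set Y : ℕ → Euc d := fun k => if k = 0 then y0 else w' with hY
  have hYf : ∀ k, Y k ∈ frontier Ω := by
    intro k; simp only [hY]; split_ifs <;> assumption
  have hYy : ∀ k, dist (Y k) y0 ≤ 5 * r := by
    intro k; simp only [hY]; split_ifs
    · rw [dist_self]; linarith
    · exact hwd
  set c : ℕ → Euc d := fun k => Y k + (ρ k / 2) • ν (Y k) (ρ k) with hc
  have hhcap : ∀ k, ∀ q ∈ Ω ∩ ball (Y k) (ρ k), ENNReal.ofReal ‖gradVec w q‖ ≤ h q := by
    intro k q hq
    apply hh q ⟨hq.1, ?_⟩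
    have h1 := mem_ball.1 hq.2
    rw [mem_ball]
    linarith [dist_triangle q (Y k) y0, hYy k, hρle k]
  have hscale : ∀ k ≤ J, ((ρ k / 64) ^ d)⁻¹ ≤ (2 ^ J) ^ d * (r ^ d)⁻¹ := by
    intro k hk
    have e : ρ k / 64 = r / 2 ^ k := by simp only [hρ]; rw [one_div, inv_pow]; field_simp
    rw [e, div_pow, inv_div, div_eq_mul_inv]
    gcongr
    · norm_num
  have hstep : ∀ k, k < J → ENNReal.ofReal |avg (ball (c (k+1)) (ρ (k+1) / 64)) w -
      avg (ball (c k) (ρ k / 64)) w| ≤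
      ENNReal.ofReal (Cb d * (2 ^ J) ^ d * (r * (r ^ d)⁻¹)) * ∫⁻ z, h z := by
    intro k hk
    have hp := hρp k
    have hd : dist (Y (k+1)) (Y k) ≤ ρ k / 2 := by
      rcases Nat.eq_zero_or_pos k with h0 | h0
      · subst h0
        simp only [hY, hρ0]
        simp only [zero_add, one_ne_zero, if_false, if_true]
        linarith
      · simp only [hY]
        rw [if_neg (by omega), if_neg (by omega), dist_self]; linarith
    obtain ⟨a1, a2, a3⟩ := hν (Y k) (hYf k) (ρ k) ⟨hρp k, hρR k⟩
    have h2 := step_cmp hw (cap_convex γ (Y k) (ρ k) (ν (Y k) (ρ k)))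
      (cap_open γ (Y k) (ρ k) (ν (Y k) (ρ k))) (x := Y k) (c := c k) (c' := c (k+1))
      (r := ρ k / 64) (by positivity)
      (ball_sub_cap _ (hρp k) hγ0 a1 (by linarith [hgr k]))
      (by
        have := cap_trans hγ0 hγ hν (hρp k) (hρR k) (hYf k) (hYf (k+1)) hd
        simp only [hc]
        rw [hρs]
        convert this using 2
        ring)
      ((cap_sub_ball _ _ _ _).trans (ball_subset_ball (by linarith)))
      (h := h) (fun q hq => hhcap k q ⟨a2 hq, hq.1⟩)
    have e : ρ (k+1) / 64 = ρ k / 64 / 2 := by rw [hρs]; ring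
    rw [e]
    refine h2.trans ?_
    rw [← mul_assoc (ENNReal.ofReal (ρ k / 64)), ← mul_assoc (ENNReal.ofReal (Cb d)),
      ← ENNReal.ofReal_mul (p := ρ k / 64) (by positivity), ← ENNReal.ofReal_mul hCb.le]
    refine mul_le_mul' (ENNReal.ofReal_le_ofReal ?_) (setLIntegral_le_lintegral _ _)
    have h3 := hscale k hk.le
    have h4 : ρ k / 64 ≤ r := by linarith [hρle k]
    calc Cb d * (ρ k / 64 * ((ρ k / 64) ^ d)⁻¹) ≤ Cb d * (r * ((2 ^ J) ^ d * (r ^ d)⁻¹)) := by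
          gcongr
      _ = _ := by ring
  have hsum : ∀ n, n ≤ J → ENNReal.ofReal |avg (ball (c 0) (ρ 0 / 64)) w| ≤
      ENNReal.ofReal (n * (Cb d * (2 ^ J) ^ d * (r * (r ^ d)⁻¹))) * (∫⁻ z, h z) +
      ENNReal.ofReal |avg (ball (c n) (ρ n / 64)) w| := by
    intro n
    induction n with
    | zero => intro _; simp
    | succ n ih =>
      intro hn
      refine (ih (by omega)).trans ?_
      have h3 := hstep n (by omega)
      have h4 := ofReal_tri (avg (ball (c n) (ρ n / 64)) w)
        (avg (ball (c (n+1)) (ρ (n+1) / 64)) w) 0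
      rw [sub_zero, sub_zero, abs_sub_comm] at h4
      have e : ((n + 1 : ℕ) : ℝ) * (Cb d * (2 ^ J) ^ d * (r * (r ^ d)⁻¹)) =
        n * (Cb d * (2 ^ J) ^ d * (r * (r ^ d)⁻¹)) + Cb d * (2 ^ J) ^ d * (r * (r ^ d)⁻¹) := by
        push_cast; ring
      rw [e, ENNReal.ofReal_add (by positivity) (by positivity), add_mul, add_assoc]
      refine add_le_add le_rfl (h4.trans ?_)
      rw [add_comm]
      exact add_le_add h3 le_rfl
  have hend : ENNReal.ofReal |avg (ball (c J) (ρ J / 64)) w| ≤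
      ENNReal.ofReal (48 * (2 ^ J) ^ d / ub d * (r * (r ^ d)⁻¹)) * ∫⁻ z, h z := by
    have hp := hρp J
    obtain ⟨a1, a2, a3⟩ := hν (Y J) (hYf J) (ρ J) ⟨hρp J, hρR J⟩
    have hYJ : Y J = w' := by simp only [hY]; rw [if_neg hJ0]
    have hρJ : ρ J ≤ r / (4 * (1 + M)) := by
      simp only [hρ]
      have : 64 * (r * (1/2:ℝ)^J) ≤ 64 * (r * (1 / (256 * (1 + M)))) := by gcongr
      refine this.trans (le_of_eq ?_)
      field_simp; norm_num
    have hray := ray_avg (b := ball (c J) (ρ J / 64)) measurableSet_ball hhm (w := w)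
      (T := 3 * ρ J / 4) (v := - ν (Y J) (ρ J)) (by
        intro z hz
        refine ray_bound hΩ hγ0 hγ hp a1 a2 a3 ?_ hz hw hwD (hhcap J)
        rw [hYJ]
        exact (inter_subset_inter_right _ (ball_subset_ball hρJ)).trans hwD')
    have h5 := enn_cancel (by positivity) (by positivity)
      ((avg_abs_le hw.continuous (c J) (by positivity)).trans hray)
    refine h5.trans (enn_le_of ?_ _)
    have h3 := hscale J le_rfl
    calc 3 * ρ J / 4 / ((ρ J / 64) ^ d * ub d) = 3 * ρ J / 4 / ub d * ((ρ J / 64) ^ d)⁻¹ := by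
          field_simp
      _ ≤ 48 * r / ub d * ((2 ^ J) ^ d * (r ^ d)⁻¹) := by
          gcongr
          linarith [hρle J]
      _ = _ := by ring
  have hfin := (hsum J le_rfl).trans (add_le_add le_rfl hend)
  have e1 : ball (c 0) (ρ 0 / 64) = ball (y0 + (32 * r) • ν y0 (64 * r)) r := by
    simp only [hc, hρ0, hY, if_true]
    congr 1
    · congr 2; ring
    · ring
  rw [e1] at hfin
  refine hfin.trans (le_of_eq ?_)
  rw [← add_mul, ← ENNReal.ofReal_add (by positivity) (by positivity)]
  congr 2
  ring

/-- cut-off gradient size -/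
noncomputable def hcut {d : ℕ} (w : Euc d → ℝ) (V : Set (Euc d)) : Euc d → ENNReal :=
  V.indicator (fun y => ENNReal.ofReal ‖gradVec w y‖)

lemma hcut_meas {d : ℕ} {w : Euc d → ℝ} (hw : ContDiff ℝ (⊤ : ℕ∞) w) {V : Set (Euc d)}
    (hV : IsOpen V) : Measurable (hcut w V) := by
  unfold hcut
  apply Measurable.indicator _ hV.measurableSet
  have := continuous_gradVec hw
  fun_prop

lemma hcut_le {d : ℕ} {w : Euc d → ℝ} {V : Set (Euc d)} {y : Euc d} (hy : y ∈ V) :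
    ENNReal.ofReal ‖gradVec w y‖ ≤ hcut w V y := by
  unfold hcut; rw [indicator_of_mem hy]

lemma geom (d : ℕ) {M : ℝ} (hM : 0 < M) : ∃ CD > (0:ℝ), ∀ (m : ℕ) (Ω N D : Set (Euc d))
    (γ R1 r : ℝ), IsOpen Ω → 0 < γ → γ ≤ 1 / 48 → BoundarySplit Ω N D →
    ReifenbergFlat Ω γ R1 → FlatSeparation Ω N D m M γ R1 → 0 < r → 64 * r ≤ R1 →
    ∀ z : Euc d, Ω ∩ ball z (2 * r) = ∅ ∨ ∃ c0, ball c0 r ⊆ Ω ∩ ball z (200 * r) ∧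
      ∀ w : Euc d → ℝ, ContDiff ℝ (⊤ : ℕ∞) w → (∀ q ∈ D, w q = 0) →
      (∀ x ∈ Ω ∩ ball z (2 * r), ENNReal.ofReal |w x - avg (ball c0 r) w| ≤
        ENNReal.ofReal (Cb d) * pot (hcut w (Ω ∩ ball z (200 * r))) r x) ∧
      ((D ∩ ball z (2 * r)).Nonempty → ENNReal.ofReal |avg (ball c0 r) w| ≤
        ENNReal.ofReal (CD * (r * (r ^ d)⁻¹)) * ∫⁻ y, hcut w (Ω ∩ ball z (200 * r)) y) := by
  obtain ⟨CD, hCD, hD⟩ := avg_D_bound d hM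
  refine ⟨CD, hCD, ?_⟩
  intro m Ω N D γ R1 r hΩ hγ0 hγ hsplit hRF hFS hr hrR z
  obtain ⟨ν, hν⟩ := exists_dir hRF
  -- the boundary case
  have hbd : ∀ y0 ∈ frontier Ω, dist y0 z < 4 * r →
      ball (y0 + (32 * r) • ν y0 (64 * r)) r ⊆ Ω ∩ ball z (200 * r) ∧
      ∀ w : Euc d → ℝ, ContDiff ℝ (⊤ : ℕ∞) w →
      (∀ x ∈ Ω ∩ ball z (2 * r), ENNReal.ofReal
        |w x - avg (ball (y0 + (32 * r) • ν y0 (64 * r)) r) w| ≤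
        ENNReal.ofReal (Cb d) * pot (hcut w (Ω ∩ ball z (200 * r))) r x) := by
    intro y0 hy0 hy0z
    obtain ⟨a1, a2, a3⟩ := hν y0 hy0 (64 * r) ⟨by positivity, hrR⟩
    constructor
    · have hgr : γ * r ≤ r / 48 := by nlinarith
      have hb : ball (y0 + (64 * r / 2) • ν y0 (64 * r)) r ⊆ cap γ y0 (64 * r) (ν y0 (64 * r)) :=
        ball_sub_cap y0 (by positivity) hγ0 a1 (by linarith)
      have e : 64 * r / 2 = 32 * r := by ring
      rw [e] at hb
      refine subset_inter (hb.trans a2) ?_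
      exact (hb.trans (cap_sub_ball _ _ _ _)).trans (ball_subset_ball' (by linarith))
    · intro w hw x hx
      have hxz := mem_ball.1 hx.2
      obtain ⟨c, E, hc0, hE, hEo, hA, hB, hEx, hEΩ⟩ := chain_bdry hΩ hγ0 hγ hν hr hrR hy0 hx.1
        (by linarith [dist_triangle_right x y0 z])
      rw [← hc0]
      refine chain_pot hw hr hE hEo hA hB (fun k => (hEx k).trans (ball_subset_ball ?_)) ?_
      · have : 0 < r * (1/2:ℝ)^k := by positivity
        linarith
      · intro k y hy
        apply hcut_le
        refine ⟨hEΩ k hy, ?_⟩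
        have h1 := mem_ball.1 (hEx k hy)
        have h2 : r * (1/2:ℝ)^k ≤ r := mul_le_of_le_one_right hr.le
          (pow_le_one₀ (by norm_num) (by norm_num))
        rw [mem_ball]
        linarith [dist_triangle y x z]
  by_cases hDn : (D ∩ ball z (2 * r)).Nonempty
  · obtain ⟨y0, hy0D, hy0z⟩ := hDn
    rw [mem_ball] at hy0z
    have hy0 : y0 ∈ frontier Ω := by rw [hsplit.1]; exact Or.inr hy0D
    obtain ⟨h1, h2⟩ := hbd y0 hy0 (by linarith)
    refine Or.inr ⟨_, h1, fun w hw hwD => ⟨h2 w hw, fun _ => ?_⟩⟩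
    refine hD m Ω N D γ R1 r ν hΩ hγ0 hγ hsplit hRF hFS hν hr hrR y0 hy0D w hw hwD _
      (hcut_meas hw (hΩ.inter isOpen_ball)) ?_
    intro q hq
    apply hcut_le
    exact ⟨hq.1, ball_subset_ball' (by linarith) hq.2⟩
  by_cases hbn : (frontier Ω ∩ ball z (4 * r)).Nonempty
  · obtain ⟨y0, hy0, hy0z⟩ := hbn
    obtain ⟨h1, h2⟩ := hbd y0 hy0 hy0z
    exact Or.inr ⟨_, h1, fun w hw hwD => ⟨h2 w hw, fun h => absurd h hDn⟩⟩
  by_cases hΩn : Ω ∩ ball z (2 * r) = ∅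
  · exact Or.inl hΩn
  right
  have hsub : ball z (4 * r) ⊆ Ω := by
    intro q hq
    by_contra hcon
    apply hbn
    obtain ⟨x, hx⟩ := nonempty_iff_ne_empty.2 hΩn
    rw [inter_comm]
    exact preconn_frontier (convex_ball z (4 * r)).isPreconnected
      ⟨x, ball_subset_ball (by linarith) hx.2, hx.1⟩ ⟨q, hq, hcon⟩
  refine ⟨z, subset_inter ((ball_subset_ball (by linarith)).trans hsub)
    (ball_subset_ball (by linarith)), fun w hw hwD => ⟨?_, fun h => absurd h hDn⟩⟩
  intro x hx
  have hxz := mem_ball.1 hx.2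
  have hrk : ∀ k : ℕ, r * (1/2:ℝ)^k ≤ r := fun k => mul_le_of_le_one_right hr.le
          (pow_le_one₀ (by norm_num) (by norm_num))
  have hrk0 : ∀ k : ℕ, 0 < r * (1/2:ℝ)^k := fun k => by positivity
  set c : ℕ → Euc d := fun k => if k = 0 then z else x with hc
  set E : ℕ → Set (Euc d) := fun k => if k = 0 then ball z (4 * r) else ball x (r * (1/2:ℝ)^k)
    with hE
  have hEz : ∀ k, E k ⊆ ball z (4 * r) := by
    intro k; simp only [hE]; split_ifs
    · exact Subset.rfl
    · exact ball_subset_ball' (by linarith [hrk k])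
  have hc0 : c 0 = z := by simp [hc]
  rw [← hc0]
  refine chain_pot hw hr (c := c) (E := E) ?_ ?_ ?_ ?_ ?_ ?_
  · intro k; simp only [hE]; split_ifs <;> exact convex_ball _ _
  · intro k; simp only [hE]; split_ifs <;> exact isOpen_ball
  · intro k; simp only [hE, hc]; split_ifs
    · exact ball_subset_ball (by linarith [hrk k])
    · exact Subset.rfl
  · intro k
    have h1 : c (k+1) = x := by simp [hc]
    rw [h1]
    simp only [hE]; split_ifs
    · exact ball_subset_ball' (by linarith [hrk (k+1)])
    · apply ball_subset_ball
      have := hrk0 k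
      rw [pow_succ]; linarith
  · intro k; simp only [hE]; split_ifs with h0
    · subst h0
      apply ball_subset_ball'
      rw [dist_comm]
      simp; linarith
    · exact ball_subset_ball (by linarith [hrk0 k])
  · intro k y hy
    apply hcut_le
    exact ⟨hsub (hEz k hy), ball_subset_ball (by linarith) (hEz k hy)⟩

lemma ofReal_sq_abs (a : ℝ) : ENNReal.ofReal (a ^ 2) = (ENNReal.ofReal |a|) ^ 2 := by
  rw [← ENNReal.ofReal_pow (abs_nonneg _), sq_abs]

lemma poinc_smooth (d : ℕ) {M ε : ℝ} (hM : 0 < M) (hε : 0 < ε) : ∃ C > (0:ℝ),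
    ∀ (m : ℕ) (Ω N D : Set (Euc d))
    (γ R1 r : ℝ), IsOpen Ω → 0 < γ → γ ≤ 1 / 48 → BoundarySplit Ω N D →
    ReifenbergFlat Ω γ R1 → FlatSeparation Ω N D m M γ R1 → 0 < r → 64 * r ≤ R1 →
    ∀ z : Euc d, Ω ∩ ball z (2 * r) = ∅ ∨ ∃ c0, ball c0 r ⊆ Ω ∩ ball z (200 * r) ∧
      ∀ w : Euc d → ℝ, ContDiff ℝ (⊤ : ℕ∞) w → (∀ q ∈ D, w q = 0) →
      ∃ c : ℝ, ((D ∩ ball z (2 * r)).Nonempty → c = 0) ∧ |c| ≤ |avg (ball c0 r) w| ∧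
        ∫ x in Ω ∩ ball z (2 * r), (w x - c) ^ 2 ≤ r ^ 2 *
          (ε * (∫ x in Ω ∩ ball z (200 * r), ‖gradVec w x‖ ^ 2) +
            C / r ^ d * (∫ x in Ω ∩ ball z (200 * r), ‖gradVec w x‖) ^ 2) := by
  have hub := ub_pos d
  have hCb := Cb_pos d
  obtain ⟨CD, hCD, hgeom⟩ := geom d hM
  obtain ⟨C, hC, hpot⟩ := pot_L2 d (ε / (2 * Cb d ^ 2)) (by positivity)
  refine ⟨2 * Cb d ^ 2 * C + 2 * CD ^ 2 * 2 ^ d * ub d, by positivity, ?_⟩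
  intro m Ω N D γ R1 r hΩ hγ0 hγ hsplit hRF hFS hr hrR z
  rcases hgeom m Ω N D γ R1 r hΩ hγ0 hγ hsplit hRF hFS hr hrR z with h | ⟨c0, hc0, hw0⟩
  · exact Or.inl h
  refine Or.inr ⟨c0, hc0, ?_⟩
  intro w hw hwD
  obtain ⟨h1, h2⟩ := hw0 w hw hwD
  set V := Ω ∩ ball z (200 * r) with hV
  have hVo : IsOpen V := hΩ.inter isOpen_ball
  have hhm := hcut_meas hw hVo
  have hgc := continuous_gradVec hw
  set I := ∫⁻ y, hcut w V y with hI
  have hItg1 : IntegrableOn (fun x => ‖gradVec w x‖) V := by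
    have : Continuous fun x => ‖gradVec w x‖ := by fun_prop
    exact (this.locallyIntegrable.integrableOn_isCompact (isCompact_closedBall z (200*r))).mono_set
      (inter_subset_right.trans ball_subset_closedBall)
  have hItg2 : IntegrableOn (fun x => ‖gradVec w x‖ ^ 2) V := by
    have : Continuous fun x => ‖gradVec w x‖ ^ 2 := by fun_prop
    exact (this.locallyIntegrable.integrableOn_isCompact (isCompact_closedBall z (200*r))).mono_set
      (inter_subset_right.trans ball_subset_closedBall)
  have hI1 : I = ENNReal.ofReal (∫ x in V, ‖gradVec w x‖) := by
    rw [ofReal_integral_eq_lintegral_ofReal hItg1 (ae_of_all _ fun x => norm_nonneg _), hI]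
    unfold hcut
    rw [lintegral_indicator hVo.measurableSet]
  have hI2 : ∫⁻ y, hcut w V y ^ 2 = ENNReal.ofReal (∫ x in V, ‖gradVec w x‖ ^ 2) := by
    rw [ofReal_integral_eq_lintegral_ofReal hItg2 (ae_of_all _ fun x => by positivity),
      ← lintegral_indicator hVo.measurableSet]
    congr 1; ext y
    unfold hcut
    by_cases hy : y ∈ V
    · rw [indicator_of_mem hy, indicator_of_mem hy, ENNReal.ofReal_pow (norm_nonneg _)]
    · rw [indicator_of_notMem hy, indicator_of_notMem hy]; simp
  classical
  set c : ℝ := if (D ∩ ball z (2 * r)).Nonempty then 0 else avg (ball c0 r) w with hc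
  set Y := ENNReal.ofReal (CD * (r * (r ^ d)⁻¹)) * I with hY
  have hpt : ∀ x ∈ Ω ∩ ball z (2 * r), ENNReal.ofReal |w x - c| ≤
      ENNReal.ofReal (Cb d) * pot (hcut w V) r x + Y := by
    intro x hx
    by_cases hn : (D ∩ ball z (2 * r)).Nonempty
    · rw [hc, if_pos hn]
      refine (ofReal_tri _ (avg (ball c0 r) w) _).trans ?_
      rw [add_comm, sub_zero]
      exact add_le_add (h1 x hx) (h2 hn)
    · rw [hc, if_neg hn]
      exact (h1 x hx).trans le_self_add
  refine ⟨c, fun hn => by rw [hc, if_pos hn], ?_, ?_⟩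
  · rw [hc]; split_ifs
    · simp
    · exact le_rfl
  set G1 := ∫ x in V, ‖gradVec w x‖ with hG1
  set G2 := ∫ x in V, ‖gradVec w x‖ ^ 2 with hG2
  have hG1' : 0 ≤ G1 := integral_nonneg fun x => norm_nonneg _
  have hG2' : 0 ≤ G2 := integral_nonneg fun x => by positivity
  have hItg3 : IntegrableOn (fun x => (w x - c) ^ 2) (Ω ∩ ball z (2 * r)) := by
    have : Continuous fun x => (w x - c) ^ 2 := by have := hw.continuous; fun_prop
    exact (this.locallyIntegrable.integrableOn_isCompact (isCompact_closedBall z (2*r))).mono_set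
      (inter_subset_right.trans ball_subset_closedBall)
  rw [← ENNReal.ofReal_le_ofReal_iff (by positivity),
    ofReal_integral_eq_lintegral_ofReal hItg3 (ae_of_all _ fun x => by positivity)]
  have hP := hpot (hcut w V) hhm r hr z
  rw [hI2, ← hI, hI1] at hP
  rw [hI1] at hY
  have hY2 : ENNReal.ofReal (2*(CD*(r*(r^d)⁻¹)*G1)^2) = 2*Y^2 := by
    rw [ENNReal.ofReal_mul (by norm_num), ENNReal.ofReal_pow (by positivity),
      ENNReal.ofReal_mul (by positivity), hY, ENNReal.ofReal_ofNat]
  calc ∫⁻ x in Ω ∩ ball z (2 * r), ENNReal.ofReal ((w x - c) ^ 2)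
      ≤ ∫⁻ x in Ω ∩ ball z (2 * r), (2 * (ENNReal.ofReal (Cb d) * pot (hcut w V) r x) ^ 2
          + 2 * Y ^ 2) := by
        refine setLIntegral_mono' (hΩ.inter isOpen_ball).measurableSet fun x hx => ?_
        rw [ofReal_sq_abs]
        exact (pow_le_pow_left' (hpt x hx) 2).trans (enn_add_sq _ _)
    _ ≤ ∫⁻ x in ball z (2 * r), (2 * (ENNReal.ofReal (Cb d) * pot (hcut w V) r x) ^ 2
          + 2 * Y ^ 2) := lintegral_mono_set inter_subset_right
    _ = ENNReal.ofReal (2 * Cb d ^ 2) * (∫⁻ x in ball z (2 * r), pot (hcut w V) r x ^ 2) +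
          2 * Y ^ 2 * ENNReal.ofReal ((2 * r) ^ d * ub d) := by
        rw [lintegral_add_right _ measurable_const, setLIntegral_const,
          vol_ball_enn _ (by positivity), ← lintegral_const_mul' _ _ ENNReal.ofReal_ne_top]
        congr 2; ext x
        rw [ENNReal.ofReal_mul (by norm_num), ENNReal.ofReal_pow hCb.le]
        simp only [ENNReal.ofReal_ofNat]
        ring
    _ ≤ ENNReal.ofReal (2 * Cb d ^ 2) * (ENNReal.ofReal (r ^ 2) *
          (ENNReal.ofReal (ε / (2 * Cb d ^ 2)) * ENNReal.ofReal G2 +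
            ENNReal.ofReal (C / r ^ d) * ENNReal.ofReal G1 ^ 2)) +
          2 * Y ^ 2 * ENNReal.ofReal ((2 * r) ^ d * ub d) :=
        add_le_add (mul_le_mul_right hP _) le_rfl
    _ = ENNReal.ofReal (2 * Cb d ^ 2 * (r ^ 2 * (ε / (2 * Cb d ^ 2) * G2 + C / r ^ d * G1 ^ 2)) +
          2 * (CD * (r * (r ^ d)⁻¹) * G1) ^ 2 * ((2 * r) ^ d * ub d)) := by
        rw [ENNReal.ofReal_add (by positivity) (by positivity),
          ENNReal.ofReal_mul (p := 2 * Cb d ^ 2) (by positivity),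
          ENNReal.ofReal_mul (p := r ^ 2) (by positivity),
          ENNReal.ofReal_add (p := ε / (2 * Cb d ^ 2) * G2) (by positivity) (by positivity),
          ENNReal.ofReal_mul (p := ε / (2 * Cb d ^ 2)) (by positivity),
          ENNReal.ofReal_mul (p := C / r ^ d) (by positivity),
          ENNReal.ofReal_pow (p := G1) hG1',
          ENNReal.ofReal_mul (p := 2 * (CD * (r * (r ^ d)⁻¹) * G1) ^ 2) (by positivity),
          hY2]
    _ = _ := by
        congr 1
        rw [mul_pow 2 r d]
        field_simp
        try ring

lemma cs_int {α : Type*} [MeasurableSpace α] {μ : Measure α} {f h : α → ℝ}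
    (hf : MemLp f 2 μ) (hh : MemLp h 2 μ) :
    (∫ x, |f x| * |h x| ∂μ) ^ 2 ≤ (∫ x, f x ^ 2 ∂μ) * ∫ x, h x ^ 2 ∂μ := by
  have h2 : ENNReal.ofReal 2 = 2 := by simp
  have := integral_mul_le_Lp_mul_Lq_of_nonneg (μ := μ) Real.HolderConjugate.two_two
    (f := fun x => |f x|) (g := fun x => |h x|) (ae_of_all _ fun x => abs_nonneg _)
    (ae_of_all _ fun x => abs_nonneg _) (by rw [h2]; exact hf.abs) (by rw [h2]; exact hh.abs)
  simp only [Real.rpow_two, sq_abs] at this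
  have h0 : 0 ≤ ∫ x, |f x| * |h x| ∂μ := integral_nonneg fun x => by positivity
  have hA : 0 ≤ ∫ x, f x ^ 2 ∂μ := integral_nonneg fun x => by positivity
  have hB : 0 ≤ ∫ x, h x ^ 2 ∂μ := integral_nonneg fun x => by positivity
  have := pow_le_pow_left₀ h0 this 2
  rwa [mul_pow, ← Real.sqrt_eq_rpow, ← Real.sqrt_eq_rpow, Real.sq_sqrt hA, Real.sq_sqrt hB] at this

lemma cs_one {α : Type*} [MeasurableSpace α] {μ : Measure α} [IsFiniteMeasure μ] {h : α → ℝ}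
    (hh : MemLp h 2 μ) :
    (∫ x, |h x| ∂μ) ^ 2 ≤ μ.real univ * ∫ x, h x ^ 2 ∂μ := by
  have := cs_int (μ := μ) (memLp_const (1:ℝ)) hh
  simpa using this

lemma int_sq_add {α : Type*} [MeasurableSpace α] {μ : Measure α} {f h k : α → ℝ}
    (hf : MemLp f 2 μ) (hh : MemLp h 2 μ) (hk : ∀ x, |k x| ≤ |f x| + |h x|) :
    ∫ x, k x ^ 2 ∂μ ≤ 2 * (∫ x, f x ^ 2 ∂μ) + 2 * ∫ x, h x ^ 2 ∂μ := by
  rw [← integral_const_mul, ← integral_const_mul, ← integral_add (hf.integrable_sq.const_mul _)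
    (hh.integrable_sq.const_mul _)]
  refine integral_mono_of_nonneg (ae_of_all _ fun x => by positivity)
    ((hf.integrable_sq.const_mul _).add (hh.integrable_sq.const_mul _)) (ae_of_all _ fun x => ?_)
  have := pow_le_pow_left₀ (abs_nonneg _) (hk x) 2
  simp only
  rw [sq_abs] at this
  nlinarith [sq_nonneg (|f x| - |h x|), sq_abs (f x), sq_abs (h x)]

lemma test_grad_cont {d : ℕ} {w : Euc d → ℝ} (hw : IsTest w) :
    Continuous (gradVec w) ∧ HasCompactSupport (gradVec w) := by
  refine ⟨continuous_gradVec hw.1, ?_⟩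
  refine (hw.2.fderiv (𝕜 := ℝ)).mono' ?_
  refine Function.support_subset_iff'.2 fun x hx => ?_
  have : fderiv ℝ w x = 0 := by simpa using (fun h => hx (subset_closure h) : ¬ x ∈ Function.support (fderiv ℝ w))
  unfold gradVec
  rw [this]; ext i; simp

lemma test_memLp {d : ℕ} {w : Euc d → ℝ} (hw : IsTest w) (p : ENNReal) (Ω : Set (Euc d)) :
    MemLp w p (volume.restrict Ω) ∧ MemLp (gradVec w) p (volume.restrict Ω) := by
  have h := test_grad_cont hw
  exact ⟨(hw.1.continuous.memLp_of_hasCompactSupport hw.2).restrict _,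
    (h.1.memLp_of_hasCompactSupport h.2).restrict _⟩

set_option maxHeartbeats 1000000 in
lemma poinc_u (d : ℕ) {M ε : ℝ} (hM : 0 < M) (hε : 0 < ε) : ∃ C > (0:ℝ),
    ∀ (m : ℕ) (Ω N D : Set (Euc d))
    (γ R1 r : ℝ), IsOpen Ω → 0 < γ → γ ≤ 1 / 48 → BoundarySplit Ω N D →
    ReifenbergFlat Ω γ R1 → FlatSeparation Ω N D m M γ R1 → 0 < r → 64 * r ≤ R1 →
    ∀ (z : Euc d) (u : Euc d → ℝ) (g : Euc d → Euc d), MemW1pD u g D Ω 2 →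
    ∀ δ > 0, ∃ c : ℝ, ((D ∩ ball z (2 * r)).Nonempty → c = 0) ∧
        ∫ x in Ω ∩ ball z (2 * r), (u x - c) ^ 2 ≤ r ^ 2 *
          (ε * (∫ x in Ω ∩ ball z (200 * r), ‖g x‖ ^ 2) +
            C / r ^ d * (∫ x in Ω ∩ ball z (200 * r), ‖g x‖) ^ 2) + δ ∧
        ((Ω ∩ ball z (2 * r)).Nonempty →
        r ^ d * c ^ 2 ≤ C / r ^ d * (∫ x in Ω ∩ ball z (200 * r), |u x|) ^ 2 + δ) := by
  have hub := ub_pos d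
  obtain ⟨C0, hC0, hP⟩ := poinc_smooth d hM (by positivity : 0 < ε / 4)
  refine ⟨4 * C0 + 2 / (ub d) ^ 2, by positivity, ?_⟩
  intro m Ω N D γ R1 r hΩ hγ0 hγ hsplit hRF hFS hr hrR z u g hu δ hδ
  obtain ⟨hu2, hg2, -, un, hun, hT1, hT2⟩ := hu
  have h2 : ENNReal.ofReal 2 = 2 := by simp
  rw [h2] at hu2 hg2
  simp only [Real.rpow_two, sq_abs] at hT1 hT2
  set V := Ω ∩ ball z (200 * r) with hV
  have hVΩ : V ⊆ Ω := inter_subset_left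
  have hVfin : volume V < ⊤ := (measure_mono inter_subset_right).trans_lt measure_ball_lt_top
  have : IsFiniteMeasure (volume.restrict V) := ⟨by simpa using hVfin⟩
  have hVm : MeasurableSet V := (hΩ.inter isOpen_ball).measurableSet
  set v := (volume.restrict V).real univ with hv
  have hv0 : 0 ≤ v := measureReal_nonneg
  set G1 := ∫ x in V, ‖g x‖ with hG1
  set G2 := ∫ x in V, ‖g x‖ ^ 2 with hG2
  set A := ∫ x in V, |u x| with hA
  have hG1' : 0 ≤ G1 := integral_nonneg fun x => norm_nonneg _
  have hG2' : 0 ≤ G2 := integral_nonneg fun x => by positivity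
  have hA' : 0 ≤ A := integral_nonneg fun x => abs_nonneg _
  rcases hP m Ω N D γ R1 r hΩ hγ0 hγ hsplit hRF hFS hr hrR z with h | ⟨c0, hc0, hw0⟩
  · refine ⟨0, fun _ => rfl, ?_, ?_⟩
    · rw [h]; simp; positivity
    · rw [h]; simp
  have hlim : Tendsto (fun n => (r ^ 2 * (ε + 4 * C0 * v / r ^ d)) *
      (∫ x in Ω, ‖gradVec (un n) x - g x‖ ^ 2) +
      (2 + 2 * v / (ub d ^ 2 * r ^ d)) * ∫ x in Ω, (un n x - u x) ^ 2) atTop (𝓝 0) := by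
    have := (hT2.const_mul (r ^ 2 * (ε + 4 * C0 * v / r ^ d))).add
      (hT1.const_mul (2 + 2 * v / (ub d ^ 2 * r ^ d)))
    simpa using this
  obtain ⟨n, hn⟩ := (hlim.eventually (gt_mem_nhds hδ)).exists
  obtain ⟨w, hwn⟩ : ∃ w, w = un n := ⟨_, rfl⟩
  have hwT := hun n
  rw [← hwn] at hn hwT
  set E := ∫ x in Ω, ‖gradVec w x - g x‖ ^ 2 with hE
  set E' := ∫ x in Ω, (w x - u x) ^ 2 with hE'
  have hE0 : 0 ≤ E := integral_nonneg fun x => by positivity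
  have hE0' : 0 ≤ E' := integral_nonneg fun x => by positivity
  obtain ⟨hw, hwD⟩ := hwT
  obtain ⟨c, hcD, hc, hcP⟩ := hw0 w hw.1 (fun q hq => by
    by_contra hne
    have : q ∈ Function.support w ∩ D := ⟨hne, hq⟩
    rw [hwD] at this; exact this)
  have hres : volume.restrict V ≤ volume.restrict Ω := Measure.restrict_mono hVΩ le_rfl
  have hLw := test_memLp hw 2 Ω
  have mdu : MemLp (fun x => w x - u x) 2 (volume.restrict Ω) := hLw.1.sub hu2
  have mdg : MemLp (fun x => ‖gradVec w x - g x‖) 2 (volume.restrict Ω) := (hLw.2.sub hg2).norm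
  have hEV : ∫ x in V, ‖gradVec w x - g x‖ ^ 2 ≤ E :=
    setIntegral_mono_set mdg.integrable_sq (ae_of_all _ fun x => by positivity) hVΩ.eventuallyLE
  have hEV' : ∫ x in V, (w x - u x) ^ 2 ≤ E' :=
    setIntegral_mono_set mdu.integrable_sq (ae_of_all _ fun x => by positivity) hVΩ.eventuallyLE
  have s1 : ∫ x in V, ‖gradVec w x‖ ^ 2 ≤ 2 * G2 + 2 * E := by
    have := int_sq_add (μ := volume.restrict V) (hg2.norm.mono_measure hres)
      (mdg.mono_measure hres) (k := fun x => ‖gradVec w x‖) (fun x => by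
        simp only [abs_norm]
        calc ‖gradVec w x‖ = ‖g x + (gradVec w x - g x)‖ := by congr 1; abel
          _ ≤ _ := norm_add_le _ _)
    linarith
  have s2 : (∫ x in V, ‖gradVec w x‖) ^ 2 ≤ 2 * G1 ^ 2 + 2 * v * E := by
    have i1 : IntegrableOn (fun x => ‖g x‖) V :=
      (hg2.norm.mono_measure hres).integrable (by norm_num)
    have i2 : IntegrableOn (fun x => ‖gradVec w x - g x‖) V :=
      (mdg.mono_measure hres).integrable (by norm_num)
    have a1 : ∫ x in V, ‖gradVec w x‖ ≤ G1 + ∫ x in V, ‖gradVec w x - g x‖ := by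
      rw [hG1, ← integral_add i1 i2]
      refine integral_mono_of_nonneg (ae_of_all _ fun x => by positivity) (i1.add i2)
        (ae_of_all _ fun x => ?_)
      calc ‖gradVec w x‖ = ‖g x + (gradVec w x - g x)‖ := by congr 1; abel
          _ ≤ _ := norm_add_le _ _
    have a2 := cs_one (mdg.mono_measure hres)
    simp only [abs_norm] at a2
    have a3 : (∫ x in V, ‖gradVec w x - g x‖) ^ 2 ≤ v * E :=
      a2.trans (mul_le_mul_of_nonneg_left hEV hv0)
    have a0 : 0 ≤ ∫ x in V, ‖gradVec w x‖ := integral_nonneg fun x => norm_nonneg _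
    nlinarith [pow_le_pow_left₀ a0 a1 2, sq_nonneg (G1 - ∫ x in V, ‖gradVec w x - g x‖)]
  refine ⟨c, hcD, ?_, fun _ => ?_⟩
  · have hBΩ : Ω ∩ ball z (2 * r) ⊆ Ω := inter_subset_left
    have hBfin : volume (Ω ∩ ball z (2 * r)) < ⊤ :=
      (measure_mono inter_subset_right).trans_lt measure_ball_lt_top
    have : IsFiniteMeasure (volume.restrict (Ω ∩ ball z (2 * r))) := ⟨by simpa using hBfin⟩
    have hres' : volume.restrict (Ω ∩ ball z (2 * r)) ≤ volume.restrict Ω :=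
      Measure.restrict_mono hBΩ le_rfl
    have hEB : ∫ x in Ω ∩ ball z (2 * r), (w x - u x) ^ 2 ≤ E' :=
      setIntegral_mono_set mdu.integrable_sq (ae_of_all _ fun x => by positivity) hBΩ.eventuallyLE
    have := int_sq_add (μ := volume.restrict (Ω ∩ ball z (2 * r)))
      (f := fun x => w x - c) (h := fun x => w x - u x) (k := fun x => u x - c)
      ((hLw.1.mono_measure hres').sub (memLp_const c)) (mdu.mono_measure hres') (fun x => by
        rw [abs_sub_comm (w x) (u x)]
        calc |u x - c| = |(w x - c) + (u x - w x)| := by congr 1; ring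
          _ ≤ _ := abs_add_le _ _)
    calc ∫ x in Ω ∩ ball z (2 * r), (u x - c) ^ 2 ≤
        2 * (r ^ 2 * (ε / 4 * (2 * G2 + 2 * E) + C0 / r ^ d * (2 * G1 ^ 2 + 2 * v * E))) + 2 * E' := by
          refine this.trans (add_le_add (mul_le_mul_of_nonneg_left (hcP.trans ?_) (by norm_num))
            (by linarith))
          gcongr
      _ = r ^ 2 * (ε * G2 + (4 * C0) / r ^ d * G1 ^ 2) +
          ((r ^ 2 * (ε + 4 * C0 * v / r ^ d)) * E + 2 * E') := by ring
      _ ≤ _ := by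
          refine add_le_add ?_ ?_
          · gcongr
            linarith [show 0 ≤ 2 / (ub d) ^ 2 by positivity]
          · have : 0 ≤ 2 * v / (ub d ^ 2 * r ^ d) * E' := by positivity
            linarith
  · have hcv := avg_abs_le hw.1.continuous c0 hr
    have i1 : IntegrableOn (fun x => |u x|) V :=
      (hu2.abs.mono_measure hres).integrable (by norm_num)
    have i2 : IntegrableOn (fun x => |w x - u x|) V :=
      (mdu.abs.mono_measure hres).integrable (by norm_num)
    have i3 : IntegrableOn (fun x => |w x|) (ball c0 r) := (intOn_ball hw.1.continuous.abs c0 r)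
    rw [← ofReal_integral_eq_lintegral_ofReal i3 (ae_of_all _ fun x => abs_nonneg _),
      ← ENNReal.ofReal_mul (by positivity), ENNReal.ofReal_le_ofReal_iff
        (integral_nonneg fun x => abs_nonneg _)] at hcv
    have i4 : IntegrableOn (fun x => |w x|) V :=
      (hLw.1.abs.mono_measure hres).integrable (by norm_num)
    have a1 : ∫ x in ball c0 r, |w x| ≤ A + ∫ x in V, |w x - u x| := by
      refine (setIntegral_mono_set i4 (ae_of_all _ fun x => abs_nonneg _) hc0.eventuallyLE).trans ?_
      rw [hA, ← integral_add i1 i2]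
      refine integral_mono_of_nonneg (ae_of_all _ fun x => abs_nonneg _) (i1.add i2)
        (ae_of_all _ fun x => ?_)
      calc |w x| = |u x + (w x - u x)| := by congr 1; ring
          _ ≤ _ := abs_add_le _ _
    have a3 : (∫ x in V, |w x - u x|) ^ 2 ≤ v * E' :=
      (cs_one (mdu.mono_measure hres)).trans (mul_le_mul_of_nonneg_left hEV' hv0)
    have a4 : r ^ d * ub d * |c| ≤ A + ∫ x in V, |w x - u x| :=
      (mul_le_mul_of_nonneg_left hc (by positivity)).trans (hcv.trans a1)
    have a5 : (r ^ d * ub d) ^ 2 * c ^ 2 ≤ 2 * A ^ 2 + 2 * v * E' := by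
      have := pow_le_pow_left₀ (by positivity) a4 2
      rw [mul_pow, sq_abs] at this
      nlinarith [sq_nonneg (A - ∫ x in V, |w x - u x|)]
    calc r ^ d * c ^ 2 = ((r ^ d * ub d) ^ 2 * c ^ 2) / (ub d ^ 2 * r ^ d) := by field_simp
      _ ≤ (2 * A ^ 2 + 2 * v * E') / (ub d ^ 2 * r ^ d) := by gcongr
      _ = 2 / (ub d) ^ 2 / r ^ d * A ^ 2 + 2 * v / (ub d ^ 2 * r ^ d) * E' := by
        field_simp
      _ ≤ _ := by
          refine add_le_add ?_ ?_
          · gcongr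
            linarith
          · have : 0 ≤ (r ^ 2 * (ε + 4 * C0 * v / r ^ d)) * E := by positivity
            linarith

lemma grad_zero_ae {d : ℕ} {v : Euc d → ℝ} (hv : ContDiff ℝ (⊤ : ℕ∞) v) :
    ∀ᵐ x : Euc d, v x = 0 → gradVec v x = 0 := by
  rcases Nat.eq_zero_or_pos d with rfl | hd
  · exact ae_of_all _ fun x _ => by ext i; exact i.elim0
  set s : Set (Euc d) := {x | v x = 0} with hs
  have hsm : MeasurableSet s := (isClosed_eq hv.continuous continuous_const).measurableSet
  set e : Euc d := EuclideanSpace.single ⟨0, hd⟩ 1 with he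
  have hne : e ≠ 0 := by simp [he]
  have hdiff : ∀ x, HasFDerivAt v (fderiv ℝ v x) x := fun x =>
    (hv.differentiable (by simp) x).hasFDerivAt
  have key := ApproximatesLinearOn.norm_fderiv_sub_le (volume : Measure (Euc d)) (s := s)
    (f := fun x => v x • e) (A := 0) (δ := 0) (by
      intro x hx y hy
      have hx' : v x = 0 := hx
      have hy' : v y = 0 := hy
      simp [hx', hy']) hsm (fun x => (fderiv ℝ v x).smulRight e)
      (fun x _ => ((hdiff x).smul_const e).hasFDerivWithinAt)
  rw [ae_restrict_iff' hsm] at key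
  filter_upwards [key] with x hx hx0
  have h1 := hx hx0
  have h2 : fderiv ℝ v x = 0 := by
    simpa [hne] using h1
  have h3 : ∀ y, fderiv ℝ v x y = 0 := fun y => by
    rw [h2]; rfl
  unfold gradVec
  ext i; simp [h3]

lemma trunc_exists : ∃ T : ℝ → ℝ, ContDiff ℝ (⊤ : ℕ∞) T ∧ (∀ s, |s| ≤ 1 → T s = 0) ∧
    (∀ s, |T s| ≤ |s|) ∧ (∀ s, 2 < |s| → T s = s ∧ deriv T s = 1) ∧
    ∃ K : ℝ, 0 ≤ K ∧ ∀ s, |deriv T s| ≤ K := by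
  let ψ : ContDiffBump (0:ℝ) := ⟨1, 2, by norm_num, by norm_num⟩
  have hT : ContDiff ℝ (⊤ : ℕ∞) (fun s : ℝ => s * (1 - ψ s)) :=
    contDiff_id.mul (contDiff_const.sub ψ.contDiff)
  have hbig : ∀ s : ℝ, 2 < |s| → s * (1 - ψ s) = s ∧ deriv (fun s : ℝ => s * (1 - ψ s)) s = 1 := by
    intro s hs
    have h0 : ∀ t : ℝ, 2 < |t| → t * (1 - ψ t) = t := fun t ht => by
      rw [ψ.zero_of_le_dist (by simpa [Real.dist_eq] using ht.le)]; ring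
    refine ⟨h0 s hs, ?_⟩
    have : (fun s : ℝ => s * (1 - ψ s)) =ᶠ[𝓝 s] id := by
      filter_upwards [(isOpen_lt continuous_const continuous_abs).mem_nhds hs] with t ht
      exact h0 t ht
    rw [this.deriv_eq]; simp
  refine ⟨fun s => s * (1 - ψ s), hT, ?_, ?_, hbig, ?_⟩
  · intro s hs
    simp only
    rw [ψ.one_of_mem_closedBall (by simpa [Real.dist_eq] using hs)]; ring
  · intro s
    simp only
    rw [abs_mul]
    have h1 := ψ.nonneg' s
    have h2 := ψ.le_one (x := s)
    have : |1 - ψ s| ≤ 1 := abs_le.2 ⟨by linarith, by linarith⟩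
    nlinarith [abs_nonneg s]
  · have hc : Continuous (deriv fun s : ℝ => s * (1 - ψ s)) := hT.continuous_deriv (by simp)
    obtain ⟨K, hK⟩ := (isCompact_Icc (a := (-2:ℝ)) (b := 2)).exists_bound_of_continuousOn hc.continuousOn
    refine ⟨max K 1, le_max_of_le_right zero_le_one, fun s => ?_⟩
    by_cases hs : 2 < |s|
    · rw [(hbig s hs).2]; simp
    · exact (hK s (abs_le.1 (not_lt.1 hs))).trans (le_max_left _ _)

lemma gradVec_of_hasFDerivAt {d : ℕ} {v w : Euc d → ℝ} {x : Euc d} {k : ℝ}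
    (h : HasFDerivAt w (k • fderiv ℝ v x) x) : gradVec w x = k • gradVec v x := by
  unfold gradVec
  rw [h.fderiv]; ext i; simp

/-- The weak form, abstractly: `b, β ∈ L²`. -/
def WForm {d : ℕ} (b : Euc d → Euc d) (β : Euc d → ℝ) (Ω D : Set (Euc d)) : Prop :=
  ∀ ζ : Euc d → ℝ, IsTest ζ → tsupport ζ ∩ closure D = ∅ →
    ∫ x in Ω, (inner ℝ (b x) (gradVec ζ x) + β x * ζ x) = 0

lemma wform_int {d : ℕ} {b G : Euc d → Euc d} {β v : Euc d → ℝ} {Ω : Set (Euc d)}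
    (hb : MemLp b 2 (volume.restrict Ω)) (hβ : MemLp β 2 (volume.restrict Ω))
    (hG : MemLp G 2 (volume.restrict Ω)) (hv : MemLp v 2 (volume.restrict Ω)) :
    IntegrableOn (fun x => inner ℝ (b x) (G x) + β x * v x) Ω := by
  refine Integrable.add ?_ (hβ.integrable_mul hv)
  refine (hb.norm.integrable_mul hG.norm).mono' (hb.1.inner hG.1) (ae_of_all _ fun x => ?_)
  simpa using abs_real_inner_le_norm (b x) (G x)

lemma wform_ext {d : ℕ} {b : Euc d → Euc d} {β : Euc d → ℝ} {Ω D : Set (Euc d)}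
    (hb : MemLp b 2 (volume.restrict Ω)) (hβ : MemLp β 2 (volume.restrict Ω))
    (hW : WForm b β Ω D) {v : Euc d → ℝ} (hv : IsTest v) (hvD : ∀ q ∈ D, v q = 0) :
    ∫ x in Ω, (inner ℝ (b x) (gradVec v x) + β x * v x) = 0 := by
  obtain ⟨T, hT, hT0, hTle, hTbig, K, hK0, hK⟩ := trunc_exists
  have hvcl : ∀ q ∈ closure D, v q = 0 := fun q hq => by
    have : closure D ⊆ {x | v x = 0} :=
      closure_minimal hvD (isClosed_eq hv.1.continuous continuous_const)
    exact this hq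
  set ζ : ℕ → Euc d → ℝ := fun n x => ((n:ℝ)+1)⁻¹ * T (((n:ℝ)+1) * v x) with hζ
  have hn : ∀ n : ℕ, (0:ℝ) < (n:ℝ) + 1 := fun n => by positivity
  have hζT : ∀ n, IsTest (ζ n) := fun n => by
    refine ⟨contDiff_const.mul (hT.comp (contDiff_const.mul hv.1)), ?_⟩
    refine hv.2.mono' ((Function.support_subset_iff'.2 fun x hx => ?_))
    have : v x = 0 := by
      by_contra h; exact hx (subset_closure h)
    simp [hζ, this, hT0 0 (by simp)]
  have hζD : ∀ n, tsupport (ζ n) ∩ closure D = ∅ := fun n => by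
    refine eq_empty_iff_forall_notMem.2 fun x ⟨hx1, hx2⟩ => ?_
    refine (notMem_tsupport_iff_eventuallyEq.2 ?_) hx1
    have ho : IsOpen {y | |((n:ℝ)+1) * v y| < 1} :=
      isOpen_lt (by have := hv.1.continuous; fun_prop) continuous_const
    filter_upwards [ho.mem_nhds (by simp [hvcl x hx2] : x ∈ {y | |((n:ℝ)+1) * v y| < 1})] with y hy
    simp only [hζ, Pi.zero_apply]
    rw [hT0 _ (le_of_lt hy), mul_zero]
  have hgr : ∀ n x, gradVec (ζ n) x = deriv T (((n:ℝ)+1) * v x) • gradVec v x := fun n x => by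
    apply gradVec_of_hasFDerivAt
    have h1 : HasFDerivAt v (fderiv ℝ v x) x := (hv.1.differentiable (by simp) x).hasFDerivAt
    have h2 : HasDerivAt T (deriv T (((n:ℝ)+1) * v x)) (((n:ℝ)+1) * v x) :=
      (hT.differentiable (by simp) _).hasDerivAt
    have h3 := (h2.comp_hasFDerivAt x (h1.const_mul ((n:ℝ)+1))).const_mul ((n:ℝ)+1)⁻¹
    have h4 : ((n:ℝ)+1)⁻¹ • deriv T (((n:ℝ)+1) * v x) • ((n:ℝ)+1) • fderiv ℝ v x =
        deriv T (((n:ℝ)+1) * v x) • fderiv ℝ v x := by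
      rw [smul_smul, smul_smul]
      congr 1
      have := (hn n).ne'
      field_simp
    rw [h4] at h3
    exact h3
  have hle : ∀ n x, |ζ n x| ≤ |v x| := fun n x => by
    have h1 := hTle (((n:ℝ)+1) * v x)
    simp only [hζ]
    rw [abs_mul, abs_of_pos (inv_pos.2 (hn n)), inv_mul_le_iff₀ (hn n)]
    rwa [abs_mul, abs_of_pos (hn n)] at h1
  have hLv := test_memLp hv 2 Ω
  have hlim : Tendsto (fun n => ∫ x in Ω, (inner ℝ (b x) (gradVec (ζ n) x) + β x * ζ n x)) atTop
      (𝓝 (∫ x in Ω, (inner ℝ (b x) (gradVec v x) + β x * v x))) := by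
    refine tendsto_integral_of_dominated_convergence
      (fun x => K * (‖b x‖ * ‖gradVec v x‖) + |β x| * |v x|) ?_ ?_ ?_ ?_
    · intro n
      have := test_memLp (hζT n) 2 Ω
      exact (wform_int hb hβ this.2 this.1).1
    · exact ((hb.norm.integrable_mul hLv.2.norm).const_mul K).add
        (hβ.abs.integrable_mul hLv.1.abs)
    · intro n
      refine ae_of_all _ fun x => ?_
      refine (norm_add_le _ _).trans (add_le_add ?_ ?_)
      · rw [hgr, inner_smul_right, norm_mul]
        exact mul_le_mul (hK _) (by simpa using abs_real_inner_le_norm _ _) (norm_nonneg _) hK0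
      · rw [norm_mul]
        exact mul_le_mul_of_nonneg_left (hle n x) (norm_nonneg _)
    · refine ae_restrict_of_ae ?_
      filter_upwards [grad_zero_ae hv.1] with x hx
      by_cases h0 : v x = 0
      · have e1 : ∀ n, gradVec (ζ n) x = 0 := fun n => by rw [hgr, hx h0, smul_zero]
        have e2 : ∀ n, ζ n x = 0 := fun n => by
          have := hle n x; rw [h0, abs_zero] at this; exact abs_nonpos_iff.1 this
        simp only [e1, e2, hx h0, h0]
        exact tendsto_const_nhds
      · refine tendsto_const_nhds.congr' ?_
        have hev : ∀ᶠ n : ℕ in atTop, 2 < |((n:ℝ)+1) * v x| := by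
          obtain ⟨n0, hn0⟩ := exists_nat_gt (2 / |v x|)
          filter_upwards [eventually_ge_atTop n0] with n hnn
          have hp := abs_pos.2 h0
          rw [abs_mul, abs_of_pos (hn n)]
          rw [div_lt_iff₀ hp] at hn0
          have : (n0:ℝ) ≤ n := by exact_mod_cast hnn
          nlinarith
        filter_upwards [hev] with n hnn
        have := hTbig _ hnn
        rw [hgr, this.2, one_smul]
        simp only [hζ]
        rw [this.1, inv_mul_cancel_left₀ (hn n).ne']
  have h0 : (fun n => ∫ x in Ω, (inner ℝ (b x) (gradVec (ζ n) x) + β x * ζ n x)) = fun _ => 0 :=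
    funext fun n => hW (ζ n) (hζT n) (hζD n)
  rw [h0] at hlim
  exact tendsto_nhds_unique hlim tendsto_const_nhds |>.symm ▸ rfl

lemma gradVec_prod {d : ℕ} {η w : Euc d → ℝ} (hη : ContDiff ℝ (⊤ : ℕ∞) η)
    (hw : ContDiff ℝ (⊤ : ℕ∞) w) (c : ℝ) (x : Euc d) :
    gradVec (fun y => η y ^ 2 * (w y - c)) x =
      η x ^ 2 • gradVec w x + (2 * η x * (w x - c)) • gradVec η x := by
  have h1 : HasFDerivAt η (fderiv ℝ η x) x := (hη.differentiable (by simp) x).hasFDerivAt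
  have h2 : HasFDerivAt w (fderiv ℝ w x) x := (hw.differentiable (by simp) x).hasFDerivAt
  have h3 := (h1.pow 2).mul (h2.sub_const c)
  unfold gradVec
  have h4 := h3.fderiv
  have h5 : fderiv ℝ (fun y => η y ^ 2 * (w y - c)) x = _ := h4
  rw [h5]
  ext i
  simp
  ring

lemma cutoff_exists (d : ℕ) : ∃ L > (0:ℝ), ∀ (z : Euc d) (r : ℝ), 0 < r → ∃ η : Euc d → ℝ,
    IsTest η ∧ (∀ x, 0 ≤ η x ∧ η x ≤ 1) ∧ (∀ x ∈ ball z r, η x = 1) ∧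
    (∀ x, x ∉ ball z (2 * r) → η x = 0) ∧ ∀ x, ‖gradVec η x‖ ≤ L / r := by
  let φ : ContDiffBump (0 : Euc d) := ⟨1, 2, by norm_num, by norm_num⟩
  have hφ : IsTest φ := ⟨φ.contDiff, φ.hasCompactSupport⟩
  have hg := test_grad_cont hφ
  obtain ⟨L, hL⟩ := hg.2.exists_bound_of_continuous hg.1
  refine ⟨max L 1, lt_max_of_lt_right one_pos, fun z r hr => ?_⟩
  have hrn : ‖r⁻¹‖ = r⁻¹ := by rw [Real.norm_eq_abs, abs_of_pos (inv_pos.2 hr)]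
  have hd0 : ∀ x : Euc d, dist (r⁻¹ • (x - z)) 0 = r⁻¹ * dist x z := fun x => by
    rw [dist_zero_right, norm_smul, hrn, dist_eq_norm]
  have hcd : ContDiff ℝ (⊤ : ℕ∞) (fun x : Euc d => φ (r⁻¹ • (x - z))) :=
    φ.contDiff.comp ((contDiff_id.sub contDiff_const).const_smul r⁻¹)
  have hz : ∀ x, x ∉ ball z (2 * r) → φ (r⁻¹ • (x - z)) = 0 := fun x hx => by
    refine φ.zero_of_le_dist ?_
    rw [hd0]
    rw [mem_ball, not_lt] at hx
    rw [← div_eq_inv_mul, le_div_iff₀ hr]; exact hx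
  refine ⟨fun x => φ (r⁻¹ • (x - z)), ⟨hcd, ?_⟩, fun x => ⟨φ.nonneg' _, φ.le_one⟩, ?_, hz, ?_⟩
  · refine HasCompactSupport.intro (isCompact_closedBall z (2 * r)) fun x hx => hz x fun h =>
      hx (ball_subset_closedBall h)
  · intro x hx
    refine φ.one_of_mem_closedBall ?_
    rw [mem_closedBall, hd0, ← div_eq_inv_mul, div_le_iff₀ hr, one_mul]
    exact le_of_lt hx
  · intro x
    have h1 : HasFDerivAt φ (fderiv ℝ φ (r⁻¹ • (x - z))) (r⁻¹ • (x - z)) :=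
      (φ.contDiff (n := 1).differentiable (by simp) _).hasFDerivAt
    have h2 : HasFDerivAt (fun x : Euc d => r⁻¹ • (x - z)) (r⁻¹ • ContinuousLinearMap.id ℝ (Euc d)) x :=
      ((hasFDerivAt_id (𝕜 := ℝ) x).sub_const z).const_smul r⁻¹
    have h3 := (h1.comp x h2).fderiv
    have h5 : fderiv ℝ (fun x : Euc d => φ (r⁻¹ • (x - z))) x = _ := h3
    have h6 : gradVec (fun x : Euc d => φ (r⁻¹ • (x - z))) x =
        r⁻¹ • gradVec φ (r⁻¹ • (x - z)) := by
      unfold gradVec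
      rw [h5]; ext i; simp
    rw [h6, norm_smul, hrn, div_eq_inv_mul]
    exact mul_le_mul_of_nonneg_left ((hL _).trans (le_max_left _ _)) (inv_pos.2 hr).le

lemma le_zero_of_lim {I B B' : ℝ} {e e' : ℕ → ℝ} (he : Tendsto e atTop (𝓝 0))
    (he' : Tendsto e' atTop (𝓝 0)) (h : ∀ n, ∃ X Y : ℝ, |I| ≤ X + Y ∧ X ^ 2 ≤ B * e n ∧
      Y ^ 2 ≤ B' * e' n) : I = 0 := by
  have h1 : Tendsto (fun n => 2 * (B * e n) + 2 * (B' * e' n)) atTop (𝓝 0) := by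
    simpa using ((he.const_mul B).const_mul 2).add ((he'.const_mul B').const_mul 2)
  have h2 : I ^ 2 ≤ 0 := ge_of_tendsto' h1 fun n => by
    obtain ⟨X, Y, a, b, c⟩ := h n
    have := pow_le_pow_left₀ (abs_nonneg I) a 2
    rw [sq_abs] at this
    nlinarith [sq_nonneg (X - Y)]
  nlinarith [sq_nonneg I]

set_option maxHeartbeats 1000000 in
lemma wform_test {d : ℕ} {b g : Euc d → Euc d} {β u : Euc d → ℝ} {Ω D : Set (Euc d)}
    (hb : MemLp b 2 (volume.restrict Ω)) (hβ : MemLp β 2 (volume.restrict Ω))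
    (hW : WForm b β Ω D) (hu : MemW1pD u g D Ω 2)
    {η : Euc d → ℝ} (hη : IsTest η) (hη1 : ∀ x, 0 ≤ η x ∧ η x ≤ 1) {L c : ℝ}
    (hL : ∀ x, ‖gradVec η x‖ ≤ L) (hc : ∀ q ∈ D, c = 0 ∨ η q = 0) :
    IntegrableOn (fun x => inner ℝ (b x)
      (η x ^ 2 • g x + (2 * η x * (u x - c)) • gradVec η x) + β x * (η x ^ 2 * (u x - c))) Ω ∧
    ∫ x in Ω, (inner ℝ (b x)
      (η x ^ 2 • g x + (2 * η x * (u x - c)) • gradVec η x) + β x * (η x ^ 2 * (u x - c))) = 0 := by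
  obtain ⟨hu2, hg2, -, un, hun, hT1, hT2⟩ := hu
  have h2 : ENNReal.ofReal 2 = 2 := by simp
  rw [h2] at hu2 hg2
  simp only [Real.rpow_two, sq_abs] at hT1 hT2
  have hL0 : 0 ≤ L := (norm_nonneg _).trans (hL 0)
  have hηc := hη.1.continuous
  have hgη := continuous_gradVec hη.1
  set vn : ℕ → Euc d → ℝ := fun n y => η y ^ 2 * (un n y - c) with hvn
  have hvT : ∀ n, IsTest (vn n) := fun n => by
    refine ⟨(hη.1.pow 2).mul ((hun n).1.1.sub contDiff_const), ?_⟩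
    refine hη.2.mono' (Function.support_subset_iff'.2 fun x hx => ?_)
    have : η x = 0 := by
      by_contra h; exact hx (subset_closure h)
    simp [hvn, this]
  have hvD : ∀ n, ∀ q ∈ D, vn n q = 0 := fun n q hq => by
    have hq0 : un n q = 0 := by
      by_contra hne
      have : q ∈ Function.support (un n) ∩ D := ⟨hne, hq⟩
      rw [(hun n).2] at this; exact this
    rcases hc q hq with h | h
    · simp [hvn, h, hq0]
    · simp [hvn, h]
  have hz := fun n => wform_ext hb hβ hW (hvT n) (hvD n)
  -- difference function
  have hLn := fun n => test_memLp (hun n).1 2 Ω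
  have mdu : ∀ n, MemLp (fun x => un n x - u x) 2 (volume.restrict Ω) := fun n => (hLn n).1.sub hu2
  have mdg : ∀ n, MemLp (fun x => gradVec (un n) x - g x) 2 (volume.restrict Ω) :=
    fun n => (hLn n).2.sub hg2
  set DG : ℕ → Euc d → Euc d := fun n x => η x ^ 2 • (gradVec (un n) x - g x) +
    (2 * η x * (un n x - u x)) • gradVec η x with hDG
  set DV : ℕ → Euc d → ℝ := fun n x => η x ^ 2 * (un n x - u x) with hDV
  have hηsq : ∀ x, |η x ^ 2| ≤ 1 := fun x => by
    rw [abs_of_nonneg (by positivity)]; exact pow_le_one₀ (hη1 x).1 (hη1 x).2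
  have hDGb : ∀ n x, ‖DG n x‖ ≤ ‖gradVec (un n) x - g x‖ + 2 * L * |un n x - u x| := fun n x => by
    refine (norm_add_le _ _).trans (add_le_add ?_ ?_)
    · rw [norm_smul]
      exact mul_le_of_le_one_left (norm_nonneg _) (hηsq x)
    · rw [norm_smul, norm_mul, norm_mul, Real.norm_eq_abs, Real.norm_eq_abs, Real.norm_eq_abs,
        abs_of_nonneg (hη1 x).1, abs_two]
      have h3 : η x * ‖gradVec η x‖ ≤ 1 * L :=
        mul_le_mul (hη1 x).2 (hL x) (norm_nonneg _) zero_le_one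
      calc 2 * η x * |un n x - u x| * ‖gradVec η x‖ = 2 * |un n x - u x| * (η x * ‖gradVec η x‖) := by ring
        _ ≤ 2 * |un n x - u x| * (1 * L) := by gcongr
        _ = _ := by ring
  have hDVb : ∀ n x, |DV n x| ≤ |un n x - u x| := fun n x => by
    rw [hDV]; simp only; rw [abs_mul]
    exact mul_le_of_le_one_left (abs_nonneg _) (hηsq x)
  have mDG : ∀ n, MemLp (DG n) 2 (volume.restrict Ω) := fun n => by
    refine ((mdg n).norm.add ((mdu n).abs.const_mul (2 * L))).mono' ?_ (ae_of_all _ (hDGb n))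
    exact ((hηc.pow 2).aestronglyMeasurable.smul (mdg n).1).add
      (((hηc.const_mul 2).aestronglyMeasurable.mul (mdu n).1).smul hgη.aestronglyMeasurable)
  have mDV : ∀ n, MemLp (DV n) 2 (volume.restrict Ω) := fun n => by
    refine (mdu n).abs.mono' ?_ (ae_of_all _ (hDVb n))
    exact (hηc.pow 2).aestronglyMeasurable.mul (mdu n).1
  have hid : ∀ n x, inner ℝ (b x)
      (η x ^ 2 • g x + (2 * η x * (u x - c)) • gradVec η x) + β x * (η x ^ 2 * (u x - c)) =
      (inner ℝ (b x) (gradVec (vn n) x) + β x * vn n x) -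
        (inner ℝ (b x) (DG n x) + β x * DV n x) := fun n x => by
    have e1 : gradVec (vn n) x = η x ^ 2 • gradVec (un n) x +
        (2 * η x * (un n x - c)) • gradVec η x := gradVec_prod hη.1 (hun n).1.1 c x
    rw [e1]
    simp only [hvn, hDV, hDG, inner_add_right, inner_smul_right, inner_sub_right]
    ring
  have i1 := fun n => wform_int hb hβ (test_memLp (hvT n) 2 Ω).2 (test_memLp (hvT n) 2 Ω).1
  have i2 := fun n => wform_int hb hβ (mDG n) (mDV n)
  have hfun : ∀ n, (fun x => inner ℝ (b x)
      (η x ^ 2 • g x + (2 * η x * (u x - c)) • gradVec η x) + β x * (η x ^ 2 * (u x - c))) =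
      fun x => (inner ℝ (b x) (gradVec (vn n) x) + β x * vn n x) -
        (inner ℝ (b x) (DG n x) + β x * DV n x) := fun n => funext (hid n)
  refine ⟨by rw [hfun 0]; exact (i1 0).sub (i2 0), ?_⟩
  have hI : ∀ n, ∫ x in Ω, (inner ℝ (b x)
      (η x ^ 2 • g x + (2 * η x * (u x - c)) • gradVec η x) + β x * (η x ^ 2 * (u x - c))) =
      - ∫ x in Ω, (inner ℝ (b x) (DG n x) + β x * DV n x) := fun n => by
    rw [hfun n, integral_sub (i1 n) (i2 n), hz n, zero_sub]
  set mb : Euc d → ℝ := fun x => 2 * L * ‖b x‖ + |β x| with hmb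
  have mmb : MemLp mb 2 (volume.restrict Ω) := (hb.norm.const_mul (2 * L)).add hβ.abs
  refine le_zero_of_lim (B := ∫ x in Ω, ‖b x‖ ^ 2) (B' := ∫ x in Ω, mb x ^ 2) hT2 hT1 fun n => ?_
  refine ⟨∫ x in Ω, |‖b x‖| * |‖gradVec (un n) x - g x‖|, ∫ x in Ω, |mb x| * |un n x - u x|,
    ?_, cs_int hb.norm (mdg n).norm, cs_int mmb (mdu n)⟩
  have j1 : IntegrableOn (fun x => |‖b x‖| * |‖gradVec (un n) x - g x‖|) Ω :=
    hb.norm.abs.integrable_mul (mdg n).norm.abs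
  have j2 : IntegrableOn (fun x => |mb x| * |un n x - u x|) Ω :=
    mmb.abs.integrable_mul (mdu n).abs
  rw [hI n, abs_neg, ← integral_add j1 j2, ← Real.norm_eq_abs]
  refine norm_integral_le_of_norm_le (j1.add j2) (ae_of_all _ fun x => ?_)
  have hmb0 : 0 ≤ mb x := by positivity
  rw [abs_norm, abs_norm, abs_of_nonneg hmb0, hmb]
  have k1 : ‖(inner ℝ (b x) (DG n x) : ℝ)‖ ≤ ‖b x‖ * ‖DG n x‖ := by
    simpa using abs_real_inner_le_norm (b x) (DG n x)
  have k2 := mul_le_mul_of_nonneg_left (hDGb n x) (norm_nonneg (b x))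
  have k3 := mul_le_mul_of_nonneg_left (hDVb n x) (abs_nonneg (β x))
  refine (norm_add_le _ _).trans ?_
  rw [norm_mul, Real.norm_eq_abs (β x), Real.norm_eq_abs (DV n x)]
  simp only
  nlinarith

/-- The vector with given coordinates. -/
def mkV {d : ℕ} (h : Fin d → Euc d → ℝ) (x : Euc d) : Euc d := WithLp.toLp 2 (fun i => h i x)

lemma norm_le_sum {d : ℕ} (y : Euc d) : ‖y‖ ≤ ∑ i, |y i| := by
  have hv : y = ∑ i, y i • EuclideanSpace.single i (1:ℝ) := by
    ext j
    simp [Finset.sum_apply, Pi.single_apply]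
  conv_lhs => rw [hv]
  refine (norm_sum_le _ _).trans (Finset.sum_le_sum fun i _ => ?_)
  rw [norm_smul]; simp

lemma mkV_meas {d : ℕ} {h : Fin d → Euc d → ℝ} {μ : Measure (Euc d)}
    (hh : ∀ i, AEStronglyMeasurable (h i) μ) : AEStronglyMeasurable (mkV h) μ := by
  have h1 : AEMeasurable (fun x => fun i => h i x) μ :=
    aemeasurable_pi_iff.2 fun i => (hh i).aemeasurable
  exact (PiLp.continuous_toLp 2 (fun _ : Fin d => ℝ)).comp_aestronglyMeasurable h1.aestronglyMeasurable

lemma mkV_memLp {d : ℕ} {h : Fin d → Euc d → ℝ} {μ : Measure (Euc d)}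
    (hh : ∀ i, MemLp (h i) 2 μ) : MemLp (mkV h) 2 μ := by
  have : MemLp (fun x => ∑ i, |h i x|) 2 μ := memLp_finsetSum _ fun i _ => (hh i).abs
  exact this.mono' (mkV_meas fun i => (hh i).1) (ae_of_all _ fun x => norm_le_sum _)

lemma ell_bound {d : ℕ} {a : Fin d → Fin d → Euc d → ℝ} {Λ : ℝ} (hΛ : 0 < Λ)
    (ha : EllipticSym a Λ) (i j : Fin d) (x : Euc d) : |a i j x| ≤ Λ⁻¹ := by
  have hinv : 0 < Λ⁻¹ := inv_pos.2 hΛ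
  have hii : ∀ i, 0 ≤ a i i x ∧ a i i x ≤ Λ⁻¹ := fun i => by
    have := ha.2.2 x (Pi.single i 1)
    simp [Pi.single_apply] at this
    exact ⟨hΛ.le.trans this.1, this.2⟩
  by_cases hij : i = j
  · subst hij
    rw [abs_of_nonneg (hii i).1]; exact (hii i).2
  · have h1 := ha.2.2 x (fun k => (Pi.single i 1 : Fin d → ℝ) k + (Pi.single j 1 : Fin d → ℝ) k)
    simp only [mul_add, Finset.sum_add_distrib, add_sq] at h1
    simp [Pi.single_apply, hij, Ne.symm hij, Finset.sum_add_distrib, add_mul] at h1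
    have hs := ha.2.1 i j x
    have := hii i
    have := hii j
    rw [abs_le]
    constructor <;> nlinarith [h1.1, h1.2]

lemma A_norm {d : ℕ} {a : Fin d → Fin d → Euc d → ℝ} {Λ : ℝ} (hΛ : 0 < Λ)
    (ha : EllipticSym a Λ) (g : Euc d → Euc d) (x : Euc d) :
    ‖mkV (fun i x => ∑ j, a i j x * g x j) x‖ ≤ (d ^ 2 * Λ⁻¹) * ‖g x‖ := by
  refine (norm_le_sum _).trans ?_
  have : ∀ i, |(mkV (fun i x => ∑ j, a i j x * g x j) x) i| ≤ d * (Λ⁻¹ * ‖g x‖) := fun i => by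
    change |∑ j, a i j x * g x j| ≤ _
    refine (Finset.abs_sum_le_sum_abs _ _).trans ?_
    have hj : ∀ j ∈ Finset.univ, |a i j x * g x j| ≤ Λ⁻¹ * ‖g x‖ := fun j _ => by
      rw [abs_mul]
      exact mul_le_mul (ell_bound hΛ ha i j x) (by simpa using PiLp.norm_apply_le (g x) j)
        (abs_nonneg _) (inv_pos.2 hΛ).le
    exact (Finset.sum_le_sum hj).trans (by simp)
  refine (Finset.sum_le_sum fun i _ => this i).trans ?_
  simp
  apply le_of_eq; ring

lemma A_coer {d : ℕ} {a : Fin d → Fin d → Euc d → ℝ} {Λ : ℝ}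
    (ha : EllipticSym a Λ) (g : Euc d → Euc d) (x : Euc d) :
    Λ * ‖g x‖ ^ 2 ≤ inner ℝ (mkV (fun i x => ∑ j, a i j x * g x j) x) (g x) := by
  have := (ha.2.2 x (fun i => g x i)).1
  rw [EuclideanSpace.norm_sq_eq]
  simp only [Real.norm_eq_abs, sq_abs]
  refine this.trans (le_of_eq ?_)
  simp only [mkV, PiLp.inner_apply, RCLike.inner_apply, conj_trivial, Finset.sum_mul]
  refine Finset.sum_congr rfl fun i _ => ?_
  simp [Finset.mul_sum]
  try exact Finset.sum_congr rfl fun j _ => by ring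

lemma A_memLp {d : ℕ} {a : Fin d → Fin d → Euc d → ℝ} {Λ : ℝ} (hΛ : 0 < Λ)
    (ha : EllipticSym a Λ) {g : Euc d → Euc d} {μ : Measure (Euc d)} (hg : MemLp g 2 μ) :
    MemLp (mkV (fun i x => ∑ j, a i j x * g x j)) 2 μ := by
  refine (hg.norm.const_mul (d ^ 2 * Λ⁻¹)).mono' (mkV_meas fun i => ?_)
    (ae_of_all _ (A_norm hΛ ha g))
  refine Finset.aestronglyMeasurable_fun_sum _ fun j _ => (ha.1 i j).aestronglyMeasurable.mul ?_
  exact (EuclideanSpace.proj (𝕜 := ℝ) j).continuous.comp_aestronglyMeasurable hg.1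

lemma wform_of_weak {d : ℕ} {a : Fin d → Fin d → Euc d → ℝ} {Λ lam : ℝ} (hΛ : 0 < Λ)
    (ha : EllipticSym a Λ) {u f : Euc d → ℝ} {g : Euc d → Euc d} {fv : Fin d → Euc d → ℝ}
    {Ω D : Set (Euc d)} (hu : MemLp u 2 (volume.restrict Ω)) (hg : MemLp g 2 (volume.restrict Ω))
    (hf : MemLp f 2 (volume.restrict Ω)) (hfv : ∀ i, MemLp (fv i) 2 (volume.restrict Ω))
    (hw : WeakSolMixed a lam u g f fv Ω D) :
    WForm (fun x => mkV (fun i x => ∑ j, a i j x * g x j) x - mkV fv x)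
      (fun x => lam * u x + f x) Ω D := by
  intro ζ hζ hζD
  have h := hw ζ hζ hζD
  have hL := test_memLp hζ 2 Ω
  have mA := A_memLp hΛ ha hg
  have mF := mkV_memLp hfv
  have i1 := wform_int mA (hu.const_mul lam) hL.2 hL.1
  have i2 : IntegrableOn (fun x => f x * ζ x) Ω := hf.integrable_mul hL.1
  have i3 : IntegrableOn (fun x => inner ℝ (mkV fv x) (gradVec ζ x) + 0) Ω := by
    simpa using wform_int mF (MemLp.zero (ε := ℝ)) hL.2 hL.1
  have e1 : ∀ x, -(∑ i, ∑ j, a i j x * g x j * pder i ζ x) - lam * u x * ζ x =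
      - (inner ℝ (mkV (fun i x => ∑ j, a i j x * g x j) x) (gradVec ζ x) + lam * u x * ζ x) := by
    intro x
    simp only [mkV, gradVec, pder, PiLp.inner_apply, RCLike.inner_apply, conj_trivial,
      Finset.mul_sum]
    rw [neg_add', sub_left_inj, neg_inj]
    exact Finset.sum_congr rfl fun i _ => Finset.sum_congr rfl fun j _ => by ring
  have e2 : ∀ x, ∑ i, fv i x * pder i ζ x = inner ℝ (mkV fv x) (gradVec ζ x) + 0 := by
    intro x
    simp only [mkV, gradVec, pder, PiLp.inner_apply, RCLike.inner_apply, conj_trivial, add_zero]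
    exact Finset.sum_congr rfl fun i _ => by ring
  simp only [e1, e2] at h
  rw [integral_neg] at h
  have e3 : ∀ x, inner ℝ (mkV (fun i x => ∑ j, a i j x * g x j) x - mkV fv x) (gradVec ζ x) +
      (lam * u x + f x) * ζ x =
      (inner ℝ (mkV (fun i x => ∑ j, a i j x * g x j) x) (gradVec ζ x) + lam * u x * ζ x) +
      f x * ζ x - (inner ℝ (mkV fv x) (gradVec ζ x) + 0) := by
    intro x; rw [inner_sub_left]; ring
  simp only [e3]
  have e4 := integral_sub (i1.add i2) i3
  have e5 := integral_add i1 i2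
  simp only [Pi.add_apply] at e4
  rw [e4, e5]
  linarith

lemma cacc_pt5 {s u c F h fx : ℝ} (hF : 0 ≤ F) (hs : 0 ≤ s) (hf : |fx| ≤ s * F) :
    h ^ 2 * (s ^ 2 / 4 * u ^ 2) - 2 * (h ^ 2 * F ^ 2) - h ^ 2 * (s ^ 2 * c ^ 2) ≤
      (s ^ 2 * u + fx) * (h ^ 2 * (u - c)) := by
  have b1 : |fx * u| ≤ s * F * |u| := by rw [abs_mul]; gcongr
  have b2 : |fx * c| ≤ s * F * |c| := by rw [abs_mul]; gcongr
  have c1 := (abs_le.1 b1).1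
  have c2 := (abs_le.1 b2).2
  have e : ∀ y : ℝ, s * F * |y| ≤ F ^ 2 + s ^ 2 / 4 * y ^ 2 := fun y => by
    have h1 := sq_nonneg (s * |y| / 2 - F)
    have h2 : (s * |y| / 2 - F) ^ 2 = s ^ 2 / 4 * y ^ 2 - s * F * |y| + F ^ 2 := by
      rw [← sq_abs y]; ring
    linarith
  have c3 := e u
  have c4 := e c
  have c5 := sq_nonneg (s * u - s * c)
  have c7 := sq_nonneg (s * c)
  have c6 : 0 ≤ (s ^ 2 * u + fx) * (u - c) - (s ^ 2 / 4 * u ^ 2 - 2 * F ^ 2 - s ^ 2 * c ^ 2) := by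
    linarith
  have := mul_nonneg (sq_nonneg h) c6
  linarith

lemma cacc_pt {Λ κ s u c E F t h q1 q2 q3 q4 fx : ℝ} (hΛ : 0 < Λ) (hκ : 0 ≤ κ)
    (hE : 0 ≤ E) (hF : 0 ≤ F) (ht : 0 ≤ t) (hh : 0 ≤ h)
    (h1 : Λ * E ^ 2 ≤ q1) (h2 : |q2| ≤ κ * E * t) (h3 : |q3| ≤ F * E) (h4 : |q4| ≤ F * t)
    (hs : 0 ≤ s) (hf : |fx| ≤ s * F) :
    h ^ 2 * (Λ / 2 * E ^ 2 + s ^ 2 / 4 * u ^ 2) - (4 * κ ^ 2 / Λ + 1 / Λ + 4) *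
      ((u - c) ^ 2 * t ^ 2 + h ^ 2 * F ^ 2 + h ^ 2 * (s ^ 2 * c ^ 2)) ≤
    h ^ 2 * q1 + 2 * h * (u - c) * q2 - h ^ 2 * q3 - 2 * h * (u - c) * q4 +
      (s ^ 2 * u + fx) * (h ^ 2 * (u - c)) := by
  set w := u - c with hw
  have a1 : Λ * (h ^ 2 * E ^ 2) ≤ h ^ 2 * q1 := by nlinarith [sq_nonneg h]
  have a2 : -(Λ / 4 * (h ^ 2 * E ^ 2)) - 4 * κ ^ 2 / Λ * (w ^ 2 * t ^ 2) ≤ 2 * h * w * q2 := by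
    have b1 : |2 * h * w * q2| ≤ 2 * h * |w| * (κ * E * t) := by
      rw [abs_mul, abs_mul, abs_of_nonneg (by positivity : 0 ≤ 2 * h)]
      gcongr
    have b2 : 2 * (h * E) * (κ * |w| * t) ≤ Λ / 4 * (h * E) ^ 2 + 4 / Λ * (κ * |w| * t) ^ 2 := by
      have : 0 ≤ (1 / Λ) * (Λ / 2 * (h * E) - 2 * (κ * |w| * t)) ^ 2 := by positivity
      have e : (1 / Λ) * (Λ / 2 * (h * E) - 2 * (κ * |w| * t)) ^ 2 =
        Λ / 4 * (h * E) ^ 2 + 4 / Λ * (κ * |w| * t) ^ 2 - 2 * (h * E) * (κ * |w| * t) := by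
        field_simp; ring
      linarith
    have b3 : 4 / Λ * (κ * |w| * t) ^ 2 = 4 * κ ^ 2 / Λ * (w ^ 2 * t ^ 2) := by
      rw [mul_pow, mul_pow, sq_abs]; ring
    have := (abs_le.1 b1).1
    nlinarith
  have a3 : -(Λ / 4 * (h ^ 2 * E ^ 2)) - 1 / Λ * (h ^ 2 * F ^ 2) ≤ - (h ^ 2 * q3) := by
    have b2 : F * E ≤ Λ / 4 * E ^ 2 + 1 / Λ * F ^ 2 := by
      have : 0 ≤ (1 / Λ) * (Λ / 2 * E - F) ^ 2 := by positivity
      have e : (1 / Λ) * (Λ / 2 * E - F) ^ 2 = Λ / 4 * E ^ 2 + 1 / Λ * F ^ 2 - F * E := by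
        field_simp; ring
      linarith
    have := (abs_le.1 h3).2
    nlinarith [mul_le_mul_of_nonneg_left (this.trans b2) (sq_nonneg h)]
  have a4 : -(h ^ 2 * F ^ 2) - w ^ 2 * t ^ 2 ≤ - (2 * h * w * q4) := by
    have b1 : |2 * h * w * q4| ≤ 2 * h * |w| * (F * t) := by
      rw [abs_mul, abs_mul, abs_of_nonneg (by positivity : 0 ≤ 2 * h)]
      gcongr
    have := (abs_le.1 b1).2
    nlinarith [sq_nonneg (h * F - |w| * t), sq_abs w]
  have a5 : h ^ 2 * (s ^ 2 / 4 * u ^ 2) - 2 * (h ^ 2 * F ^ 2) - h ^ 2 * (s ^ 2 * c ^ 2) ≤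
      (s ^ 2 * u + fx) * (h ^ 2 * w) := cacc_pt5 hF hs hf
  have p1 : 0 ≤ w ^ 2 * t ^ 2 := by positivity
  have p2 : 0 ≤ h ^ 2 * F ^ 2 := by positivity
  have p3 : 0 ≤ h ^ 2 * (s ^ 2 * c ^ 2) := by positivity
  have p4 : 0 ≤ 4 * κ ^ 2 / Λ := by positivity
  have p5 : 0 ≤ 1 / Λ := by positivity
  have k1 := mul_nonneg p4 p2
  have k2 := mul_nonneg p4 p3
  have k3 := mul_nonneg p5 p1
  have k4 := mul_nonneg p5 p3
  linarith

set_option maxHeartbeats 1000000 in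
lemma cacc (d : ℕ) {Λ : ℝ} (hΛ : 0 < Λ) (hΛ1 : Λ ≤ 1) : ∃ C > (0:ℝ),
    ∀ (Ω D : Set (Euc d)) (a : Fin d → Fin d → Euc d → ℝ) (lam : ℝ) (u f : Euc d → ℝ)
    (g : Euc d → Euc d) (fv : Fin d → Euc d → ℝ) (F : Euc d → ℝ), IsOpen Ω → EllipticSym a Λ →
    0 ≤ lam → MemW1pD u g D Ω 2 → MemLp f 2 (volume.restrict Ω) →
    (∀ i, MemLp (fv i) 2 (volume.restrict Ω)) → MemLp F 2 (volume.restrict Ω) →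
    (∀ x, ∑ i, |fv i x| ≤ F x) → (∀ x, |f x| ≤ Real.sqrt lam * F x) →
    WeakSolMixed a lam u g f fv Ω D → ∀ (z : Euc d) (r : ℝ), 0 < r → ∀ c : ℝ,
    ((D ∩ ball z (2 * r)).Nonempty → c = 0) →
    ∫ x in Ω ∩ ball z r, (‖g x‖ ^ 2 + lam * u x ^ 2) ≤
      C * ((∫ x in Ω ∩ ball z (2 * r), (u x - c) ^ 2) / r ^ 2 +
        (∫ x in Ω ∩ ball z (2 * r), F x ^ 2) + lam * (r ^ d * c ^ 2)) := by
  obtain ⟨L, hL0, hcut⟩ := cutoff_exists d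
  have hub := ub_pos d
  set κ : ℝ := d ^ 2 * Λ⁻¹ with hκd
  have hκ : 0 ≤ κ := by positivity
  set C1 := 4 * κ ^ 2 / Λ + 1 / Λ + 4 with hC1
  have hC1p : 0 < C1 := by positivity
  refine ⟨4 / Λ * C1 * (L ^ 2 + 1 + 2 ^ d * ub d), by positivity, ?_⟩
  intro Ω D a lam u f g fv F hΩ ha hlam hu hf hfv hF hF1 hF2 hw z r hr c hc
  obtain ⟨η, hη, hη1, hηr, hη0, hηL⟩ := hcut z r hr
  have h2 : ENNReal.ofReal 2 = 2 := by simp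
  have hu2 : MemLp u 2 (volume.restrict Ω) := by have := hu.1; rwa [h2] at this
  have hg2 : MemLp g 2 (volume.restrict Ω) := by have := hu.2.1; rwa [h2] at this
  have mA := A_memLp hΛ ha hg2
  have mF := mkV_memLp hfv
  have hF0 : ∀ x, 0 ≤ F x := fun x => (Finset.sum_nonneg fun i _ => abs_nonneg _).trans (hF1 x)
  obtain ⟨hItg, hz⟩ := wform_test (c := c) (mA.sub mF) ((hu2.const_mul lam).add hf)
    (wform_of_weak hΛ ha hu2 hg2 hf hfv hw) hu hη hη1 hηL (fun q hq => by
      by_cases h : q ∈ ball z (2 * r)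
      · exact Or.inl (hc ⟨q, hq, h⟩)
      · exact Or.inr (hη0 q h))
  set P : Euc d → ℝ := fun x => inner ℝ ((mkV (fun i x => ∑ j, a i j x * g x j) - mkV fv) x)
      (η x ^ 2 • g x + (2 * η x * (u x - c)) • gradVec η x) +
      ((fun x => lam * u x) + f) x * (η x ^ 2 * (u x - c)) with hP
  have hz' : ∫ x in Ω, P x = 0 := hz
  have hItg' : IntegrableOn P Ω := hItg
  set B := Ω ∩ ball z (2 * r) with hB
  have hBm : MeasurableSet B := (hΩ.inter isOpen_ball).measurableSet
  have hBΩ : B ⊆ Ω := inter_subset_left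
  have hzB : ∫ x in B, P x = 0 := by
    rw [← hz']
    symm
    refine setIntegral_eq_of_subset_of_forall_sdiff_eq_zero hΩ.measurableSet hBΩ fun x hx => ?_
    have : η x = 0 := hη0 x fun h => hx.2 ⟨hx.1, h⟩
    simp [hP, this]
  have hBfin : volume B < ⊤ := (measure_mono inter_subset_right).trans_lt measure_ball_lt_top
  have : IsFiniteMeasure (volume.restrict B) := ⟨by simpa using hBfin⟩
  have hres : volume.restrict B ≤ volume.restrict Ω := Measure.restrict_mono hBΩ le_rfl
  have ig : IntegrableOn (fun x => ‖g x‖ ^ 2) B := (hg2.norm.mono_measure hres).integrable_sq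
  have iu : IntegrableOn (fun x => u x ^ 2) B := (hu2.mono_measure hres).integrable_sq
  have iw : IntegrableOn (fun x => (u x - c) ^ 2) B :=
    ((hu2.mono_measure hres).sub (memLp_const c)).integrable_sq
  have iF : IntegrableOn (fun x => F x ^ 2) B := (hF.mono_measure hres).integrable_sq
  have ic : IntegrableOn (fun _ : Euc d => lam * c ^ 2) B := integrable_const _
  have iN : IntegrableOn (fun x => ‖g x‖ ^ 2 + lam * u x ^ 2) B := ig.add (iu.const_mul lam)
  set H : Euc d → ℝ := fun x => L ^ 2 / r ^ 2 * (u x - c) ^ 2 + F x ^ 2 + lam * c ^ 2 with hH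
  have iH : IntegrableOn H B := ((iw.const_mul _).add iF).add ic
  have hsub : Ω ∩ ball z r ⊆ B := inter_subset_inter_right _ (ball_subset_ball (by linarith))
  set χ : Euc d → ℝ := (Ω ∩ ball z r).indicator (fun x => ‖g x‖ ^ 2 + lam * u x ^ 2) with hχ
  have hrm : MeasurableSet (Ω ∩ ball z r) := (hΩ.inter isOpen_ball).measurableSet
  have iχ : IntegrableOn χ B := iN.indicator hrm
  have hpt : ∀ x, Λ / 4 * χ x - C1 * H x ≤ P x := by
    intro x
    have hs : Real.sqrt lam ^ 2 = lam := Real.sq_sqrt hlam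
    have hm : ‖mkV fv x‖ ≤ F x := (norm_le_sum _).trans (hF1 x)
    have key := cacc_pt (u := u x) (c := c) hΛ hκ (norm_nonneg (g x)) (hF0 x) (norm_nonneg (gradVec η x))
      (hη1 x).1 (A_coer ha g x)
      ((abs_real_inner_le_norm _ (gradVec η x)).trans
        (mul_le_mul_of_nonneg_right (A_norm hΛ ha g x) (norm_nonneg _)))
      ((abs_real_inner_le_norm (mkV fv x) (g x)).trans
        (mul_le_mul_of_nonneg_right hm (norm_nonneg _)))
      ((abs_real_inner_le_norm (mkV fv x) (gradVec η x)).trans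
        (mul_le_mul_of_nonneg_right hm (norm_nonneg _))) (Real.sqrt_nonneg lam) (hF2 x)
    rw [hs] at key
    have hPe : P x = η x ^ 2 * inner ℝ (mkV (fun i x => ∑ j, a i j x * g x j) x) (g x) +
        2 * η x * (u x - c) * inner ℝ (mkV (fun i x => ∑ j, a i j x * g x j) x) (gradVec η x) -
        η x ^ 2 * inner ℝ (mkV fv x) (g x) - 2 * η x * (u x - c) * inner ℝ (mkV fv x) (gradVec η x) +
        (lam * u x + f x) * (η x ^ 2 * (u x - c)) := by
      simp only [hP, Pi.sub_apply, Pi.add_apply, inner_sub_left, inner_add_right, inner_smul_right]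
      ring
    rw [hPe]
    refine le_trans ?_ key
    have hη2 : η x ^ 2 ≤ 1 := pow_le_one₀ (hη1 x).1 (hη1 x).2
    have t1 : (u x - c) ^ 2 * ‖gradVec η x‖ ^ 2 + η x ^ 2 * F x ^ 2 + η x ^ 2 * (lam * c ^ 2) ≤ H x := by
      have : ‖gradVec η x‖ ^ 2 ≤ L ^ 2 / r ^ 2 := by
        rw [← div_pow]; exact pow_le_pow_left₀ (norm_nonneg _) (hηL x) 2
      simp only [hH]
      refine add_le_add (add_le_add ?_ ?_) ?_
      · rw [mul_comm]; gcongr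
      · exact mul_le_of_le_one_left (by positivity) hη2
      · exact mul_le_of_le_one_left (by positivity) hη2
    have t2 : Λ / 4 * χ x ≤ η x ^ 2 * (Λ / 2 * ‖g x‖ ^ 2 + lam / 4 * u x ^ 2) := by
      by_cases hx : x ∈ Ω ∩ ball z r
      · rw [hχ, indicator_of_mem hx, hηr x hx.2]
        have q1 : 0 ≤ Λ * ‖g x‖ ^ 2 := by positivity
        have q2 : 0 ≤ (1 - Λ) * (lam * u x ^ 2) :=
          mul_nonneg (by linarith) (by positivity)
        nlinarith
      · rw [hχ, indicator_of_notMem hx, mul_zero]; positivity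
    have t3 := mul_le_mul_of_nonneg_left t1 hC1p.le
    linarith
  have hI : Λ / 4 * (∫ x in B, χ x) - C1 * (∫ x in B, H x) ≤ 0 := by
    rw [← hzB, ← integral_const_mul, ← integral_const_mul,
      ← integral_sub (iχ.const_mul _) (iH.const_mul _)]
    exact integral_mono ((iχ.const_mul _).sub (iH.const_mul _)) (hItg'.mono_set hBΩ) hpt
  have hχI : ∫ x in B, χ x = ∫ x in Ω ∩ ball z r, (‖g x‖ ^ 2 + lam * u x ^ 2) := by
    rw [hχ, setIntegral_indicator hrm, inter_eq_self_of_subset_right hsub]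
  set W := ∫ x in B, (u x - c) ^ 2 with hW
  set FF := ∫ x in B, F x ^ 2 with hFF
  have hW0 : 0 ≤ W := integral_nonneg fun x => by positivity
  have hFF0 : 0 ≤ FF := integral_nonneg fun x => by positivity
  have hvB : volume.real B ≤ 2 ^ d * r ^ d * ub d := by
    refine (measureReal_mono inter_subset_right measure_ball_lt_top.ne).trans ?_
    rw [vol_ball _ (by positivity), mul_pow]
  have hHI : ∫ x in B, H x ≤ L ^ 2 * (W / r ^ 2) + FF + 2 ^ d * ub d * (lam * (r ^ d * c ^ 2)) := by
    have e1 : ∫ x in B, H x = L ^ 2 / r ^ 2 * W + FF + volume.real B * (lam * c ^ 2) := by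
      have a1 := integral_add ((iw.const_mul (L ^ 2 / r ^ 2)).add iF) ic
      have a2 := integral_add (iw.const_mul (L ^ 2 / r ^ 2)) iF
      simp only [Pi.add_apply] at a1
      rw [hH, a1, a2, integral_const_mul, setIntegral_const, smul_eq_mul]
    rw [e1]
    have := mul_le_mul_of_nonneg_right hvB (by positivity : 0 ≤ lam * c ^ 2)
    have e2 : L ^ 2 / r ^ 2 * W = L ^ 2 * (W / r ^ 2) := by ring
    nlinarith
  rw [← hχI]
  have hT : 0 ≤ lam * (r ^ d * c ^ 2) := by positivity
  have hS : ∫ x in B, H x ≤ (L ^ 2 + 1 + 2 ^ d * ub d) * (W / r ^ 2 + FF + lam * (r ^ d * c ^ 2)) := by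
    have w0 : 0 ≤ W / r ^ 2 := by positivity
    have k0 : 0 ≤ 2 ^ d * ub d := by positivity
    nlinarith [mul_nonneg k0 w0, mul_nonneg k0 hFF0, mul_nonneg (sq_nonneg L) hFF0,
      mul_nonneg (sq_nonneg L) hT]
  have : ∫ x in B, χ x ≤ 4 / Λ * (C1 * ∫ x in B, H x) := by
    rw [div_mul_eq_mul_div, le_div_iff₀ hΛ]; linarith
  refine this.trans ?_
  have := mul_le_mul_of_nonneg_left hS (by positivity : 0 ≤ 4 / Λ * C1)
  linarith

lemma ind_int_sq {d : ℕ} {Ω E : Set (Euc d)} (hΩ : MeasurableSet Ω) (U : Euc d → ℝ) :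
    ∫ y in E, (Ω.indicator U y) ^ 2 = ∫ y in Ω ∩ E, U y ^ 2 := by
  rw [inter_comm, ← setIntegral_indicator hΩ]
  congr 1; ext y
  by_cases h : y ∈ Ω
  · rw [indicator_of_mem h, indicator_of_mem h]
  · rw [indicator_of_notMem h, indicator_of_notMem h]; simp

lemma ind_int {d : ℕ} {Ω E : Set (Euc d)} (hΩ : MeasurableSet Ω) (U : Euc d → ℝ) :
    ∫ y in E, (Ω.indicator U y) = ∫ y in Ω ∩ E, U y := by
  rw [inter_comm, ← setIntegral_indicator hΩ]

lemma radius_le {d : ℕ} (hd : 1 ≤ d) {x x0 : Euc d} {s R : ℝ} (hs : 0 < s) (hR : 0 < R)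
    (h : ball x s ⊆ ball x0 R) : s ≤ R := by
  have h1 := measureReal_mono (μ := volume) h measure_ball_lt_top.ne
  rw [vol_ball _ hs, vol_ball _ hR] at h1
  have h2 := le_of_mul_le_mul_right h1 (ub_pos d)
  exact (pow_le_pow_iff_left₀ hs.le hR.le (by omega)).1 h2

set_option maxHeartbeats 1000000 in
lemma revH_main (d : ℕ) (hd : 1 ≤ d) {M Λ : ℝ} (hM : 0 < M) (hΛ : 0 < Λ) (hΛ1 : Λ ≤ 1) :
    ∃ A > (0:ℝ), ∀ (m : ℕ) (Ω N D : Set (Euc d)) (γ R1 : ℝ), IsOpen Ω → 0 < γ → γ ≤ 1 / 48 →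
    BoundarySplit Ω N D → ReifenbergFlat Ω γ R1 → FlatSeparation Ω N D m M γ R1 →
    ∀ (a : Fin d → Fin d → Euc d → ℝ) (lam : ℝ) (u f : Euc d → ℝ)
    (g : Euc d → Euc d) (fv : Fin d → Euc d → ℝ) (F : Euc d → ℝ), EllipticSym a Λ →
    0 ≤ lam → MemW1pD u g D Ω 2 → MemLp f 2 (volume.restrict Ω) →
    (∀ i, MemLp (fv i) 2 (volume.restrict Ω)) → MemLp F 2 (volume.restrict Ω) →
    (∀ x, ∑ i, |fv i x| ≤ F x) → (∀ x, |f x| ≤ Real.sqrt lam * F x) →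
    WeakSolMixed a lam u g f fv Ω D → ∀ (x0 : Euc d) (R : ℝ), 0 < R → R ≤ R1 →
    RevH (Ω.indicator fun y => ‖g y‖ + Real.sqrt lam * |u y|) (Ω.indicator F) x0 R 200 A := by
  obtain ⟨C2, hC2, hcacc⟩ := cacc d hΛ hΛ1
  set ε : ℝ := 1 / (4 * 200 ^ d) / (2 * C2) with hε
  have hε0 : 0 < ε := by positivity
  obtain ⟨C, hC, hpoi⟩ := poinc_u d hM hε0
  refine ⟨4 * C2 * C + 2 * C2, by positivity, ?_⟩
  intro m Ω N D γ R1 hΩ hγ0 hγ hsplit hRF hFS a lam u f g fv F ha hlam hu hf hfv hF hF1 hF2 hw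
    x0 R hR hRR z r hr hsub
  have h200 : 200 * r ≤ R := radius_le hd (by positivity) hR hsub
  have hΩm := hΩ.measurableSet
  rw [ind_int_sq hΩm, ind_int_sq hΩm, ind_int_sq hΩm, ind_int hΩm]
  have h2 : ENNReal.ofReal 2 = 2 := by simp
  have hu2 : MemLp u 2 (volume.restrict Ω) := by have := hu.1; rwa [h2] at this
  have hg2 : MemLp g 2 (volume.restrict Ω) := by have := hu.2.1; rwa [h2] at this
  set s := Real.sqrt lam with hs
  have hs0 : 0 ≤ s := Real.sqrt_nonneg _
  have hss : s ^ 2 = lam := Real.sq_sqrt hlam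
  set U : Euc d → ℝ := fun y => ‖g y‖ + s * |u y| with hU
  have hU0 : ∀ y, 0 ≤ U y := fun y => by positivity
  have mU : MemLp U 2 (volume.restrict Ω) := hg2.norm.add (hu2.abs.const_mul s)
  set V := Ω ∩ ball z (200 * r) with hV
  have hVΩ : V ⊆ Ω := inter_subset_left
  have hVfin : volume V < ⊤ := (measure_mono inter_subset_right).trans_lt measure_ball_lt_top
  have : IsFiniteMeasure (volume.restrict V) := ⟨by simpa using hVfin⟩
  have hres : volume.restrict V ≤ volume.restrict Ω := Measure.restrict_mono hVΩ le_rfl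
  set S2 := ∫ y in V, U y ^ 2 with hS2
  set S1 := ∫ y in V, U y with hS1
  set SF := ∫ y in V, F y ^ 2 with hSF
  have hS20 : 0 ≤ S2 := integral_nonneg fun x => by positivity
  have hS10 : 0 ≤ S1 := integral_nonneg hU0
  have hSF0 : 0 ≤ SF := integral_nonneg fun x => by positivity
  by_cases hne : (Ω ∩ ball z (2 * r)).Nonempty
  swap
  · have : Ω ∩ ball z r = ∅ := by
      rw [← subset_empty_iff, ← not_nonempty_iff_eq_empty.1 hne]
      exact inter_subset_inter_right _ (ball_subset_ball (by linarith))
    rw [this]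
    simp only [Measure.restrict_empty, integral_zero_measure]
    positivity
  have iU2 : IntegrableOn (fun y => U y ^ 2) V := (mU.mono_measure hres).integrable_sq
  have iU : IntegrableOn U V := (mU.mono_measure hres).integrable (by norm_num)
  have iF2 : IntegrableOn (fun y => F y ^ 2) V := (hF.mono_measure hres).integrable_sq
  have g2 : ∫ x in V, ‖g x‖ ^ 2 ≤ S2 := by
    refine integral_mono_of_nonneg (ae_of_all _ fun x => by positivity) iU2 (ae_of_all _ fun x => ?_)
    exact pow_le_pow_left₀ (norm_nonneg _) (le_add_of_nonneg_right (by positivity)) 2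
  have g1 : ∫ x in V, ‖g x‖ ≤ S1 := by
    refine integral_mono_of_nonneg (ae_of_all _ fun x => norm_nonneg _) iU (ae_of_all _ fun x => ?_)
    exact le_add_of_nonneg_right (by positivity)
  have u1 : s * ∫ x in V, |u x| ≤ S1 := by
    rw [← integral_const_mul]
    refine integral_mono_of_nonneg (ae_of_all _ fun x => by positivity) iU (ae_of_all _ fun x => ?_)
    exact le_add_of_nonneg_left (norm_nonneg _)
  have hBV : Ω ∩ ball z (2 * r) ⊆ V := inter_subset_inter_right _ (ball_subset_ball (by linarith))
  have F2 : ∫ x in Ω ∩ ball z (2 * r), F x ^ 2 ≤ SF :=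
    setIntegral_mono_set iF2 (ae_of_all _ fun x => by positivity) hBV.eventuallyLE
  have hrV : Ω ∩ ball z r ⊆ V := inter_subset_inter_right _ (ball_subset_ball (by linarith))
  have U2 : ∫ y in Ω ∩ ball z r, U y ^ 2 ≤
      2 * ∫ x in Ω ∩ ball z r, (‖g x‖ ^ 2 + lam * u x ^ 2) := by
    have hres' : volume.restrict (Ω ∩ ball z r) ≤ volume.restrict Ω :=
      Measure.restrict_mono inter_subset_left le_rfl
    rw [← integral_const_mul]
    refine integral_mono (iU2.mono_set hrV) (Integrable.const_mul
      (((hg2.norm.mono_measure hres').integrable_sq).add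
      (((hu2.mono_measure hres').integrable_sq).const_mul lam)) 2) fun x => ?_
    simp only [hU]
    have : (s * |u x|) ^ 2 = lam * u x ^ 2 := by rw [mul_pow, sq_abs, hss]
    rw [← this]
    nlinarith [sq_nonneg (‖g x‖ - s * |u x|)]
  refine le_of_forall_pos_le_add fun e he => ?_
  set δ := e / (2 * C2 * (1 / r ^ 2 + lam)) with hδ
  have hq : 0 < 2 * C2 * (1 / r ^ 2 + lam) := by positivity
  have hδ0 : 0 < δ := by positivity
  obtain ⟨c, hcD, hcP, hcA⟩ := hpoi m Ω N D γ R1 r hΩ hγ0 hγ hsplit hRF hFS hr (by linarith)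
    z u g hu δ hδ0
  have hcA := hcA hne
  have hca := hcacc Ω D a lam u f g fv F hΩ ha hlam hu hf hfv hF hF1 hF2 hw z r hr c hcD
  set Au := ∫ x in V, |u x| with hAu
  have hAu0 : 0 ≤ Au := integral_nonneg fun x => abs_nonneg _
  have w1 : (∫ x in Ω ∩ ball z (2 * r), (u x - c) ^ 2) / r ^ 2 ≤
      ε * S2 + C / r ^ d * S1 ^ 2 + δ / r ^ 2 := by
    rw [div_le_iff₀ (by positivity)]
    refine hcP.trans ?_
    have e1 : (ε * S2 + C / r ^ d * S1 ^ 2 + δ / r ^ 2) * r ^ 2 =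
        r ^ 2 * (ε * S2 + C / r ^ d * S1 ^ 2) + δ := by field_simp
    rw [e1]
    have : 0 ≤ ∫ x in V, ‖g x‖ := integral_nonneg fun x => norm_nonneg _
    gcongr
  have w2 : lam * (r ^ d * c ^ 2) ≤ C / r ^ d * S1 ^ 2 + lam * δ := by
    refine (mul_le_mul_of_nonneg_left hcA hlam).trans ?_
    have e1 : lam * (C / r ^ d * Au ^ 2 + δ) = C / r ^ d * (s * Au) ^ 2 + lam * δ := by
      rw [← hss]; ring
    rw [e1]
    gcongr
  have e2 : 2 * C2 * (δ / r ^ 2 + lam * δ) = e := by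
    rw [show 2 * C2 * (δ / r ^ 2 + lam * δ) = (2 * C2 * (1 / r ^ 2 + lam)) * δ by ring, hδ]
    field_simp
  have e3 : 2 * C2 * ε = 1 / (4 * 200 ^ d) := by rw [hε]; field_simp
  have t : 2 * C2 * ((∫ x in Ω ∩ ball z (2 * r), (u x - c) ^ 2) / r ^ 2 +
        (∫ x in Ω ∩ ball z (2 * r), F x ^ 2) + lam * (r ^ d * c ^ 2)) ≤
      2 * C2 * ((ε * S2 + C / r ^ d * S1 ^ 2 + δ / r ^ 2) + SF +
        (C / r ^ d * S1 ^ 2 + lam * δ)) :=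
    mul_le_mul_of_nonneg_left (add_le_add (add_le_add w1 F2) w2) (by positivity)
  have e4 : 2 * C2 * ((ε * S2 + C / r ^ d * S1 ^ 2 + δ / r ^ 2) + SF +
        (C / r ^ d * S1 ^ 2 + lam * δ)) = (2 * C2 * ε) * S2 + 4 * C2 * C / r ^ d * S1 ^ 2 +
        2 * C2 * SF + 2 * C2 * (δ / r ^ 2 + lam * δ) := by ring
  rw [e4, e2, e3] at t
  have e5 : (4 * C2 * C + 2 * C2) / r ^ d * S1 ^ 2 = 4 * C2 * C / r ^ d * S1 ^ 2 +
      2 * C2 / r ^ d * S1 ^ 2 := by ring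
  have p1 : 0 ≤ 2 * C2 / r ^ d * S1 ^ 2 := by positivity
  have p2 : 0 ≤ 4 * C2 * C * SF := by positivity
  rw [e5]
  linarith

lemma memLp_rpow_int {d : ℕ} {F : Euc d → ℝ} {Ω E : Set (Euc d)} {p p0 : ℝ} (hp0 : 0 < p0)
    (hpp : p0 ≤ p) (hΩ : MeasurableSet Ω) (hE : volume E < ⊤) (hF0 : ∀ x, 0 ≤ F x)
    (hF : MemLp F (ENNReal.ofReal p) (volume.restrict Ω)) :
    IntegrableOn (fun x => (Ω.indicator F x) ^ p0) E := by
  have h1 : MemLp (Ω.indicator F) (ENNReal.ofReal p) volume := (memLp_indicator_iff_restrict hΩ).2 hF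
  have : IsFiniteMeasure (volume.restrict E) := ⟨by simpa using hE⟩
  have h2 : MemLp (Ω.indicator F) (ENNReal.ofReal p0) (volume.restrict E) :=
    (h1.restrict E).mono_exponent (ENNReal.ofReal_le_ofReal hpp)
  have h3 := h2.integrable_norm_rpow (by simpa using hp0) ENNReal.ofReal_ne_top
  rw [ENNReal.toReal_ofReal hp0.le] at h3
  refine h3.congr (ae_of_all _ fun x => ?_)
  simp only
  rw [Real.norm_of_nonneg (indicator_nonneg (fun x _ => hF0 x) x)]

lemma main_unified (d : ℕ) (hd : 1 ≤ d) {M Λ p : ℝ} (hM : 0 < M) (hΛ : 0 < Λ) (hΛ1 : Λ ≤ 1)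
    (hp : 2 < p) :
    ∃ p0 ∈ Ioo (2:ℝ) p, ∃ C > (0:ℝ), ∀ (m : ℕ) (Ω N D : Set (Euc d)) (γ R1 : ℝ), IsOpen Ω →
    0 < γ → γ ≤ 1 / 48 →
    BoundarySplit Ω N D → ReifenbergFlat Ω γ R1 → FlatSeparation Ω N D m M γ R1 →
    ∀ (a : Fin d → Fin d → Euc d → ℝ) (lam : ℝ) (u f : Euc d → ℝ)
    (g : Euc d → Euc d) (fv : Fin d → Euc d → ℝ) (F : Euc d → ℝ), EllipticSym a Λ →
    0 ≤ lam → MemW1pD u g D Ω 2 → MemLp f 2 (volume.restrict Ω) →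
    (∀ i, MemLp (fv i) 2 (volume.restrict Ω)) → MemLp F 2 (volume.restrict Ω) →
    MemLp F (ENNReal.ofReal p) (volume.restrict Ω) →
    (∀ x, ∑ i, |fv i x| ≤ F x) → (∀ x, |f x| ≤ Real.sqrt lam * F x) →
    WeakSolMixed a lam u g f fv Ω D → ∀ (x0 : Euc d) (R : ℝ), 0 < R → R ≤ R1 →
    (avg (ball x0 (R / 2)) (fun x =>
        (Ω.indicator (fun y => ‖g y‖ + Real.sqrt lam * |u y|) x) ^ p0)) ^ (1 / p0)
      ≤ C * (avg (ball x0 R) (fun x =>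
          (Ω.indicator (fun y => ‖g y‖ + Real.sqrt lam * |u y|) x) ^ (2 : ℝ))) ^ ((1 : ℝ) / 2)
        + C * (avg (ball x0 R) (fun x => (Ω.indicator F x) ^ p0)) ^ (1 / p0) := by
  obtain ⟨A, hA, hrev⟩ := revH_main d hd hM hΛ hΛ1
  obtain ⟨p0, hp0, C, hC, hg⟩ := gehring_avg d hd 200 A p (by norm_num) hA hp
  refine ⟨p0, hp0, C, hC, ?_⟩
  intro m Ω N D γ R1 hΩ hγ0 hγ hsplit hRF hFS a lam u f g fv F ha hlam hu hf hfv hF hFp hF1 hF2 hw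
    x0 R hR hRR
  have hΩm := hΩ.measurableSet
  have h2 : ENNReal.ofReal 2 = 2 := by simp
  have hu2 : MemLp u 2 (volume.restrict Ω) := by have := hu.1; rwa [h2] at this
  have hg2 : MemLp g 2 (volume.restrict Ω) := by have := hu.2.1; rwa [h2] at this
  have hF0 : ∀ x, 0 ≤ F x := fun x => (Finset.sum_nonneg fun i _ => abs_nonneg _).trans (hF1 x)
  have mU : MemLp (fun y => ‖g y‖ + Real.sqrt lam * |u y|) 2 (volume.restrict Ω) :=
    hg2.norm.add (hu2.abs.const_mul _)
  have mU' := (memLp_indicator_iff_restrict hΩm).2 mU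
  have mF' := (memLp_indicator_iff_restrict hΩm).2 hF
  refine hg _ _ mU'.1 mF'.1 (fun x => indicator_nonneg (fun y _ => by positivity) x)
    (fun x => indicator_nonneg (fun y _ => hF0 y) x) x0 R hR mU'.integrable_sq.integrableOn
    mF'.integrable_sq.integrableOn
    (memLp_rpow_int (by linarith [hp0.1]) hp0.2.le hΩm measure_ball_lt_top hF0 hFp)
    (hrev m Ω N D γ R1 hΩ hγ0 hγ hsplit hRF hFS a lam u f g fv F ha hlam hu hf hfv hF hF1 hF2 hw
      x0 R hR hRR)

/-- Proposition 4.2 (reverse Hölder inequality): under `γ`-Reifenberg flatness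
(`γ ≤ 1/48`), a `(γ,m)`-flat separation and uniformly elliptic symmetric coefficients,
there are `p0 ∈ (2,p)` and `C = C(d,p,M,Λ)` such that the zero extensions `Ū, F̄` of
`U = |∇u| + √λ|u|` and `F = Σ|f_i| + λ^{-1/2}|f|` satisfy
`((Ū^{p0})_{B_{R/2}(x0)})^{1/p0} ≤ C ((Ū²)_{B_R(x0)})^{1/2} + C ((F̄^{p0})_{B_R(x0)})^{1/p0}`
for all `x0 ∈ ℝ^d` and `R ∈ (0,R1]`; and analogously with `λ = 0` when `f ≡ 0`. -/
theorem reverse_holder_mixed (d m : ℕ) (hd : 2 ≤ d) (hm : m + 2 ≤ d)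
    (M Λ : ℝ) (hM : 0 < M) (hΛ : Λ ∈ Set.Ioc (0 : ℝ) 1)
    (γ : ℝ) (hγ : γ ∈ Set.Ioc (0 : ℝ) (1 / 48)) (p : ℝ) (hp : 2 < p) :
    ∃ p0 ∈ Set.Ioo (2 : ℝ) p, ∃ C > (0 : ℝ),
      ∀ R1 > (0 : ℝ), ∀ Ω N D : Set (Euc d), IsOpen Ω → BoundarySplit Ω N D →
        ReifenbergFlat Ω γ R1 → FlatSeparation Ω N D m M γ R1 →
        ∀ a : Fin d → Fin d → Euc d → ℝ, EllipticSym a Λ →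
        (∀ lam > (0 : ℝ), ∀ f : Euc d → ℝ, ∀ fv : Fin d → Euc d → ℝ,
          ∀ u : Euc d → ℝ, ∀ g : Euc d → Euc d,
          MemLp f (ENNReal.ofReal p) (volume.restrict Ω) →
          MemLp f 2 (volume.restrict Ω) →
          (∀ i, MemLp (fv i) (ENNReal.ofReal p) (volume.restrict Ω) ∧
            MemLp (fv i) 2 (volume.restrict Ω)) →
          MemW1pD u g D Ω 2 → WeakSolMixed a lam u g f fv Ω D →
          ∀ x0 : Euc d, ∀ R ∈ Set.Ioc (0 : ℝ) R1,
            (avg (ball x0 (R / 2)) (fun x =>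
                (Set.indicator Ω (fun y => ‖g y‖ + Real.sqrt lam * |u y|) x) ^ p0))
                  ^ (1 / p0)
              ≤ C * (avg (ball x0 R) (fun x =>
                  (Set.indicator Ω (fun y => ‖g y‖ + Real.sqrt lam * |u y|) x)
                    ^ (2 : ℝ))) ^ ((1 : ℝ) / 2)
                + C * (avg (ball x0 R) (fun x =>
                  (Set.indicator Ω (fun y =>
                    (∑ i, |fv i y|) + (Real.sqrt lam)⁻¹ * |f y|) x) ^ p0)) ^ (1 / p0)) ∧
        (∀ fv : Fin d → Euc d → ℝ, ∀ u : Euc d → ℝ, ∀ g : Euc d → Euc d,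
          (∀ i, MemLp (fv i) (ENNReal.ofReal p) (volume.restrict Ω) ∧
            MemLp (fv i) 2 (volume.restrict Ω)) →
          MemW1pD u g D Ω 2 → WeakSolMixed a 0 u g (fun _ => 0) fv Ω D →
          ∀ x0 : Euc d, ∀ R ∈ Set.Ioc (0 : ℝ) R1,
            (avg (ball x0 (R / 2)) (fun x =>
                (Set.indicator Ω (fun y => ‖g y‖) x) ^ p0)) ^ (1 / p0)
              ≤ C * (avg (ball x0 R) (fun x =>
                  (Set.indicator Ω (fun y => ‖g y‖) x) ^ (2 : ℝ))) ^ ((1 : ℝ) / 2)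
                + C * (avg (ball x0 R) (fun x =>
                  (Set.indicator Ω (fun y => ∑ i, |fv i y|) x) ^ p0)) ^ (1 / p0)) := by
  obtain ⟨p0, hp0, C, hC, H⟩ := main_unified d (by omega) hM hΛ.1 hΛ.2 hp
  refine ⟨p0, hp0, C, hC, ?_⟩
  intro R1 hR1 Ω N D hΩ hsplit hRF hFS a ha
  constructor
  · intro lam hlam f fv u g hfp hf2 hfv hu hw x0 R hR
    have hs : 0 < Real.sqrt lam := Real.sqrt_pos.2 hlam
    refine H m Ω N D γ R1 hΩ hγ.1 hγ.2 hsplit hRF hFS a lam u f g fv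
      (fun y => (∑ i, |fv i y|) + (Real.sqrt lam)⁻¹ * |f y|) ha hlam.le hu hf2
      (fun i => (hfv i).2)
      ((memLp_finsetSum _ fun i _ => (hfv i).2.abs).add (hf2.abs.const_mul _))
      ((memLp_finsetSum _ fun i _ => (hfv i).1.abs).add (hfp.abs.const_mul _))
      (fun x => le_add_of_nonneg_right (by positivity)) (fun x => ?_) hw x0 R hR.1 hR.2
    have h0 : 0 ≤ Real.sqrt lam * ∑ i, |fv i x| :=
      mul_nonneg hs.le (Finset.sum_nonneg fun i _ => abs_nonneg _)
    rw [mul_add, mul_inv_cancel_left₀ hs.ne']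
    linarith
  · intro fv u g hfv hu hw x0 R hR
    have := H m Ω N D γ R1 hΩ hγ.1 hγ.2 hsplit hRF hFS a 0 u (fun _ => 0) g fv
      (fun y => ∑ i, |fv i y|) ha le_rfl hu MemLp.zero'
      (fun i => (hfv i).2)
      (memLp_finsetSum _ fun i _ => (hfv i).2.abs)
      (memLp_finsetSum _ fun i _ => (hfv i).1.abs)
      (fun x => le_rfl) (fun x => by simp) hw x0 R hR.1 hR.2
    simpa only [Real.sqrt_zero, zero_mul, add_zero] using this
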